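/- Let L/K satisfy condition (ram) with parameter n, let K_i be the fixed field of G^i, and let m_{i+1} be the maximal ideal of the ring of integers of K_{i+1}. Then for every integer k with 0 ≤ k ≤ p−1 and every 1 ≤ i ≤ n, the trace satisfies Tr_{K_{i+1}/K_i}(m_{i+1}^k) = π·O_{K_i}. -/

import Mathlib

noncomputable section

open scoped Classical

/-- An additive `ℚ ∪ {∞}`-valued valuation on a field `A`, normalized by `v p = 1`.
This models the `p`-adic valuation `v_p` on (an algebraic closure of) `ℚ_p`,
with the convention `v 0 = ∞`. -/
structure PadicValData (A : Type) [Field A] (p : ℕ) : Type where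
  v : A → WithTop ℚ
  v_top_iff : ∀ x : A, v x = ⊤ ↔ x = 0
  v_mul : ∀ x y : A, v (x * y) = v x + v y
  v_min_le_add : ∀ x y : A, min (v x) (v y) ≤ v (x + y)
  v_coe_p : v (p : A) = 1

variable {p : ℕ} {A : Type} [Field A]

/-- `x ∈ F` is a uniformizer of the `p`-adic field `F` (embedded in `A` by `emb`):
its valuation is minimal among the positive valuations of elements of `F`. -/
def IsUniformizer (vd : PadicValData A p) {F : Type} [Field F] (emb : F →+* A) (x : F) : Prop :=
  x ≠ 0 ∧ 0 < vd.v (emb x) ∧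
    ∀ y : F, 0 < vd.v (emb y) → vd.v (emb x) ≤ vd.v (emb y)

/-- `y` belongs to the `j`-th power `m_F^j` of the maximal ideal of the ring of integers
`O_F` of `F` (embedded in `A` by `emb`): `y` is a multiple, by an element of `O_F`, of a
product of `j` elements of the maximal ideal `m_F`.  (For `j = 0` this says `y ∈ O_F`.) -/
def InMaxIdealPow (vd : PadicValData A p) {F : Type} [Field F] (emb : F →+* A) (j : ℕ)
    (y : A) : Prop :=
  ∃ (u : F) (s : Fin j → F), 0 ≤ vd.v (emb u) ∧ (∀ k, 0 < vd.v (emb (s k))) ∧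
    y = emb u * ∏ k, emb (s k)

/-- The lower-numbering ramification set
`G_i = {σ ∈ Gal(L/K) | ∀ x ∈ O_L, σ x - x ∈ m_L^{i+1}}` (with `G_i = G` for `i ≤ -1`). -/
def lowerRamSet (vd : PadicValData A p) (K L : Type) [Field K] [Field L] [Algebra K L]
    (emb : L →+* A) (i : ℤ) : Set (L ≃ₐ[K] L) :=
  {σ | ∀ x : L, 0 ≤ vd.v (emb x) →
    InMaxIdealPow vd emb (i + 1).toNat (emb (σ x) - emb x)}

/-- The Herbrand function `φ_{L/K}(u) = ∫_0^u dt / (G_0 : G_t)`, where `G_t = G_{⌈t⌉}`. -/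
noncomputable def herbrandPhi (vd : PadicValData A p) (K L : Type) [Field K] [Field L]
    [Algebra K L] (emb : L →+* A) (u : ℝ) : ℝ :=
  ∫ t in (0:ℝ)..u,
    (Nat.card ↥(lowerRamSet vd K L emb ⌈t⌉) : ℝ) /
      (Nat.card ↥(lowerRamSet vd K L emb 0) : ℝ)

/-- The Herbrand function `ψ_{L/K}`, the inverse of `φ_{L/K}`. -/
noncomputable def herbrandPsi (vd : PadicValData A p) (K L : Type) [Field K] [Field L]
    [Algebra K L] (emb : L →+* A) (w : ℝ) : ℝ :=
  Function.invFun (herbrandPhi vd K L emb) w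

/-- The upper-numbering ramification set `G^i = G_{ψ_{L/K}(i)}` of `Gal(L/K)`. -/
def upperRamSet (vd : PadicValData A p) (K L : Type) [Field K] [Field L] [Algebra K L]
    (emb : L →+* A) (i : ℤ) : Set (L ≃ₐ[K] L) :=
  lowerRamSet vd K L emb ⌈herbrandPsi vd K L emb (i : ℝ)⌉

/-- Condition (ram): the upper ramification groups of `L/K` satisfy
`G = G^{-1} = G^0 ⊇ G^1 ⊋ G^2 ⊋ ⋯ ⊋ G^n ⊋ G^{n+1} = {1}`, with `G^i/G^{i+1}` of order `p`
for `1 ≤ i ≤ n` and `G^0/G^1` of order `p - 1`. -/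
def RamCond (vd : PadicValData A p) (K L : Type) [Field K] [Field L] [Algebra K L]
    (emb : L →+* A) (n : ℕ) : Prop :=
  upperRamSet vd K L emb (-1) = Set.univ ∧
  upperRamSet vd K L emb 0 = Set.univ ∧
  (∀ i : ℤ, upperRamSet vd K L emb (i + 1) ⊆ upperRamSet vd K L emb i) ∧
  Nat.card ↥(upperRamSet vd K L emb 0)
    = (p - 1) * Nat.card ↥(upperRamSet vd K L emb 1) ∧
  (∀ i : ℕ, 1 ≤ i → i ≤ n →
    Nat.card ↥(upperRamSet vd K L emb (i : ℤ))
      = p * Nat.card ↥(upperRamSet vd K L emb ((i : ℤ) + 1))) ∧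
  upperRamSet vd K L emb ((n : ℤ) + 1) = {1}

/-- The local resolvent `⟨α|χ⟩ = ∑_{γ ∈ Gal(L/K)} χ(γ) γ(α)`, computed in `A`. -/
noncomputable def localResolvent (K L : Type) [Field K] [Field L] [Algebra K L]
    (emb : L →+* A) (χ : (L ≃ₐ[K] L) → A) (α : L) : A :=
  ∑ᶠ γ : L ≃ₐ[K] L, χ γ * emb (γ α)

end

section

namespace HA

section basics
variable {L : Type*} [Field L] (w : AddValuation L (WithTop ℤ))

theorem lt_iff_add_one_le {m : ℤ} {x : WithTop ℤ} : (m : WithTop ℤ) < x ↔ ((m + 1 : ℤ) : WithTop ℤ) ≤ x := by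
  induction x using WithTop.recTopCoe with
  | top => simp
  | coe x => norm_cast

theorem exists_int {x : L} (hx : x ≠ 0) : ∃ m : ℤ, w x = (m : WithTop ℤ) := by
  have := (w.ne_top_iff (x := x)).2 hx
  lift w x to ℤ using this with m
  exact ⟨m, rfl⟩

theorem ge_mul {x y : L} {m n : ℤ} (hx : (m : WithTop ℤ) ≤ w x) (hy : (n : WithTop ℤ) ≤ w y) :
    ((m + n : ℤ) : WithTop ℤ) ≤ w (x * y) := by
  rw [w.map_mul]; push_cast; exact add_le_add hx hy

theorem eq_mul {x y : L} {m n : ℤ} (hx : w x = m) (hy : w y = n) :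
    w (x * y) = ((m + n : ℤ) : WithTop ℤ) := by
  rw [w.map_mul, hx, hy]; push_cast; rfl

theorem eq_pow {x : L} {m : ℤ} (hx : w x = m) (k : ℕ) :
    w (x ^ k) = ((k * m : ℤ) : WithTop ℤ) := by
  induction k with
  | zero => simp
  | succ k ih => rw [pow_succ, eq_mul w ih hx]; congr 1; push_cast; ring

theorem ne_zero_of_eq {x : L} {m : ℤ} (hx : w x = m) : x ≠ 0 := by
  rintro rfl; simp at hx

theorem eq_div {x y : L} {m n : ℤ} (hx : w x = m) (hy : w y = n) :
    w (x / y) = ((m - n : ℤ) : WithTop ℤ) := by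
  have hy0 := ne_zero_of_eq w hy
  have hx0 := ne_zero_of_eq w hx
  obtain ⟨k, hk⟩ := exists_int w (div_ne_zero hx0 hy0)
  have := eq_mul w hk hy
  rw [div_mul_cancel₀ _ hy0, hx] at this
  rw [hk]; norm_cast at this ⊢; omega

theorem ge_div {x y : L} {m n : ℤ} (hx : (m : WithTop ℤ) ≤ w x) (hy : w y = n) :
    ((m - n : ℤ) : WithTop ℤ) ≤ w (x / y) := by
  by_cases h : x = 0
  · simp [h]
  obtain ⟨k, hk⟩ := exists_int w h
  rw [eq_div w hk hy]; rw [hk] at hx; norm_cast at hx ⊢; omega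

theorem ge_mono {x : WithTop ℤ} {m n : ℤ} (hx : (m : WithTop ℤ) ≤ x) (h : n ≤ m) :
    (n : WithTop ℤ) ≤ x := le_trans (by exact_mod_cast h) hx

theorem eq_add {x y : L} {m : ℤ} (hx : w x = m) (hy : ((m + 1 : ℤ) : WithTop ℤ) ≤ w y) :
    w (x + y) = m := by
  rw [w.map_add_eq_of_lt_left, hx]
  rw [hx]; exact lt_iff_add_one_le.2 hy

theorem eq_of_sub {x y : L} {m : ℤ} (hx : w x = m) (hy : ((m + 1 : ℤ) : WithTop ℤ) ≤ w (y - x)) :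
    w y = m := by
  have := eq_add w hx hy
  rwa [add_sub_cancel] at this

theorem ge_prod {ι : Type*} (s : Finset ι) (f : ι → L) (m : ι → ℤ)
    (h : ∀ i ∈ s, (m i : WithTop ℤ) ≤ w (f i)) :
    ((∑ i ∈ s, m i : ℤ) : WithTop ℤ) ≤ w (∏ i ∈ s, f i) := by
  classical
  induction s using Finset.induction_on with
  | empty => simp
  | insert a s ha ih =>
    rw [Finset.sum_insert ha, Finset.prod_insert ha]
    exact ge_mul w (h a (by simp)) (ih fun i hi => h i (by simp [hi]))

theorem eq_prod {ι : Type*} (s : Finset ι) (f : ι → L) (m : ι → ℤ)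
    (h : ∀ i ∈ s, w (f i) = m i) :
    w (∏ i ∈ s, f i) = ((∑ i ∈ s, m i : ℤ) : WithTop ℤ) := by
  classical
  induction s using Finset.induction_on with
  | empty => simp
  | insert a s ha ih =>
    rw [Finset.sum_insert ha, Finset.prod_insert ha]
    exact eq_mul w (h a (by simp)) (ih fun i hi => h i (by simp [hi]))

theorem nat_ge (n : ℕ) : ((0 : ℤ) : WithTop ℤ) ≤ w (n : L) := by
  induction n with
  | zero => simp
  | succ k ih => push_cast; exact w.map_le_add ih (by simp)

theorem int_ge (n : ℤ) : ((0 : ℤ) : WithTop ℤ) ≤ w (n : L) := by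
  obtain ⟨k, rfl | rfl⟩ := n.eq_nat_or_neg
  · exact_mod_cast nat_ge w k
  · push_cast; rw [w.map_neg]; exact_mod_cast nat_ge w k

theorem nat_eq_zero {p : ℕ} (hp : p.Prime) (wp : ((1 : ℤ) : WithTop ℤ) ≤ w (p : L)) {n : ℕ}
    (hn : ¬ p ∣ n) : w (n : L) = ((0 : ℤ) : WithTop ℤ) := by
  have hc : IsCoprime (n : ℤ) (p : ℤ) :=
    Nat.isCoprime_iff_coprime.2 ((Nat.Prime.coprime_iff_not_dvd hp).2 hn).symm
  obtain ⟨a, b, hab⟩ := hc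
  have h1 : w ((a : L) * n) = ((0 : ℤ) : WithTop ℤ) := by
    have : (a : L) * n = 1 + (-((b : L) * p)) := by
      have : ((a * n + b * p : ℤ) : L) = 1 := by rw [hab]; simp
      push_cast at this; linear_combination this
    rw [this]
    apply eq_add w (by simp)
    rw [w.map_neg]
    simpa using ge_mul w (int_ge w b) wp
  have hn0 : (n : L) ≠ 0 := by
    intro h; rw [h] at h1; simp at h1
  have ha0 : (a : L) ≠ 0 := by
    intro h; rw [h] at h1; simp at h1
  obtain ⟨k, hk⟩ := exists_int w hn0
  obtain ⟨l, hl⟩ := exists_int w ha0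
  have h2 := nat_ge w n
  have h3 := int_ge w a
  have h4 := eq_mul w hl hk
  rw [h1] at h4
  rw [hk] at h2 ⊢
  rw [hl] at h3
  norm_cast at *; omega

/-- sum with valuations pairwise distinct mod d -/
theorem le_of_sum_distinct {ι : Type*} (s : Finset ι) (f : ι → L)
    (h : ∀ i ∈ s, ∀ j ∈ s, i ≠ j → w (f i) = w (f j) → f i = 0) :
    ∀ i ∈ s, w (∑ j ∈ s, f j) ≤ w (f i) := by
  classical
  intro i hi
  obtain ⟨i0, hi0, hmin⟩ := s.exists_min_image (fun j => w (f j)) ⟨i, hi⟩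
  refine le_trans ?_ (hmin i hi)
  by_cases h0 : f i0 = 0
  · simp [h0]
  rw [← Finset.add_sum_erase s f hi0]
  obtain ⟨m, hm⟩ := exists_int w h0
  rw [eq_add w hm, hm]
  apply w.map_le_sum
  intro j hj
  rw [Finset.mem_erase] at hj
  rw [← lt_iff_add_one_le, ← hm]
  refine lt_of_le_of_ne (hmin j hj.2) ?_
  intro he
  exact h0 (h i0 hi0 j hj.2 hj.1.symm he)

end basics

structure Setup (K L : Type*) [Field K] [Field L] [Algebra K L] (p : ℕ)
    (w : AddValuation L (WithTop ℤ)) (Pi : L) : Prop where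
  pp : p.Prime
  inv : ∀ (g : L ≃ₐ[K] L) (x : L), w (g x) = w x
  unif : w Pi = ((1 : ℤ) : WithTop ℤ)
  res : ∀ x : L, ((0 : ℤ) : WithTop ℤ) ≤ w x → ∃ c : K, ((1 : ℤ) : WithTop ℤ) ≤ w (x - algebraMap K L c)
  tr : ∀ c : K, c ≠ 0 → ∃ m : ℤ, w (algebraMap K L c) = ((Module.finrank K L * m : ℤ) : WithTop ℤ)
  wp : ((1 : ℤ) : WithTop ℤ) ≤ w (p : L)

namespace Setup
variable {K L : Type*} [Field K] [Field L] [Algebra K L] {p : ℕ}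
    {w : AddValuation L (WithTop ℤ)} {Pi : L} (S : Setup K L p w Pi)
include S

theorem pi_ne : Pi ≠ 0 := ne_zero_of_eq w S.unif

theorem eq_pi_pow (m : ℕ) : w (Pi ^ m) = ((m : ℤ) : WithTop ℤ) := by
  simpa using eq_pow w S.unif m

/-- approximate by c * y -/
theorem approx {x y : L} {m : ℤ} (hx : (m : WithTop ℤ) ≤ w x) (hy : w y = m) :
    ∃ c : K, ((0 : ℤ) : WithTop ℤ) ≤ w (algebraMap K L c) ∧
      ((m + 1 : ℤ) : WithTop ℤ) ≤ w (x - algebraMap K L c * y) := by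
  have hy0 := ne_zero_of_eq w hy
  have h0 := ge_div w hx hy
  rw [sub_self] at h0
  obtain ⟨c, hc⟩ := S.res _ h0
  refine ⟨c, ?_, ?_⟩
  · have : algebraMap K L c = x / y - (x / y - algebraMap K L c) := by ring
    rw [this]
    exact w.map_le_sub h0 (ge_mono hc (by norm_num))
  · have := ge_mul w hy.ge hc
    convert this using 2
    field_simp

theorem ge_pow_sub (g : L ≃ₐ[K] L) {i : ℤ} (hi : (i : WithTop ℤ) ≤ w (g Pi - Pi)) (m : ℕ) :
    ((m - 1 + i : ℤ) : WithTop ℤ) ≤ w (g (Pi ^ m) - Pi ^ m) := by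
  induction m with
  | zero => simp
  | succ m ih =>
    have : g (Pi ^ (m+1)) - Pi ^ (m+1) = g Pi * (g (Pi ^ m) - Pi ^ m) + (g Pi - Pi) * Pi ^ m := by
      simp only [map_pow]; ring
    rw [this]
    apply w.map_le_add
    · have := ge_mul w ((S.inv g Pi).trans S.unif).ge ih
      refine ge_mono this (by push_cast; omega)
    · have := ge_mul w hi (S.eq_pi_pow m).ge
      refine ge_mono this (by push_cast; omega)

theorem ge_sub_aux (g : L ≃ₐ[K] L) {i : ℤ} (hi : (i : WithTop ℤ) ≤ w (g Pi - Pi)) (m : ℕ) (k : ℕ) :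
    ∀ (r : ℕ), (m - 1 + i : ℤ) ≤ m + r + k → ∀ x : L, ((m + r : ℤ) : WithTop ℤ) ≤ w x →
     ((m - 1 + i : ℤ) : WithTop ℤ) ≤ w (g x - x) := by
  induction k with
  | zero =>
    intro r hr x hx
    exact ge_mono (w.map_le_sub ((S.inv g x).symm ▸ hx) hx) (by simpa using hr)
  | succ k ih =>
    intro r hr x hx
    obtain ⟨c, hc, hc'⟩ := S.approx hx (y := Pi ^ (m + r)) (by rw [S.eq_pi_pow]; push_cast; rfl)
    have h1 := ih (r+1) (by push_cast at hr ⊢; omega) _ (by push_cast; rw [← add_assoc]; exact_mod_cast hc')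
    have h2 := ge_mul w hc (S.ge_pow_sub g hi (m+r))
    have : g x - x = (g (x - algebraMap K L c * Pi ^ (m+r)) - (x - algebraMap K L c * Pi ^ (m+r)))
        + algebraMap K L c * (g (Pi ^ (m+r)) - Pi ^ (m+r)) := by
      rw [map_sub, map_mul, g.commutes]; ring
    rw [this]
    exact w.map_le_add h1 (ge_mono h2 (by push_cast; omega))

theorem ge_sub (g : L ≃ₐ[K] L) {i : ℤ} (hi : (i : WithTop ℤ) ≤ w (g Pi - Pi)) (m : ℕ)
    {x : L} (hx : ((m : ℤ) : WithTop ℤ) ≤ w x) :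
     ((m - 1 + i : ℤ) : WithTop ℤ) ≤ w (g x - x) :=
  S.ge_sub_aux g hi m i.toNat 0 (by push_cast; omega) x (by simpa using hx)

theorem ge_sub0 (g : L ≃ₐ[K] L) {i : ℤ} (hi : (i : WithTop ℤ) ≤ w (g Pi - Pi))
    {x : L} (hx : ((0 : ℤ) : WithTop ℤ) ≤ w x) :
     (i : WithTop ℤ) ≤ w (g x - x) := by
  obtain ⟨c, hc⟩ := S.res x hx
  have := S.ge_sub g hi 1 hc
  simpa using this

theorem one_le (g : L ≃ₐ[K] L) : ((1 : ℤ) : WithTop ℤ) ≤ w (g Pi - Pi) :=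
  w.map_le_sub ((S.inv g Pi).trans S.unif).ge S.unif.ge

/-- expansions -/
theorem distinct_aux (c : ℕ → K) {i j : ℕ} (hi : i < Module.finrank K L) (hj : j < Module.finrank K L)
    (hij : i ≠ j) (h : w (algebraMap K L (c i) * Pi ^ i) = w (algebraMap K L (c j) * Pi ^ j)) :
    algebraMap K L (c i) * Pi ^ i = 0 := by
  by_contra hne
  have h0 : c i ≠ 0 := by rintro h; simp [h] at hne
  have h0' : c j ≠ 0 := by
    rintro h'; rw [h', map_zero, zero_mul, w.map_zero, w.top_iff] at h; exact hne h
  obtain ⟨a, ha⟩ := S.tr _ h0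
  obtain ⟨b, hb⟩ := S.tr _ h0'
  rw [eq_mul w ha (S.eq_pi_pow i), eq_mul w hb (S.eq_pi_pow j)] at h
  norm_cast at h
  have h1 : (i : ℤ) % Module.finrank K L = i := Int.emod_eq_of_lt (by omega) (by omega)
  have h2 : (j : ℤ) % Module.finrank K L = j := Int.emod_eq_of_lt (by omega) (by omega)
  have h3 : ((Module.finrank K L : ℤ) * a + i) % Module.finrank K L = i := by
    rw [Int.mul_add_emod_self_left, h1]
  have h4 : ((Module.finrank K L : ℤ) * b + j) % Module.finrank K L = j := by
    rw [Int.mul_add_emod_self_left, h2]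
  rw [h, h4] at h3
  omega

theorem expand [FiniteDimensional K L] {x : L} (hx : ((0 : ℤ) : WithTop ℤ) ≤ w x) :
    ∃ c : ℕ → K, (∀ j < Module.finrank K L, ((0 : ℤ) : WithTop ℤ) ≤ w (algebraMap K L (c j))) ∧
      x = ∑ j ∈ Finset.range (Module.finrank K L), algebraMap K L (c j) * Pi ^ j := by
  set d := Module.finrank K L with hd
  have hli : LinearIndependent K (fun j : Fin d => Pi ^ (j : ℕ)) := by
    rw [Fintype.linearIndependent_iff]
    intro g hg i
    let c : ℕ → K := fun j => if h : j < d then g ⟨j, h⟩ else 0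
    have hs : ∑ j ∈ Finset.range d, algebraMap K L (c j) * Pi ^ j = 0 := by
      rw [Finset.sum_range, ← hg]
      apply Finset.sum_congr rfl
      intro j _
      simp [c, Algebra.smul_def]
    have := le_of_sum_distinct w (Finset.range d) (fun j => algebraMap K L (c j) * Pi ^ j)
      (fun i hi j hj hij h => S.distinct_aux c (by simpa using hi) (by simpa using hj) hij h)
      i (by simp)
    rw [hs, w.map_zero, top_le_iff, w.top_iff] at this
    simpa [S.pi_ne, c] using this
  let B := basisOfLinearIndependentOfCardEqFinrank' _ hli (by simp [hd])
  let c : ℕ → K := fun j => if h : j < d then B.repr x ⟨j, h⟩ else 0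
  have hs : x = ∑ j ∈ Finset.range d, algebraMap K L (c j) * Pi ^ j := by
    rw [Finset.sum_range]
    conv_lhs => rw [← B.sum_repr x]
    apply Finset.sum_congr rfl
    intro j _
    simp [c, B, Algebra.smul_def]
  refine ⟨c, ?_, hs⟩
  intro j hj
  have := le_of_sum_distinct w (Finset.range d) (fun j => algebraMap K L (c j) * Pi ^ j)
      (fun i hi j hj hij h => S.distinct_aux c (by simpa using hi) (by simpa using hj) hij h)
      j (by simpa using hj)
  rw [← hs] at this
  by_cases h0 : c j = 0
  · simp [h0]
  obtain ⟨a, ha⟩ := S.tr _ h0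
  have h2 := hx.trans this
  rw [eq_mul w ha (S.eq_pi_pow j)] at h2
  rw [ha]
  norm_cast at h2 ⊢
  have : -1 < a := by
    by_contra hcon
    have : (Module.finrank K L : ℤ) * a ≤ (Module.finrank K L : ℤ) * (-1) :=
      mul_le_mul_of_nonneg_left (by omega) (by omega)
    omega
  have : 0 ≤ a := by omega
  positivity

end Setup
end HA

end

section
namespace HA
namespace Setup
variable {K L : Type*} [Field K] [Field L] [Algebra K L] {p : ℕ}
    {w : AddValuation L (WithTop ℤ)} {Pi : L} (S : Setup K L p w Pi)
include S

theorem ge_mul_aut {g h : L ≃ₐ[K] L} {i : ℤ} (hg : (i : WithTop ℤ) ≤ w (g Pi - Pi))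
    (hh : (i : WithTop ℤ) ≤ w (h Pi - Pi)) : (i : WithTop ℤ) ≤ w ((g * h) Pi - Pi) := by
  have : (g * h) Pi - Pi = g (h Pi - Pi) + (g Pi - Pi) := by
    simp [AlgEquiv.mul_apply]
  rw [this]
  exact w.map_le_add ((S.inv g _).symm ▸ hh) hg

theorem ge_pow_aut {g : L ≃ₐ[K] L} {i : ℤ} (hg : (i : WithTop ℤ) ≤ w (g Pi - Pi)) (j : ℕ) :
    (i : WithTop ℤ) ≤ w ((g ^ j) Pi - Pi) := by
  induction j with
  | zero => simp
  | succ j ih => rw [pow_succ]; exact S.ge_mul_aut ih hg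

theorem ge_inv_aut {g : L ≃ₐ[K] L} {i : ℤ} (hg : (i : WithTop ℤ) ≤ w (g Pi - Pi)) :
    (i : WithTop ℤ) ≤ w (g⁻¹ Pi - Pi) := by
  rw [← S.inv g]
  have : g (g⁻¹ Pi - Pi) = -(g Pi - Pi) := by
    rw [map_sub, ← AlgEquiv.mul_apply, mul_inv_cancel]; simp
  rwa [this, w.map_neg]

theorem ge_two {g : L ≃ₐ[K] L} (hg : ((2 : ℤ) : WithTop ℤ) ≤ w (g Pi - Pi)) (m : ℤ) (hm : 0 ≤ m)
    {x : L} (hx : (m : WithTop ℤ) ≤ w x) : ((m + 1 : ℤ) : WithTop ℤ) ≤ w (g x - x) := by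
  lift m to ℕ using hm
  have := S.ge_sub g hg m hx
  exact ge_mono this (by omega)

theorem eq_pow_coprime {g : L ≃ₐ[K] L} (hg : ((2 : ℤ) : WithTop ℤ) ≤ w (g Pi - Pi)) {j : ℕ}
    (hj : ¬ p ∣ j) : w ((g ^ j) Pi - Pi) = w (g Pi - Pi) := by
  by_cases h0 : g Pi - Pi = 0
  · have : ∀ k : ℕ, (g ^ k) Pi = Pi := by
      intro k
      induction k with
      | zero => simp
      | succ k ih => rw [pow_succ, AlgEquiv.mul_apply, sub_eq_zero.1 h0, ih]
    rw [this, sub_eq_zero.1 h0]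
  obtain ⟨i, hi⟩ := exists_int w h0
  have hi2 : 2 ≤ i := by rw [hi] at hg; exact_mod_cast hg
  have key : ∀ k : ℕ, ((i + 1 : ℤ) : WithTop ℤ) ≤ w ((g ^ k) Pi - Pi - k * (g Pi - Pi)) := by
    intro k
    induction k with
    | zero => simp
    | succ k ih =>
      have : (g ^ (k+1)) Pi - Pi - ((k+1 : ℕ) : L) * (g Pi - Pi) =
        g ((g ^ k) Pi - Pi - k * (g Pi - Pi)) + k * (g (g Pi - Pi) - (g Pi - Pi)) := by
        rw [pow_succ', AlgEquiv.mul_apply]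
        simp only [map_sub, map_mul, map_natCast]
        push_cast; ring
      rw [this]
      apply w.map_le_add
      · rwa [S.inv]
      · have := ge_mul w (nat_ge w k) (S.ge_two hg i (by omega) hi.ge)
        simpa using this
  rw [hi]
  have h1 : w ((j : L) * (g Pi - Pi)) = (i : WithTop ℤ) := by
    simpa using eq_mul w (nat_eq_zero w S.pp S.wp hj) hi
  exact eq_of_sub w h1 (key j)

/-- Sen elements -/
theorem sen_elt (t : L ≃ₐ[K] L) (m : ℕ) :
    w (∏ j ∈ Finset.range m, (t ^ j) Pi) = ((m : ℤ) : WithTop ℤ) ∧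
    (t (∏ j ∈ Finset.range m, (t ^ j) Pi) - ∏ j ∈ Finset.range m, (t ^ j) Pi) * Pi =
      (∏ j ∈ Finset.range m, (t ^ j) Pi) * ((t ^ m) Pi - Pi) := by
  constructor
  · have := eq_prod w (Finset.range m) (fun j => (t ^ j) Pi) (fun _ => 1)
      (fun j _ => (S.inv _ _).trans S.unif)
    simpa using this
  · rw [sub_mul, mul_sub]
    congr 1
    rw [← Finset.prod_range_succ, Finset.prod_range_succ', map_prod]
    simp [pow_succ', AlgEquiv.mul_apply]

theorem sen_eq (t : L ≃ₐ[K] L) (m : ℕ) {c : ℤ} (hc : w ((t ^ m) Pi - Pi) = c) :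
    w (t (∏ j ∈ Finset.range m, (t ^ j) Pi) - ∏ j ∈ Finset.range m, (t ^ j) Pi) =
      ((m + c - 1 : ℤ) : WithTop ℤ) := by
  obtain ⟨h1, h2⟩ := S.sen_elt t m
  have h3 := eq_mul w h1 hc
  rw [← h2] at h3
  have := eq_div w h3 S.unif
  rwa [mul_div_cancel_right₀ _ S.pi_ne] at this

theorem sen_ge (t : L ≃ₐ[K] L) (m : ℕ) {c : ℤ} (hc : (c : WithTop ℤ) ≤ w ((t ^ m) Pi - Pi)) :
    ((m + c - 1 : ℤ) : WithTop ℤ) ≤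
    w (t (∏ j ∈ Finset.range m, (t ^ j) Pi) - ∏ j ∈ Finset.range m, (t ^ j) Pi) := by
  obtain ⟨h1, h2⟩ := S.sen_elt t m
  have h3 := ge_mul w h1.ge hc
  rw [← h2] at h3
  have := ge_div w h3 S.unif
  rwa [mul_div_cancel_right₀ _ S.pi_ne] at this

omit S in
theorem arith_aux {p : ℕ} (hp : p.Prime) {u k : ℕ} (hu : ¬ p ∣ u) {e : ℤ} (he : (p : ℤ) ^ (k+1) ∣ e) :
    (p : ℤ) ^ k ∣ (p ^ k * u : ℕ) + e ∧ ¬ (p : ℤ) ^ (k+1) ∣ (p ^ k * u : ℕ) + e := by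
  constructor
  · apply dvd_add
    · push_cast; exact dvd_mul_right _ _
    · exact (pow_dvd_pow _ (Nat.le_succ k)).trans he
  · intro h
    have := (dvd_add_left he).1 h
    have h' : p ^ (k+1) ∣ p ^ k * u := by exact_mod_cast this
    rw [pow_succ] at h'
    exact hu (Nat.dvd_of_mul_dvd_mul_left (pow_pos hp.pos k) h')

omit S in
theorem arith_aux2 {p : ℕ} {X : ℤ} {k k' : ℕ} (h1 : (p : ℤ) ^ k ∣ X)
    (h2 : ¬ (p : ℤ) ^ (k'+1) ∣ X) : k ≤ k' := by
  by_contra h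
  exact h2 ((pow_dvd_pow _ (by omega)).trans h1)

theorem sen {s : L ≃ₐ[K] L} (hs : ((2 : ℤ) : WithTop ℤ) ≤ w (s Pi - Pi)) (b : ℕ → ℤ) (n : ℕ)
    (hb : ∀ k ≤ n, w ((s ^ p ^ k) Pi - Pi) = b k) :
    ∀ m, 1 ≤ m → m ≤ n → (p : ℤ) ^ m ∣ b m - b (m - 1) := by
  have hp := S.pp
  intro n' 
  induction n' using Nat.strong_induction_on with
  | _ N IH =>
  intro hN1 hNn
  by_contra hcon
  -- congruences
  have hcong : ∀ k, k ≤ N - 1 → (p : ℤ) ^ (k+1) ∣ b k - b (N - 1) := by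
    intro k hk
    obtain ⟨d, hd⟩ := Nat.exists_eq_add_of_le hk
    rw [hd]
    have : ∀ d, k + d ≤ N - 1 → (p : ℤ) ^ (k+1) ∣ b k - b (k + d) := by
      intro d
      induction d with
      | zero => simp
      | succ d ih =>
        intro h
        have h1 := ih (by omega)
        have h2 := IH (k + d + 1) (by omega) (by omega) (by omega)
        have h3 : (p : ℤ) ^ (k+1) ∣ b (k+d+1) - b (k+d) :=
          (pow_dvd_pow _ (by omega)).trans h2
        have := dvd_sub h1 h3
        have e : b k - b (k + (d + 1)) = b k - b (k + d) - (b (k + d + 1) - b (k + d)) := by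
          rw [← add_assoc]; ring
        rw [e]; exact this
    exact this d (by omega)
  have hval : ∀ k ≤ n, ∀ u, ¬ p ∣ u → w ((s ^ (p ^ k * u)) Pi - Pi) = b k := by
    intro k hk u hu
    rw [pow_mul, S.eq_pow_coprime (S.ge_pow_aut hs _) hu, hb k hk]
  have hvalge : ∀ m, p ^ N ∣ m → (b N : WithTop ℤ) ≤ w ((s ^ m) Pi - Pi) := by
    rintro m ⟨u, rfl⟩
    rw [pow_mul]
    exact S.ge_pow_aut (hb N hNn).ge u
  have hbge : ∀ k ≤ n, 2 ≤ b k := by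
    intro k hk
    have := S.ge_pow_aut hs (p ^ k)
    rw [hb k hk] at this; exact_mod_cast this
  -- choose a
  have hpN : (0 : ℤ) < (p : ℤ) ^ N := by have := hp.pos; positivity
  obtain ⟨a, ha⟩ : ∃ a : ℕ, (a : ℤ) = (b (N - 1) - b N) % (p : ℤ) ^ N :=
    ⟨((b (N - 1) - b N) % (p : ℤ) ^ N).toNat, Int.toNat_of_nonneg (Int.emod_nonneg _ hpN.ne')⟩
  have ha1 : (p : ℤ) ^ N ∣ (a : ℤ) + b N - b (N-1) := by
    have := Int.dvd_sub_self_of_emod_eq (a := b (N - 1) - b N) (b := (p : ℤ)^N) (c := a) ha.symm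
    convert this using 1; ring
  have ha2 : ¬ p ^ N ∣ a := by
    intro h
    apply hcon
    have h' : (p : ℤ) ^ N ∣ (a : ℤ) := by exact_mod_cast h
    have := dvd_sub ha1 h'
    have e : b N - b (N - 1) = (a : ℤ) + b N - b (N-1) - a := by ring
    rw [e]; exact this
  have ha0 : a ≠ 0 := by rintro rfl; simp at ha2
  obtain ⟨q, u, hu, hau⟩ := Nat.exists_eq_pow_mul_and_not_dvd ha0 p hp.ne_one
  have hq : q < N := by
    by_contra h
    exact ha2 (hau ▸ (pow_dvd_pow p (by omega : N ≤ q)).mul_right u)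
  set T : ℤ := a + b N - 1 with hT
  -- the element y
  set t := s ^ p ^ (N - q) with ht
  set y := ∏ j ∈ Finset.range a, (t ^ j) Pi with hy
  have hyw : w y = ((a : ℤ) : WithTop ℤ) := (S.sen_elt t a).1
  have hyT : w (t y - y) = (T : WithTop ℤ) := by
    apply S.sen_eq t a
    rw [ht, ← pow_mul, hau, ← mul_assoc, ← pow_add, Nat.sub_add_cancel hq.le]
    exact hval N hNn u hu
  -- z
  set z := ∑ j ∈ Finset.range (p ^ (N - q)), (s ^ j) y with hz
  have hzT : s z - z = t y - y := by
    rw [hz, map_sum]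
    have : ∀ j, s ((s ^ j) y) = (s ^ (j+1)) y := by
      intro j; rw [pow_succ', AlgEquiv.mul_apply]
    simp only [this]
    rw [← Finset.sum_sub_distrib, Finset.sum_range_sub (fun j => (s ^ j) y)]
    simp [ht]
  have hzw : ((a + 1 : ℤ) : WithTop ℤ) ≤ w z := by
    have h1 : ∀ j : ℕ, ((a + 1 : ℤ) : WithTop ℤ) ≤ w ((s ^ j) y - y) := fun j =>
      S.ge_two (S.ge_pow_aut hs j) a (by omega) hyw.ge
    have h2 : z = ∑ j ∈ Finset.range (p ^ (N - q)), ((s ^ j) y - y) + (p : L) * ((p : L) ^ (N - q - 1) * y) := by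
      rw [Finset.sum_sub_distrib, ← hz]
      simp only [Finset.sum_const, Finset.card_range, nsmul_eq_mul]
      rw [← mul_assoc, ← pow_succ', Nat.sub_add_cancel (by omega)]
      push_cast; ring
    rw [h2]
    apply w.map_le_add (w.map_le_sum fun j _ => h1 j)
    have := ge_mul w S.wp (ge_mul w (nat_ge w (p ^ (N - q - 1))) hyw.ge)
    push_cast at this ⊢
    refine le_trans (le_of_eq ?_) this
    norm_cast; ring
  -- claim
  have claim : ∀ r m : ℕ, a + 1 ≤ m → T + 1 ≤ m + r → ∀ z : L, ((m : ℤ) : WithTop ℤ) ≤ w z →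
      ((T + 1 : ℤ) : WithTop ℤ) ≤ w (s z - z) ∨ ∃ k u : ℕ, k < N ∧ ¬ p ∣ u ∧ m ≤ p ^ k * u ∧
        w (s z - z) = (((p ^ k * u : ℕ) + b k - 1 : ℤ) : WithTop ℤ) := by
    intro r
    induction r with
    | zero =>
      intro m _ hm z hzm
      left
      exact ge_mono (w.map_le_sub ((S.inv s z).symm ▸ hzm) hzm) (by simpa using hm)
    | succ r ih =>
      intro m ham hm z hzm
      set x := ∏ j ∈ Finset.range m, (s ^ j) Pi with hx
      have hxw : w x = ((m : ℤ) : WithTop ℤ) := (S.sen_elt s m).1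
      obtain ⟨c, hc, hc'⟩ := S.approx hzm hxw
      set z' := z - algebraMap K L c * x with hz'
      have hD : s z - z = (s z' - z') + algebraMap K L c * (s x - x) := by
        rw [hz', map_sub, map_mul, s.commutes]; ring
      have hD' := ih (m+1) (by omega) (by push_cast at hm ⊢; omega) z' (by exact_mod_cast hc')
      have hD'' : ((T + 1 : ℤ) : WithTop ℤ) ≤ w (s z' - z') ∨ ∃ k u : ℕ, k < N ∧ ¬ p ∣ u ∧ m + 1 ≤ p ^ k * u ∧
        w (s z' - z') = (((p ^ k * u : ℕ) + b k - 1 : ℤ) : WithTop ℤ) := hD'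
      -- weak versions
      have weak : ((T + 1 : ℤ) : WithTop ℤ) ≤ w (algebraMap K L c * (s x - x)) →
          ((T + 1 : ℤ) : WithTop ℤ) ≤ w (s z - z) ∨ ∃ k u : ℕ, k < N ∧ ¬ p ∣ u ∧ m ≤ p ^ k * u ∧
          w (s z - z) = (((p ^ k * u : ℕ) + b k - 1 : ℤ) : WithTop ℤ) := by
        intro hlarge
        rw [hD]
        rcases hD'' with h | ⟨k, u, hk, hu, hmu, he⟩
        · left; exact w.map_le_add h hlarge
        · by_cases hle : (p ^ k * u : ℕ) + b k - 1 ≤ T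
          · right
            refine ⟨k, u, hk, hu, by omega, ?_⟩
            exact eq_add w he (ge_mono hlarge (by omega))
          · left
            refine w.map_le_add ?_ hlarge
            rw [he]; exact_mod_cast (by omega)
      by_cases hc1 : ((1 : ℤ) : WithTop ℤ) ≤ w (algebraMap K L c)
      · -- then already z has valuation ≥ m+1
        have hz1 : ((m + 1 : ℤ) : WithTop ℤ) ≤ w z := by
          have : z = z' + algebraMap K L c * x := by rw [hz']; ring
          rw [this]
          refine w.map_le_add hc' ?_
          have := ge_mul w hc1 hxw.ge
          rwa [add_comm]
        rcases ih (m+1) (by omega) (by push_cast at hm ⊢; omega) z (by exact_mod_cast hz1) with h | ⟨k, u, hk, hu, hmu, he⟩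
        · exact Or.inl h
        · exact Or.inr ⟨k, u, hk, hu, by omega, he⟩
      have hc0 : w (algebraMap K L c) = ((0 : ℤ) : WithTop ℤ) := by
        refine le_antisymm ?_ hc
        by_contra h
        exact hc1 (by simpa using (lt_iff_add_one_le.1 (not_le.1 h)))
      by_cases hdvd : p ^ N ∣ m
      · apply weak
        have := ge_mul w hc (S.sen_ge s m (hvalge m hdvd))
        exact ge_mono this (by omega)
      · obtain ⟨k, u, hu, hmu⟩ := Nat.exists_eq_pow_mul_and_not_dvd (show m ≠ 0 by omega) p hp.ne_one
        have hk : k < N := by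
          by_contra h
          exact hdvd (hmu ▸ (pow_dvd_pow p (by omega : N ≤ k)).mul_right u)
        have hA : w (algebraMap K L c * (s x - x)) = ((m + b k - 1 : ℤ) : WithTop ℤ) := by
          have := eq_mul w hc0 (S.sen_eq s m (c := b k) (by rw [hmu]; exact hval k (by omega) u hu))
          rwa [zero_add] at this
        by_cases hle : T + 1 ≤ m + b k - 1
        · apply weak
          rw [hA]; exact_mod_cast hle
        rw [hD]
        rcases hD'' with h | ⟨k', u', hk', hu', hmu', he⟩
        · right
          refine ⟨k, u, hk, hu, hmu.le, ?_⟩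
          rw [add_comm, eq_add w hA (ge_mono h (by omega)), hmu]
        · have hne : (m + b k - 1 : ℤ) ≠ (p ^ k' * u' : ℕ) + b k' - 1 := by
            intro heq
            have e1 := arith_aux hp hu (hcong k (by omega))
            have e2 := arith_aux hp hu' (hcong k' (by omega))
            have e3 : ((p ^ k * u : ℕ) : ℤ) + (b k - b (N-1)) = (p ^ k' * u' : ℕ) + (b k' - b (N-1)) := by
              rw [← hmu]; linarith
            rw [e3] at e1
            have := arith_aux2 e1.1 e2.2
            have := arith_aux2 e2.1 e1.2
            have hkk : k = k' := by omega
            subst hkk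
            omega
          right
          rcases lt_or_gt_of_ne hne with hlt | hlt
          · refine ⟨k, u, hk, hu, hmu.le, ?_⟩
            rw [add_comm, eq_add w hA, hmu]
            rw [he]; exact_mod_cast (by omega)
          · refine ⟨k', u', hk', hu', by omega, ?_⟩
            rw [eq_add w he]
            rw [hA]; exact_mod_cast (by omega)
  rcases claim (T + 1).toNat (a+1) le_rfl (by push_cast; omega) z (by exact_mod_cast hzw) with h | ⟨k, u, hk, hu, hmu, he⟩
  · rw [hzT, hyT] at h
    norm_cast at h; omega
  · rw [hzT, hyT] at he
    norm_cast at he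
    have e1 := arith_aux hp hu (hcong k (by omega))
    apply e1.2
    have : ((p ^ k * u : ℕ) : ℤ) + (b k - b (N-1)) = a + b N - b (N-1) := by
      push_cast at he ⊢; linarith
    rw [this]
    exact (pow_dvd_pow _ (by omega)).trans ha1

end Setup
end HA

end

section
open Polynomial
namespace HA

theorem exists_scaled {E L : Type*} [Field E] [Field L] (φ : E →+* L)
    (w : AddValuation L (WithTop ℤ)) (d : ℕ) (hd : 0 < d)
    (h : ∀ x : E, x ≠ 0 → ∃ m : ℤ, w (φ x) = ((d * m : ℤ) : WithTop ℤ)) :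
    ∃ w' : AddValuation E (WithTop ℤ), ∀ (x : E) (m : ℤ),
      (w' x = (m : WithTop ℤ) ↔ w (φ x) = ((d * m : ℤ) : WithTop ℤ)) ∧
      ((m : WithTop ℤ) ≤ w' x ↔ ((d * m : ℤ) : WithTop ℤ) ≤ w (φ x)) := by
  have hd' : (0 : ℤ) < d := by exact_mod_cast hd
  let f : E → WithTop ℤ := fun x => (w (φ x)).map (fun m => m / (d : ℤ))
  have f0 : f 0 = ⊤ := by simp [f]
  have fe : ∀ x (m : ℤ), w (φ x) = ((d * m : ℤ) : WithTop ℤ) → f x = m := by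
    intro x m hm
    simp only [f, hm, WithTop.map_coe]
    rw [Int.mul_ediv_cancel_left _ hd'.ne']
  have key : ∀ (x : E) (m : ℤ), (f x = (m : WithTop ℤ) ↔ w (φ x) = ((d * m : ℤ) : WithTop ℤ)) ∧
      ((m : WithTop ℤ) ≤ f x ↔ ((d * m : ℤ) : WithTop ℤ) ≤ w (φ x)) := by
    intro x m
    by_cases hx : x = 0
    · subst hx
      rw [f0, map_zero, w.map_zero]
      exact ⟨⟨fun h => absurd h WithTop.top_ne_coe, fun h => absurd h WithTop.top_ne_coe⟩,
        ⟨fun _ => le_top, fun _ => le_top⟩⟩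
    obtain ⟨k, hk⟩ := h x hx
    rw [fe x k hk, hk]
    constructor
    · norm_cast
      constructor
      · rintro rfl; rfl
      · intro h; exact mul_left_cancel₀ hd'.ne' h
    · norm_cast
      exact (mul_le_mul_iff_right₀ hd').symm
  refine ⟨AddValuation.of f f0 ?_ ?_ ?_, key⟩
  · exact (key 1 0).1.2 (by simp)
  · intro x y
    by_cases hxy : x + y = 0
    · rw [hxy, f0]; exact le_top
    obtain ⟨k, hk⟩ := h _ hxy
    rw [fe _ k hk]
    by_contra hcon
    rw [not_le, lt_min_iff, lt_iff_add_one_le, lt_iff_add_one_le, (key _ _).2, (key _ _).2] at hcon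
    have := w.map_le_add hcon.1 hcon.2
    rw [← map_add, hk] at this
    norm_cast at this
    have := (mul_le_mul_iff_right₀ hd').1 this
    omega
  · intro x y
    by_cases hx : x = 0
    · subst hx; rw [zero_mul, f0]; simp
    by_cases hy : y = 0
    · subst hy; rw [mul_zero, f0]; simp
    obtain ⟨k, hk⟩ := h x hx
    obtain ⟨l, hl⟩ := h y hy
    rw [fe x k hk, fe y l hl]
    have := eq_mul w hk hl
    rw [← map_mul, ← mul_add] at this
    exact (key _ _).1.2 this

namespace Setup

section tower
variable {K E L : Type*} [Field K] [Field E] [Field L] [Algebra K E] [Algebra E L] [Algebra K L]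
  [IsScalarTower K E L] [FiniteDimensional K L] [IsGalois K L] {p : ℕ}
    {w : AddValuation L (WithTop ℤ)} {Pi : L}

theorem norm_val (S : Setup K L p w Pi) {x : L} {m : ℤ} (hx : w x = m) :
    w (algebraMap K L (Algebra.norm K x)) = ((Module.finrank K L * m : ℤ) : WithTop ℤ) := by
  rw [Algebra.norm_eq_prod_automorphisms, eq_prod w _ _ (fun _ => m) (fun g _ => by rw [S.inv, hx])]
  simp [← Nat.card_eq_fintype_card, IsGalois.card_aut_eq_finrank]

theorem top (S : Setup K L p w Pi) : Setup E L p w Pi where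
  pp := S.pp
  inv g x := S.inv (g.restrictScalars K) x
  unif := S.unif
  res x hx := by
    obtain ⟨c, hc⟩ := S.res x hx
    exact ⟨algebraMap K E c, by rwa [← IsScalarTower.algebraMap_apply]⟩
  wp := S.wp
  tr x hx := by
    have : FiniteDimensional E L := FiniteDimensional.right K E L
    have : FiniteDimensional K E := FiniteDimensional.left K E L
    have hx' : algebraMap E L x ≠ 0 := by simpa using hx
    obtain ⟨a, ha⟩ := exists_int w hx'
    have h1 := S.norm_val ha
    have h2 : Algebra.norm K (algebraMap E L x) = (Algebra.norm K x) ^ Module.finrank E L := by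
      rw [← Algebra.norm_norm (S := E), Algebra.norm_algebraMap, map_pow]
    obtain ⟨m, hm⟩ := S.tr (Algebra.norm K x) (by simpa using hx)
    rw [h2, map_pow, eq_pow w hm] at h1
    norm_cast at h1
    refine ⟨m, ?_⟩
    rw [ha]
    norm_cast
    have hpos : (Module.finrank K L : ℤ) ≠ 0 := by
      exact_mod_cast (Module.finrank_pos (R := K) (M := L)).ne'
    apply mul_left_cancel₀ hpos
    rw [← h1]; ring

def Link (E L : Type*) [Field E] [Field L] [Algebra E L] (w : AddValuation L (WithTop ℤ))
  (wE : AddValuation E (WithTop ℤ)) : Prop := ∀ (x : E) (m : ℤ),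
      (wE x = (m : WithTop ℤ) ↔ w (algebraMap E L x) = ((Module.finrank E L * m : ℤ) : WithTop ℤ)) ∧
      ((m : WithTop ℤ) ≤ wE x ↔ ((Module.finrank E L * m : ℤ) : WithTop ℤ) ≤ w (algebraMap E L x))

theorem bot (S : Setup K L p w Pi) [IsGalois K E] : ∃ (wE : AddValuation E (WithTop ℤ)) (PiE : E),
    Setup K E p wE PiE ∧ Link E L w wE := by
  have : FiniteDimensional E L := FiniteDimensional.right K E L
  have : FiniteDimensional K E := FiniteDimensional.left K E L
  have : IsGalois E L := IsGalois.tower_top_of_isGalois K E L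
  have SE : Setup E L p w Pi := S.top
  have hd : 0 < Module.finrank E L := Module.finrank_pos
  have hd' : (0 : ℤ) < Module.finrank E L := by exact_mod_cast hd
  obtain ⟨wE, hw⟩ := exists_scaled (algebraMap E L) w (Module.finrank E L) hd SE.tr
  refine ⟨wE, Algebra.norm E Pi, ?_, hw⟩
  refine ⟨S.pp, ?_, ?_, ?_, ?_, ?_⟩
  · intro g x
    by_cases hx : x = 0
    · simp [hx]
    obtain ⟨m, hm⟩ := exists_int wE hx
    rw [hm]
    rw [(hw _ _).1] at hm ⊢
    rw [← hm, ← AlgEquiv.liftNormal_commutes g L x, S.inv]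
  · rw [(hw _ _).1]
    exact SE.norm_val SE.unif
  · intro x hx
    rw [(hw _ _).2, mul_zero] at hx
    obtain ⟨c, hc⟩ := S.res _ hx
    refine ⟨c, ?_⟩
    by_cases h0 : x - algebraMap K E c = 0
    · simp [h0]
    obtain ⟨m, hm⟩ := exists_int wE h0
    rw [hm]
    rw [(hw _ _).1, map_sub, ← IsScalarTower.algebraMap_apply] at hm
    rw [hm] at hc
    norm_cast at hc ⊢
    by_contra hcon
    have : (Module.finrank E L : ℤ) * m ≤ 0 := mul_nonpos_of_nonneg_of_nonpos hd'.le (by omega)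
    omega
  · intro c hc
    obtain ⟨m, hm⟩ := S.tr c hc
    refine ⟨m, ?_⟩
    rw [(hw _ _).1, ← IsScalarTower.algebraMap_apply, hm, ← Module.finrank_mul_finrank K E L]
    congr 1; push_cast; ring
  · have h0 : (p : E) ≠ 0 ∨ (p : E) = 0 := ne_or_eq _ _
    rcases h0 with h0 | h0
    swap
    · simp [h0]
    obtain ⟨m, hm⟩ := exists_int wE h0
    rw [hm]
    have hp := S.wp
    rw [(hw _ _).1, map_natCast] at hm
    rw [hm] at hp
    norm_cast at hp ⊢
    by_contra hcon
    have : (Module.finrank E L : ℤ) * m ≤ 0 := mul_nonpos_of_nonneg_of_nonpos hd'.le (by omega)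
    omega

end tower

section O
variable {L : Type*} [Field L] (w : AddValuation L (WithTop ℤ))

def Oring : Subring L where
  carrier := {x | ((0 : ℤ) : WithTop ℤ) ≤ w x}
  zero_mem' := by simp
  one_mem' := by simp
  add_mem' := fun ha hb => w.map_le_add ha hb
  mul_mem' := fun {a b} ha hb => by simpa using ge_mul w ha hb
  neg_mem' := fun {a} ha => by
    simp only [Set.mem_ofPred_eq, w.map_neg] at ha ⊢; exact ha

theorem mem_Oring {x : L} : x ∈ Oring w ↔ ((0 : ℤ) : WithTop ℤ) ≤ w x := Iff.rfl

end O

variable {K L : Type*} [Field K] [Field L] [Algebra K L] {p : ℕ}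
    {w : AddValuation L (WithTop ℤ)} {Pi : L} 

theorem aut_ext [FiniteDimensional K L] (S : Setup K L p w Pi) {g h : L ≃ₐ[K] L} (hg : g Pi = h Pi) : g = h := by
  have h0 : ∀ x : L, ((0 : ℤ) : WithTop ℤ) ≤ w x → g x = h x := by
    intro x hx
    obtain ⟨c, -, rfl⟩ := S.expand hx
    simp [hg]
  ext x
  by_cases hx : x = 0
  · simp [hx]
  obtain ⟨m, hm⟩ := exists_int w hx
  by_cases hm0 : 0 ≤ m
  · exact h0 x (by rw [hm]; exact_mod_cast hm0)
  · have := h0 x⁻¹ (by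
      have := eq_div w (w.map_one) hm (m := 0)
      rw [one_div] at this
      rw [this]; exact_mod_cast (by omega))
    rw [map_inv₀, map_inv₀] at this
    exact inv_injective this

theorem eq_one_iff [FiniteDimensional K L] (S : Setup K L p w Pi) {g : L ≃ₐ[K] L} :
    w (g Pi - Pi) = ⊤ ↔ g = 1 := by
  rw [w.top_iff, sub_eq_zero]
  constructor
  · intro h; exact S.aut_ext (h := 1) (by simpa using h)
  · rintro rfl; simp

end Setup
end HA

end

section
open Polynomial
namespace HA
namespace Setup
section herb
variable {K E L : Type*} [Field K] [Field E] [Field L] [Algebra K E] [Algebra E L] [Algebra K L]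
  [IsScalarTower K E L] [FiniteDimensional K L] [IsGalois K L] {p : ℕ}
    {w : AddValuation L (WithTop ℤ)} {Pi : L}

theorem ge_eval₂ (w : AddValuation L (WithTop ℤ)) (f : Oring w →+* L) (hf : ∀ x, ((0 : ℤ) : WithTop ℤ) ≤ w (f x))
    {y : L} (hy : ((0 : ℤ) : WithTop ℤ) ≤ w y) (Q : (Oring w)[X]) : ((0 : ℤ) : WithTop ℤ) ≤ w (Q.eval₂ f y) := by
  rw [eval₂_eq_sum_range]
  apply w.map_le_sum
  intro j _
  have : y ^ j ∈ Oring w := Subring.pow_mem _ hy j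
  simpa using ge_mul w (hf (Q.coeff j)) this

theorem herbrand (S : Setup K L p w Pi) {wE : AddValuation E (WithTop ℤ)} {PiE : E}
    (SE : Setup K E p wE PiE) (hl : Link E L w wE)
    (g : L ≃ₐ[K] L) (gE : E ≃ₐ[K] E) (hg : ∀ x, algebraMap E L (gE x) = g (algebraMap E L x))
    [Fintype (L ≃ₐ[E] L)] (i : (L ≃ₐ[E] L) → ℤ) (hi : ∀ s, w (g (s Pi) - Pi) = i s) :
    w (algebraMap E L (gE PiE - PiE)) = ((∑ s, i s : ℤ) : WithTop ℤ) := by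
  classical
  have : FiniteDimensional E L := FiniteDimensional.right K E L
  have : FiniteDimensional K E := FiniteDimensional.left K E L
  have : IsGalois E L := IsGalois.tower_top_of_isGalois K E L
  have ST : Setup E L p w Pi := S.top
  have hd : 0 < Module.finrank E L := Module.finrank_pos
  have hPi : ∀ s : L ≃ₐ[E] L, s Pi ∈ Oring w := fun s => by
    rw [mem_Oring, ST.inv, S.unif]; norm_num
  have hPi0 : ((0 : ℤ) : WithTop ℤ) ≤ w Pi := by rw [S.unif]; norm_num
  let F0 : (Oring w)[X] := ∏ s : L ≃ₐ[E] L, (X - C ⟨s Pi, hPi s⟩)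
  let gO : Oring w →+* L := (g : L →+* L).comp (Oring w).subtype
  have hgO : ∀ x, ((0 : ℤ) : WithTop ℤ) ≤ w (gO x) := fun x => by
    change _ ≤ w (g x); rw [S.inv]; exact x.2
  set b : L := ∏ s : L ≃ₐ[E] L, (Pi - g (s Pi)) with hb
  have hwb : w b = ((∑ s, i s : ℤ) : WithTop ℤ) := by
    apply eq_prod
    intro s _
    rw [w.map_sub_swap, hi]
  have hF0 : F0.eval₂ gO Pi = b := by
    simp only [F0, eval₂_finsetProd, hb]
    apply Finset.prod_congr rfl
    intro s _
    simp [gO]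
  have hF1 : F0.eval₂ (Oring w).subtype Pi = 0 := by
    simp only [F0, eval₂_finsetProd]
    apply Finset.prod_eq_zero (Finset.mem_univ 1)
    simp
  have hcoef : ∀ j, ∃ e : E, algebraMap E L e = (F0.coeff j : L) := by
    intro j
    have := (IsGalois.mem_range_algebraMap_iff_fixed (F := E) (E := L) (F0.coeff j : L)).2 ?_
    · exact this
    intro t
    have h1 : (F0.map ((t : L →+* L).comp (Oring w).subtype)) = F0.map (Oring w).subtype := by
      simp only [F0, Polynomial.map_prod]
      refine Fintype.prod_equiv (Equiv.mulLeft t) _ _ ?_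
      intro s; simp
    have := congrArg (fun q => q.coeff j) h1
    simpa [coeff_map] using this
  have dir1 : ∀ m : ℤ, (m : WithTop ℤ) ≤ wE (gE PiE - PiE) →
      ((Module.finrank E L * m : ℤ) : WithTop ℤ) ≤ w b := by
    intro m hm
    have hbs : b = ∑ j ∈ Finset.range (F0.natDegree + 1),
        (g (F0.coeff j) - F0.coeff j) * Pi ^ j := by
      rw [← hF0, ← sub_zero (eval₂ gO Pi F0), ← hF1, eval₂_eq_sum_range, eval₂_eq_sum_range,
        ← Finset.sum_sub_distrib]
      apply Finset.sum_congr rfl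
      intro j _
      simp [gO]; ring
    rw [hbs]
    apply w.map_le_sum
    intro j _
    obtain ⟨e, he⟩ := hcoef j
    have h1 : ((0 : ℤ) : WithTop ℤ) ≤ wE e := by
      rw [(hl _ _).2, mul_zero, he]; exact (F0.coeff j).2
    have h2 := SE.ge_sub0 gE hm h1
    rw [(hl _ _).2, map_sub, hg, he] at h2
    have h3 : Pi ^ j ∈ Oring w := Subring.pow_mem _ hPi0 j
    simpa using ge_mul w h2 h3
  have hne : gE PiE - PiE ≠ 0 := by
    intro h0
    have := dir1 (|∑ s, i s| + 1) (by simp [h0])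
    rw [hwb] at this
    norm_cast at this
    have h1 : (1 : ℤ) ≤ Module.finrank E L := by exact_mod_cast hd
    have h2 := le_abs_self (∑ s, i s)
    have h3 := abs_nonneg (∑ s, i s)
    nlinarith
  apply le_antisymm
  · obtain ⟨m, hm⟩ := exists_int wE hne
    rw [(hl _ _).1.1 hm, ← hwb]
    exact dir1 m hm.ge
  · rw [← hwb]
    have hPE : ((0 : ℤ) : WithTop ℤ) ≤ w (algebraMap E L PiE) := by
      have := ge_mono (SE.unif.ge) (n := 0) (by norm_num)
      rw [(hl _ _).2, mul_zero] at this; exact this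
    obtain ⟨c, hc, hx⟩ := S.expand hPE
    let c' : ℕ → Oring w := fun j => if h : j < Module.finrank K L then ⟨algebraMap K L (c j), hc j h⟩ else 0
    let R : (Oring w)[X] := (∑ j ∈ Finset.range (Module.finrank K L), C (c' j) * X ^ j) - C ⟨_, hPE⟩
    have hR : ∀ (f : Oring w →+* L) (y : L), R.eval₂ f y = (∑ j ∈ Finset.range (Module.finrank K L), f (c' j) * y ^ j) - f ⟨_, hPE⟩ := by
      intro f y
      simp [R, eval₂_finsetSum]
    have hc' : ∀ j ∈ Finset.range (Module.finrank K L), (c' j : L) = algebraMap K L (c j) := by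
      intro j hj
      simp [c', Finset.mem_range.1 hj]
    have hdvd : F0 ∣ R := by
      by_cases hR0 : R = 0
      · rw [hR0]; exact dvd_zero _
      have h1 : F0 = (Multiset.map (fun a => X - C a) (Finset.univ.val.map (fun s : L ≃ₐ[E] L => (⟨s Pi, hPi s⟩ : Oring w)))).prod := by
        simp only [F0, Finset.prod, Multiset.map_map, Function.comp_def]
      rw [h1, Multiset.prod_X_sub_C_dvd_iff_le_roots hR0, Multiset.le_iff_subset]
      · intro a ha
        simp only [Multiset.mem_map, Finset.mem_val, Finset.mem_univ, true_and] at ha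
        obtain ⟨s, rfl⟩ := ha
        rw [mem_roots hR0, IsRoot.def]
        apply Subtype.ext
        have := hR (Oring w).subtype (s Pi)
        have h2 : R.eval₂ (Oring w).subtype (s Pi) = (R.eval ⟨s Pi, hPi s⟩ : Oring w) := by
          rw [← eval₂_id, ← Subring.subtype_apply, hom_eval₂]; rfl
        rw [h2] at this
        rw [this]
        simp only [Subring.subtype_apply, ZeroMemClass.coe_zero, sub_eq_zero]
        conv_rhs => rw [← s.commutes PiE, hx, map_sum]
        apply Finset.sum_congr rfl
        intro j hj
        rw [hc' j hj, map_mul, map_pow, IsScalarTower.algebraMap_apply K E L, s.commutes]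
      · apply Multiset.Nodup.map _ Finset.univ.nodup
        intro s t hst
        exact ST.aut_ext (Subtype.ext_iff.1 hst)
    obtain ⟨Q, hQ⟩ := hdvd
    have h1 := hR gO Pi
    rw [hQ, eval₂_mul, hF0] at h1
    have h2 : (∑ j ∈ Finset.range (Module.finrank K L), gO (c' j) * Pi ^ j) = algebraMap E L PiE := by
      rw [hx]
      apply Finset.sum_congr rfl
      intro j hj
      change g (c' j) * _ = _
      rw [hc' j hj, g.commutes]
    rw [h2] at h1
    have h3 : gO ⟨_, hPE⟩ = algebraMap E L (gE PiE) := (hg PiE).symm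
    rw [h3] at h1
    rw [map_sub, w.map_sub_swap, ← h1, hwb]
    have := ge_mul w hwb.ge (ge_eval₂ w gO hgO hPi0 Q)
    simpa using this
end herb
end Setup
end HA

end

section
namespace HA

theorem grp {G : Type*} [Group G] [Finite G] (hab : ∀ x y : G, x * y = y * x) {p : ℕ} (hp : p.Prime)
    (P H : Subgroup G) {s0 : G} (hs0P : s0 ∈ P) (hs : s0 ∉ H) (hPp : ∀ x ∈ P, ∃ k, x ^ p ^ k = 1) :
    ∃ (N : Subgroup G) (σ : G) (r : ℕ), H ⊓ P ≤ N ∧ N ≤ P ∧ s0 ∉ N ∧ σ ∈ P ∧ 1 ≤ r ∧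
      (∀ k : ℤ, σ ^ k ∈ N ↔ ((p ^ r : ℕ) : ℤ) ∣ k) ∧ (∀ x ∈ P, ∃ k : ℤ, ∃ n ∈ N, x = σ ^ k * n) := by
  let _ : CommGroup G := { ‹Group G› with mul_comm := hab }
  have hne : (QuotientGroup.mk s0 : G ⧸ H) ≠ 1 := by rwa [Ne, QuotientGroup.eq_one_iff]
  have : Finite (G ⧸ H) := inferInstance
  obtain ⟨χ0, hχ0⟩ := CommGroup.exists_apply_ne_one_of_hasEnoughRootsOfUnity (G ⧸ H) ℂ hne
  let χ : G →* ℂˣ := χ0.comp (QuotientGroup.mk' H)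
  have hχH : ∀ x ∈ H, χ x = 1 := fun x hx => by
    simp only [χ, MonoidHom.comp_apply, QuotientGroup.mk'_apply, (QuotientGroup.eq_one_iff x).2 hx, map_one]
  let f : P →* ℂˣ := χ.comp P.subtype
  have : Finite f.range := Set.finite_range f
  have hcyc : IsCyclic f.range := inferInstance
  obtain ⟨⟨_, ⟨⟨σ, hσ⟩, rfl⟩⟩, hgen⟩ := hcyc.exists_generator
  obtain ⟨k, hk⟩ := hPp σ hσ
  have ho : orderOf (χ σ) ∣ p ^ k := by
    apply orderOf_dvd_of_pow_eq_one; rw [← map_pow, hk, map_one]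
  obtain ⟨r, hr, hor⟩ := (Nat.dvd_prime_pow hp).1 ho
  have hker : ∀ k : ℤ, σ ^ k ∈ χ.ker ⊓ P ↔ ((p ^ r : ℕ) : ℤ) ∣ k := by
    intro k
    rw [← hor, orderOf_dvd_iff_zpow_eq_one, ← map_zpow, Subgroup.mem_inf, MonoidHom.mem_ker]
    exact ⟨fun h => h.1, fun h => ⟨h, P.zpow_mem hσ k⟩⟩
  have hsurj : ∀ x ∈ P, ∃ k : ℤ, ∃ n ∈ χ.ker ⊓ P, x = σ ^ k * n := by
    intro x hx
    obtain ⟨k, hk⟩ := Subgroup.mem_zpowers_iff.1 (hgen ⟨f ⟨x, hx⟩, ⟨⟨x, hx⟩, rfl⟩⟩)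
    have hk' : χ σ ^ k = χ x := by simpa [f] using congrArg Subtype.val hk
    refine ⟨k, σ ^ (-k) * x, ⟨?_, P.mul_mem (P.zpow_mem hσ _) hx⟩, ?_⟩
    · simp [hk']
    · simp
  have hs0 : s0 ∉ χ.ker ⊓ P := fun h => hχ0 h.1
  refine ⟨χ.ker ⊓ P, σ, r, ?_, inf_le_right, hs0, hσ, ?_, hker, hsurj⟩
  · exact fun x hx => ⟨hχH x hx.1, hx.2⟩
  · by_contra hr0
    have hr0 : r = 0 := by omega
    obtain ⟨k, n, hn, h⟩ := hsurj s0 hs0P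
    apply hs0
    rw [h]
    exact Subgroup.mul_mem _ ((hker k).2 (by simp [hr0])) hn

theorem val_add {p : ℕ} (hp : p.Prime) {r a c : ℕ} (ha : a ≠ 0) (har : a < p ^ r) :
    padicValNat p (p ^ r * c + a) = padicValNat p a := by
  have := Fact.mk hp
  have h1 : ∀ k ≤ r, (p ^ k ∣ p ^ r * c + a ↔ p ^ k ∣ a) := fun k hk =>
    (Nat.dvd_add_right (Dvd.dvd.mul_right (pow_dvd_pow p hk) c))
  have h3 : padicValNat p a < r := by
    by_contra h
    have h2 : p ^ r ∣ a := (padicValNat_dvd_iff_le ha).2 (by omega)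
    exact absurd (Nat.le_of_dvd (Nat.pos_of_ne_zero ha) h2) (by omega)
  have hne : p ^ r * c + a ≠ 0 := by omega
  apply le_antisymm
  · by_contra h
    have := (padicValNat_dvd_iff_le (p := p) hne (n := padicValNat p a + 1)).2 (by omega)
    rw [h1 _ (by omega), padicValNat_dvd_iff_le ha] at this
    omega
  · rw [← padicValNat_dvd_iff_le hne, h1 _ h3.le, padicValNat_dvd_iff_le ha]

theorem arithS {p : ℕ} (hp : p.Prime) (B : ℕ → ℤ) (r : ℕ) :
    (∀ m, 1 ≤ m → m ≤ r → (p : ℤ) ^ m ∣ B m - B (m - 1)) →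
    (p : ℤ) ^ (r + 1) ∣ (∑ m ∈ Finset.range (p ^ (r + 1)), if m = 0 then 0 else B (padicValNat p m)) + B r := by
  have := Fact.mk hp
  have step : ∀ (r c : ℕ), c + 1 ≤ p → (∑ m ∈ Finset.range (p ^ r * (c + 1)), if m = 0 then 0 else B (padicValNat p m))
     = (c + 1) * (∑ m ∈ Finset.range (p ^ r), if m = 0 then 0 else B (padicValNat p m)) + c * B r := by
    intro r c
    induction c with
    | zero => intro _; simp
    | succ c ih =>
      intro hc
      rw [mul_add (p ^ r) (c + 1) 1, mul_one, Finset.sum_range_add, ih (by omega)]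
      have h1 : ∑ x ∈ Finset.range (p ^ r), (if p ^ r * (c + 1) + x = 0 then 0 else B (padicValNat p (p ^ r * (c + 1) + x)))
          = (∑ m ∈ Finset.range (p ^ r), if m = 0 then 0 else B (padicValNat p m)) + B r := by
        have hpos : 0 < p ^ r := Nat.pow_pos hp.pos
        obtain ⟨q, hq⟩ : ∃ q, p ^ r = q + 1 := ⟨p ^ r - 1, by omega⟩
        rw [hq, Finset.sum_range_succ', Finset.sum_range_succ', ← hq]
        have h2 : padicValNat p (p ^ r * (c + 1)) = r := by
          rw [padicValNat.mul hpos.ne' (by omega), padicValNat.prime_pow,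
            padicValNat.eq_zero_of_not_dvd (Nat.not_dvd_of_pos_of_lt (by omega) (by omega))]; rfl
        have h3 : p ^ r * (c + 1) ≠ 0 := by positivity
        simp only [add_zero, h2, if_neg h3, if_true]
        congr 1
        apply Finset.sum_congr rfl
        intro x hx
        have hx := Finset.mem_range.1 hx
        rw [if_neg (by omega), if_neg (by omega), val_add hp (by omega) (by omega)]
      rw [h1]; push_cast; ring
  obtain ⟨p', rfl⟩ : ∃ q, p = q + 1 := ⟨p - 1, by have := hp.pos; omega⟩
  induction r with
  | zero =>
    intro _
    have := step 0 p' le_rfl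
    simp only [pow_zero, one_mul, Finset.sum_range_one, if_true, mul_zero, zero_add] at this
    rw [zero_add, pow_one, pow_one, this]
    exact ⟨B 0, by push_cast; ring⟩
  | succ r ih =>
    intro h
    rw [pow_succ (p' + 1) (r + 1), step (r + 1) p' le_rfl]
    obtain ⟨a, ha⟩ := ih (fun m h1 h2 => h m h1 (by omega))
    obtain ⟨b, hb⟩ := h (r + 1) (by omega) le_rfl
    refine ⟨a + b, ?_⟩
    simp only [Nat.add_sub_cancel] at hb
    set T := ∑ m ∈ Finset.range ((p' + 1) ^ (r + 1)), if m = 0 then 0 else B (padicValNat (p' + 1) m)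
    have : ((p' + 1 : ℕ) : ℤ) ^ (r + 1 + 1) * (a + b) = (p' + 1 : ℕ) * (((p' + 1 : ℕ) : ℤ) ^ (r + 1) * a + ((p' + 1 : ℕ) : ℤ) ^ (r + 1) * b) := by ring
    rw [this, ← ha, ← hb]
    push_cast
    ring
end HA

end

section
namespace HA
namespace Setup
open scoped Classical in
theorem core {K L : Type*} [Field K] [Field L] [Algebra K L] [FiniteDimensional K L] [IsGalois K L] {p : ℕ}
    {w : AddValuation L (WithTop ℤ)} {Pi : L} (S : Setup K L p w Pi)
    (hab : ∀ x y : L ≃ₐ[K] L, x * y = y * x) (P N : Subgroup (L ≃ₐ[K] L)) (hNP : N ≤ P)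
    (hP : ∀ s ∈ P, ((2 : ℤ) : WithTop ℤ) ≤ w (s Pi - Pi)) (σ : L ≃ₐ[K] L) (hσP : σ ∈ P) (r : ℕ)
    (hσ : ∀ k : ℤ, σ ^ k ∈ N ↔ ((p ^ (r + 1) : ℕ) : ℤ) ∣ k) (iv : (L ≃ₐ[K] L) → ℤ)
    (hiv : ∀ s, s ≠ 1 → w (s Pi - Pi) = iv s) :
    (Nat.card N : ℤ) * (p : ℤ) ^ (r + 1) ∣
      (∑ m ∈ Finset.range (p ^ (r + 1)), if m = 0 then 0 else ∑ n : L ≃ₐ[K] L with n ∈ N, iv (σ ^ m * n))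
        + ∑ n : L ≃ₐ[K] L with n ∈ N, iv (σ ^ (p ^ r) * n) := by
  have hp := S.pp
  have := Fact.mk hp
  have hNn : N.Normal := ⟨fun n hn g => by rw [hab, ← mul_assoc, inv_mul_cancel, one_mul]; exact hn⟩
  let E := IntermediateField.fixedField N
  have hGal : IsGalois K E := IsGalois.of_fixedField_normal_subgroup N
  have : FiniteDimensional E L := FiniteDimensional.right K E L
  have : FiniteDimensional K E := FiniteDimensional.left K E L
  obtain ⟨wE, PiE, SE, hl⟩ := S.bot (E := E)
  have hfix : E.fixingSubgroup = N := IntermediateField.fixingSubgroup_fixedField N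
  have hd : Module.finrank E L = Nat.card N := IntermediateField.finrank_fixedField_eq_card N
  have hdpos : (0 : ℤ) < Nat.card N := by rw [← hd]; exact_mod_cast Module.finrank_pos
  let σE : E ≃ₐ[K] E := AlgEquiv.restrictNormalHom E σ
  have hmN : ∀ m : ℕ, (σ ^ m ∈ N ↔ p ^ (r + 1) ∣ m) := fun m => by
    have := hσ m
    rw [zpow_natCast] at this
    rw [this]; exact Int.natCast_dvd_natCast
  have main : ∀ m : ℕ, ¬ p ^ (r + 1) ∣ m → ∃ J : ℤ, wE ((σE ^ m) PiE - PiE) = J ∧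
      (Nat.card N : ℤ) * J = ∑ n : L ≃ₐ[K] L with n ∈ N, iv (σ ^ m * n) := by
    intro m hm
    have hne : ∀ n ∈ N, σ ^ m * n ≠ 1 := by
      intro n hn h
      apply hm
      rw [← hmN, eq_inv_of_mul_eq_one_left h]
      exact N.inv_mem hn
    have hgE : ∀ x, algebraMap E L ((σE ^ m) x) = (σ ^ m) (algebraMap E L x) := by
      intro x
      rw [← map_pow]
      exact AlgEquiv.restrictNormal_commutes (σ ^ m) E x
    have hsN : ∀ s : L ≃ₐ[E] L, s.restrictScalars K ∈ N := by
      intro s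
      rw [← hfix]
      exact (((IntermediateField.fixingSubgroupEquiv E).symm s)).2
    have hh := S.herbrand SE hl (σ ^ m) (σE ^ m) hgE (fun s : L ≃ₐ[E] L => iv (σ ^ m * s.restrictScalars K))
      (fun s => by rw [← hiv _ (hne _ (hsN s))]; rfl)
    have hs : (∑ s : L ≃ₐ[E] L, iv (σ ^ m * s.restrictScalars K)) = ∑ n : L ≃ₐ[K] L with n ∈ N, iv (σ ^ m * n) := by
      apply Finset.sum_bij (fun s _ => s.restrictScalars K)
      · intro s _; simpa using hsN s
      · intro s _ t _ h; ext x; exact DFunLike.congr_fun h x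
      · intro n hn
        have hn : n ∈ E.fixingSubgroup := by rw [hfix]; simpa using hn
        refine ⟨IntermediateField.fixingSubgroupEquiv E ⟨n, hn⟩, Finset.mem_univ _, ?_⟩
        ext x; rfl
      · intro _ _; rfl
    have hne0 : (σE ^ m) PiE - PiE ≠ 0 := by
      intro h0; rw [h0, map_zero, w.map_zero] at hh; exact WithTop.top_ne_coe hh
    obtain ⟨J, hJ⟩ := exists_int wE hne0
    refine ⟨J, hJ, ?_⟩
    rw [(hl _ _).1, hh, hd] at hJ
    rw [← hs]; exact_mod_cast hJ.symm
  have hndvd : ∀ m : ℕ, m < p ^ (r + 1) → m ≠ 0 → ¬ p ^ (r + 1) ∣ m := fun m h1 h2 h =>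
    absurd (Nat.le_of_dvd (by omega) h) (by omega)
  have hJ2 : ((2 : ℤ) : WithTop ℤ) ≤ wE (σE PiE - PiE) := by
    obtain ⟨J, h1, h2⟩ := main 1 (hndvd 1 (Nat.one_lt_pow (by omega) hp.one_lt) (by omega))
    rw [pow_one] at h1
    rw [h1]; norm_cast
    have h3 : ∑ n : L ≃ₐ[K] L with n ∈ N, (2 : ℤ) ≤ ∑ n : L ≃ₐ[K] L with n ∈ N, iv (σ ^ 1 * n) := by
      apply Finset.sum_le_sum
      intro n hn
      have hn : n ∈ N := by simpa using hn
      have hne : σ ^ 1 * n ≠ 1 := by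
        intro h
        have : σ ^ 1 ∈ N := by rw [eq_inv_of_mul_eq_one_left h]; exact N.inv_mem hn
        rw [hmN] at this
        exact hndvd 1 (Nat.one_lt_pow (by omega) hp.one_lt) (by omega) this
      have := hP (σ ^ 1 * n) (P.mul_mem (P.pow_mem hσP 1) (hNP hn))
      rw [hiv _ hne] at this
      exact_mod_cast this
    rw [← h2, Finset.sum_const, nsmul_eq_mul] at h3
    have h4 : (Finset.univ.filter (fun n : L ≃ₐ[K] L => n ∈ N)).card = Nat.card N := by
      rw [Nat.card_eq_fintype_card, Fintype.card_subtype]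
    rw [h4] at h3
    exact le_of_mul_le_mul_left h3 hdpos
  have hpk : ∀ k, k ≤ r → ¬ p ^ (r + 1) ∣ p ^ k := fun k hk h => by
    have := (Nat.pow_dvd_pow_iff_le_right hp.one_lt).1 h
    omega
  choose! J hJ1 hJs using main
  let B : ℕ → ℤ := fun k => J (p ^ k)
  have hB : ∀ k ≤ r, wE ((σE ^ p ^ k) PiE - PiE) = B k := fun k hk => hJ1 _ (hpk k hk)
  have hsen := SE.sen hJ2 B r hB
  have hJB : ∀ m, m < p ^ (r + 1) → m ≠ 0 → J m = B (padicValNat p m) := by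
    intro m h1 h2
    have h3 := hJ1 m (hndvd m h1 h2)
    set k := padicValNat p m with hk
    have hkr : k ≤ r := by
      by_contra h
      exact hndvd m h1 h2 ((padicValNat_dvd_iff_le h2).2 (by omega))
    obtain ⟨c, hc⟩ : p ^ k ∣ m := (padicValNat_dvd_iff_le h2).2 le_rfl
    have hpc : ¬ p ∣ c := by
      rintro ⟨e, rfl⟩
      have : p ^ (k + 1) ∣ m := ⟨e, by rw [hc]; ring⟩
      rw [padicValNat_dvd_iff_le h2] at this
      omega
    have h4 := SE.eq_pow_coprime (SE.ge_pow_aut hJ2 (p ^ k)) hpc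
    rw [← pow_mul, ← hc, h3, hB k hkr] at h4
    exact_mod_cast h4
  obtain ⟨z, hz⟩ := arithS hp B r hsen
  refine ⟨z, ?_⟩
  rw [mul_assoc, ← hz, mul_add, ← hJs _ (hpk r le_rfl), Finset.mul_sum]
  congr 1
  apply Finset.sum_congr rfl
  intro m hm
  have hm := Finset.mem_range.1 hm
  split_ifs with h0
  · simp
  · rw [← hJs _ (hndvd m hm h0), hJB m hm h0]
end Setup
end HA

end

section
namespace HA
namespace Setup
variable {K L : Type*} [Field K] [Field L] [Algebra K L] [FiniteDimensional K L] {p : ℕ}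
    {w : AddValuation L (WithTop ℤ)} {Pi : L} (S : Setup K L p w Pi)

/-- the groups `{i(g) ≥ t}` -/
def ram (S : Setup K L p w Pi) (t : ℤ) : Subgroup (L ≃ₐ[K] L) where
  carrier := {g | (t : WithTop ℤ) ≤ w (g Pi - Pi)}
  one_mem' := by simp
  mul_mem' := fun ha hb => S.ge_mul_aut ha hb
  inv_mem' := fun ha => S.ge_inv_aut ha

omit [FiniteDimensional K L] in
theorem mem_ram {t : ℤ} {g : L ≃ₐ[K] L} : g ∈ S.ram t ↔ (t : WithTop ℤ) ≤ w (g Pi - Pi) := Iff.rfl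

include S in
theorem exists_iv : ∃ iv : (L ≃ₐ[K] L) → ℤ, ∀ s, s ≠ 1 → w (s Pi - Pi) = iv s := by
  have : ∀ s : L ≃ₐ[K] L, ∃ i : ℤ, s ≠ 1 → w (s Pi - Pi) = i := by
    intro s
    by_cases h : s = 1
    · exact ⟨0, fun h' => absurd h h'⟩
    · have : s Pi - Pi ≠ 0 := by
        intro h0; exact h (S.eq_one_iff.1 (by rw [h0, w.map_zero]))
      obtain ⟨m, hm⟩ := exists_int w this
      exact ⟨m, fun _ => hm⟩
  choose iv h using this
  exact ⟨iv, h⟩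

theorem pgroup {s : L ≃ₐ[K] L} (hs : s ∈ S.ram 2) : ∃ k, s ^ p ^ k = 1 := by
  have hp := S.pp
  have : Finite (L ≃ₐ[K] L) := inferInstance
  have ho : orderOf s ≠ 0 := (orderOf_pos s).ne'
  obtain ⟨k, c, hpc, hc⟩ := Nat.exists_eq_pow_mul_and_not_dvd ho p hp.ne_one
  refine ⟨k, ?_⟩
  have h1 := S.eq_pow_coprime ((S.ram 2).pow_mem hs (p ^ k)) hpc
  rw [← pow_mul, ← hc, pow_orderOf_eq_one] at h1
  simp only [AlgEquiv.one_apply, sub_self, w.map_zero] at h1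
  exact S.eq_one_iff.1 h1.symm

open scoped Classical in
theorem hasse_arf [IsGalois K L] (hab : ∀ x y : L ≃ₐ[K] L, x * y = y * x) {s0 : L ≃ₐ[K] L} {I : ℕ}
    (hI : 2 ≤ I) (hs0 : w (s0 Pi - Pi) = ((I : ℤ) : WithTop ℤ)) :
    Nat.card (S.ram 2) ∣ ∑ t ∈ Finset.Icc 1 I, Nat.card (S.ram t ⊓ S.ram 2 : Subgroup (L ≃ₐ[K] L)) := by
  have hp := S.pp
  have : Finite (L ≃ₐ[K] L) := inferInstance
  set P := S.ram 2 with hPdef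
  have hs0P : s0 ∈ P := by rw [hPdef, mem_ram, hs0]; exact_mod_cast hI
  have hs0H : s0 ∉ S.ram (I + 1) := by rw [mem_ram, hs0]; norm_cast; omega
  obtain ⟨N, σ, r, hHN, hNP, hs0N, hσP, hr, hσ, hsurj⟩ := grp hab hp P (S.ram (I + 1)) hs0P hs0H (fun x hx => S.pgroup hx)
  obtain ⟨r, rfl⟩ : ∃ r', r = r' + 1 := ⟨r - 1, by omega⟩
  obtain ⟨iv, hiv⟩ := S.exists_iv
  have hcore := S.core hab P N hNP (fun s hs => hs) σ hσP r hσ iv hiv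
  set q := p ^ (r + 1) with hq
  have hqpos : 0 < q := Nat.pow_pos hp.pos
  have hprq : p ^ r < q := Nat.pow_lt_pow_right hp.one_lt (by omega)
  have hprpos : 0 < p ^ r := Nat.pow_pos hp.pos
  have hsum : ∀ h : (L ≃ₐ[K] L) → ℕ, ∑ s : L ≃ₐ[K] L with s ∈ P, h s =
      ∑ m ∈ Finset.range q, ∑ n : L ≃ₐ[K] L with n ∈ N, h (σ ^ m * n) := by
    intro h
    rw [← Finset.sum_product']
    symm
    apply Finset.sum_nbij (fun x => σ ^ x.1 * x.2)
    · rintro ⟨m, n⟩ hx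
      simp only [Finset.mem_product, Finset.mem_filter, Finset.mem_univ, true_and] at hx ⊢
      exact P.mul_mem (P.pow_mem hσP m) (hNP hx.2)
    · rintro ⟨m, n⟩ hx ⟨m', n'⟩ hx' heq
      simp only [Finset.coe_product, Set.mem_prod, Finset.mem_coe, Finset.mem_range, Finset.mem_filter, Finset.mem_univ, true_and] at hx hx' heq
      have h1 : σ ^ ((m : ℤ) - m') ∈ N := by
        have : σ ^ ((m : ℤ) - m') = n' * n⁻¹ := by
          rw [zpow_sub, zpow_natCast, zpow_natCast, hab, inv_mul_eq_iff_eq_mul, ← mul_assoc, ← heq]; group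
        rw [this]; exact N.mul_mem hx'.2 (N.inv_mem hx.2)
      rw [hσ] at h1
      have h2 : (m : ℤ) - m' = 0 := Int.eq_zero_of_abs_lt_dvd h1 (by rw [abs_lt]; omega)
      have h3 : m = m' := by omega
      subst h3
      simpa using heq
    · intro x hx
      simp only [Finset.coe_filter, Finset.mem_univ, true_and] at hx
      obtain ⟨k, n, hn, rfl⟩ := hsurj x hx
      refine ⟨((k % q).toNat, σ ^ (q * (k / q)) * n), ?_, ?_⟩
      · simp only [Finset.coe_product, Set.mem_prod, Finset.mem_coe, Finset.mem_range, Finset.mem_filter, Finset.mem_univ, true_and]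
        have h1 := Int.emod_lt_of_pos k (b := q) (by exact_mod_cast hqpos)
        refine ⟨by omega, N.mul_mem ((hσ _).2 (dvd_mul_right _ _)) hn⟩
      · have h1 := Int.emod_nonneg k (b := q) (by exact_mod_cast hqpos.ne')
        simp only
        rw [← mul_assoc, ← zpow_natCast, ← zpow_add, Int.toNat_of_nonneg h1, Int.emod_add_mul_ediv]
    · intro _ _; rfl
  have hcardP : Nat.card P = Nat.card N * q := by
    have := hsum (fun _ => 1)
    simp only [Finset.sum_const, smul_eq_mul, mul_one, Finset.card_range] at this
    rw [Nat.card_eq_fintype_card, Fintype.card_subtype, this, Nat.card_eq_fintype_card, Fintype.card_subtype, mul_comm]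
  -- the value
  have hval : ∀ x ∈ P, x ∉ N → (iv x : ℤ) = ∑ t ∈ Finset.Icc 1 I, (if x ∈ S.ram (t : ℕ) then 1 else 0 : ℕ) := by
    intro x hx hxN
    have hx1 : x ≠ 1 := fun h => hxN (h ▸ N.one_mem)
    have h1 : ¬ (I + 1 : ℤ) ≤ iv x := by
      intro h
      apply hxN
      apply hHN
      refine ⟨?_, hx⟩
      change x ∈ S.ram (I + 1)
      rw [mem_ram, hiv x hx1]; exact_mod_cast h
    have h2 : (2 : ℤ) ≤ iv x := by
      have : x ∈ S.ram 2 := hx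
      rw [mem_ram, hiv x hx1] at this; exact_mod_cast this
    rw [Finset.sum_ite, Finset.sum_const_zero, add_zero, Finset.sum_const, smul_eq_mul, mul_one]
    have : (Finset.Icc 1 I).filter (fun t : ℕ => x ∈ S.ram (t : ℕ)) = Finset.Icc 1 (iv x).toNat := by
      ext t
      simp only [Finset.mem_filter, Finset.mem_Icc, mem_ram, hiv x hx1]
      norm_cast
      omega
    rw [this]
    simp; omega
  -- an element of order p in each
  have hkey : ∀ t ∈ Finset.Icc 1 I, ∑ n : L ≃ₐ[K] L with n ∈ N, (if σ ^ p ^ r * n ∈ S.ram (t : ℕ) then 1 else 0 : ℕ)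
      = ∑ n : L ≃ₐ[K] L with n ∈ N, (if n ∈ S.ram (t : ℕ) then 1 else 0 : ℕ) := by
    intro t ht
    have hs0t : s0 ∈ S.ram t := by
      rw [mem_ram, hs0]; simp only [Finset.mem_Icc] at ht; exact_mod_cast ht.2
    obtain ⟨y, hy, hyN⟩ : ∃ y ∈ S.ram t, y⁻¹ * σ ^ p ^ r ∈ N := by
      obtain ⟨k, n, hn, hk⟩ := hsurj s0 hs0P
      have hqk : ¬ (q : ℤ) ∣ k := by
        intro h
        apply hs0N
        rw [hk]
        exact N.mul_mem ((hσ k).2 h) hn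
      have hg : (Int.gcd k q) ∣ p ^ r := by
        have h1 : Int.gcd k q ∣ p ^ (r + 1) := by
          have := Int.gcd_dvd_right k q; exact_mod_cast this
        obtain ⟨a, ha, hga⟩ := (Nat.dvd_prime_pow hp).1 h1
        rw [hga]
        apply pow_dvd_pow
        by_contra hcon
        have : a = r + 1 := by omega
        apply hqk
        rw [hq, ← this, ← hga]
        exact Int.gcd_dvd_left k q
      have h2 : (Int.gcd k q : ℤ) ∣ ((p ^ r : ℕ) : ℤ) := by exact_mod_cast hg
      obtain ⟨c, hc⟩ := h2
      rw [Int.gcd_eq_gcd_ab] at hc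
      set x := Int.gcdA k q
      set z := Int.gcdB k q
      refine ⟨s0 ^ (x * c), (S.ram t).zpow_mem hs0t _, ?_⟩
      have h3 : (s0 ^ (x * c))⁻¹ * σ ^ p ^ r = n ^ (-(x * c)) * σ ^ ((q : ℤ) * (z * c)) := by
        have hcomm : Commute (σ ^ k) n := hab _ _
        rw [hk, hcomm.mul_zpow, ← zpow_natCast σ, hc, ← zpow_mul, mul_inv_rev, mul_assoc, ← zpow_neg, ← zpow_neg, ← zpow_add]
        congr 2; ring
      rw [h3]
      exact N.mul_mem (N.zpow_mem hn _) ((hσ _).2 (dvd_mul_right _ _))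
    apply Finset.sum_nbij' (fun n => y⁻¹ * σ ^ p ^ r * n) (fun n => (y⁻¹ * σ ^ p ^ r)⁻¹ * n)
    · intro n hn
      simp only [Finset.mem_filter, Finset.mem_univ, true_and] at hn ⊢
      exact N.mul_mem hyN hn
    · intro n hn
      simp only [Finset.mem_filter, Finset.mem_univ, true_and] at hn ⊢
      exact N.mul_mem (N.inv_mem hyN) hn
    · intro n hn; exact inv_mul_cancel_left _ _
    · intro n hn; exact mul_inv_cancel_left _ _
    · intro n hn
      have : σ ^ p ^ r * n ∈ S.ram t ↔ y⁻¹ * σ ^ p ^ r * n ∈ S.ram t := by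
        rw [mul_assoc, Subgroup.mul_mem_cancel_left _ (Subgroup.inv_mem _ hy)]
      simp only [this]
  have hcardt : ∀ t : ℕ, Nat.card (S.ram t ⊓ S.ram 2 : Subgroup (L ≃ₐ[K] L)) = ∑ s : L ≃ₐ[K] L with s ∈ P, (if s ∈ S.ram t then 1 else 0 : ℕ) := by
    intro t
    rw [Nat.card_eq_fintype_card, Fintype.card_subtype, Finset.sum_ite, Finset.sum_const_zero, add_zero, Finset.sum_const, smul_eq_mul, mul_one, Finset.filter_filter]
    congr 1
    ext x
    simp [Subgroup.mem_inf, and_comm, hPdef]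
  rw [hcardP]
  suffices hT : ((∑ t ∈ Finset.Icc 1 I, Nat.card (S.ram t ⊓ S.ram 2 : Subgroup (L ≃ₐ[K] L)) : ℕ) : ℤ) =
      (∑ m ∈ Finset.range q, if m = 0 then 0 else ∑ n : L ≃ₐ[K] L with n ∈ N, iv (σ ^ m * n))
        + ∑ n : L ≃ₐ[K] L with n ∈ N, iv (σ ^ (p ^ r) * n) by
    rw [← hT] at hcore
    rw [hq]; exact_mod_cast hcore
  have hnot : ∀ m : ℕ, m < q → m ≠ 0 → ∀ n ∈ N, σ ^ m * n ∉ N := by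
    intro m h1 h2 n hn h
    rw [Subgroup.mul_mem_cancel_right _ hn] at h
    have := (hσ m).1 (by rwa [zpow_natCast])
    have : q ∣ m := by exact_mod_cast this
    exact absurd (Nat.le_of_dvd (by omega) this) (by omega)
  have hrow : ∀ m : ℕ, m < q → m ≠ 0 → ∑ n : L ≃ₐ[K] L with n ∈ N, iv (σ ^ m * n) =
      ((∑ t ∈ Finset.Icc 1 I, ∑ n : L ≃ₐ[K] L with n ∈ N, (if σ ^ m * n ∈ S.ram (t : ℕ) then 1 else 0 : ℕ) : ℕ) : ℤ) := by
    intro m h1 h2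
    rw [Finset.sum_comm, Nat.cast_sum]
    apply Finset.sum_congr rfl
    intro n hn
    simp only [Finset.mem_filter, Finset.mem_univ, true_and] at hn
    exact hval _ (P.mul_mem (P.pow_mem hσP m) (hNP hn)) (hnot m h1 h2 n hn)
  rw [hrow (p ^ r) hprq hprpos.ne', Finset.sum_congr rfl hkey]
  simp only [hcardt, hsum]
  obtain ⟨q', hq'⟩ : ∃ q', q = q' + 1 := ⟨q - 1, by omega⟩
  rw [hq', Finset.sum_range_succ']
  simp only [Finset.sum_range_succ', if_true, add_zero, pow_zero, one_mul]
  rw [Finset.sum_add_distrib]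
  push_cast
  congr 1
  rw [Finset.sum_comm]
  apply Finset.sum_congr rfl
  intro m hm
  rw [hrow (m+1) (by have := Finset.mem_range.1 hm; omega) (by omega)]
  push_cast; rfl
end Setup
end HA

end

section
namespace HA
namespace Setup
variable {K L : Type*} [Field K] [Field L] [Algebra K L] {p : ℕ}
    {w : AddValuation L (WithTop ℤ)} {Pi : L}

def mideal (w : AddValuation L (WithTop ℤ)) : Ideal (Oring w) where
  carrier := {x | ((1 : ℤ) : WithTop ℤ) ≤ w (x : L)}
  zero_mem' := by simp
  add_mem' := fun ha hb => w.map_le_add ha hb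
  smul_mem' := fun c x hx => by simpa using ge_mul w c.2 hx

theorem mem_mideal {x : Oring w} : x ∈ mideal w ↔ ((1 : ℤ) : WithTop ℤ) ≤ w (x : L) := Iff.rfl

theorem mideal_prime (w : AddValuation L (WithTop ℤ)) : (mideal w).IsPrime := by
  refine ⟨?_, ?_⟩
  · rw [Ideal.ne_top_iff_one, mem_mideal]; simp
  · intro x y hxy
    by_contra hcon
    rw [not_or, mem_mideal, mem_mideal, not_le, not_le] at hcon
    rw [mem_mideal] at hxy
    have hx : w (x : L) = ((0 : ℤ) : WithTop ℤ) := by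
      apply le_antisymm _ x.2
      by_contra h; rw [not_le, lt_iff_add_one_le] at h; exact absurd hcon.1 (not_lt.2 (by simpa using h))
    have hy : w (y : L) = ((0 : ℤ) : WithTop ℤ) := by
      apply le_antisymm _ y.2
      by_contra h; rw [not_le, lt_iff_add_one_le] at h; exact absurd hcon.2 (not_lt.2 (by simpa using h))
    have := eq_mul w hx hy
    rw [Subring.coe_mul, this] at hxy
    norm_cast at hxy

theorem unit_val (S : Setup K L p w Pi) (g : L ≃ₐ[K] L) : w (g Pi / Pi) = ((0 : ℤ) : WithTop ℤ) := by
  simpa using eq_div w ((S.inv g Pi).trans S.unif) S.unif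

def tameHom (S : Setup K L p w Pi) : (L ≃ₐ[K] L) →* (Oring w ⧸ mideal w) where
  toFun g := Ideal.Quotient.mk _ ⟨g Pi / Pi, (S.unit_val g).ge⟩
  map_one' := by
    rw [← map_one (Ideal.Quotient.mk (mideal w))]
    congr 1
    apply Subtype.ext
    simp [S.pi_ne]
  map_mul' g h := by
    rw [← map_mul, Ideal.Quotient.eq, mem_mideal]
    have h1 := S.ge_sub0 g (S.one_le g) (S.unit_val h).ge
    have := ge_mul w h1 (S.unit_val g).ge
    rw [add_zero] at this
    convert this using 2
    have := S.pi_ne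
    have h2 : g Pi ≠ 0 := by simpa using this
    change g (h Pi) / Pi - g Pi / Pi * (h Pi / Pi) = (g (h Pi / Pi) - h Pi / Pi) * (g Pi / Pi)
    rw [map_div₀]
    field_simp

theorem tameHom_eq_one (S : Setup K L p w Pi) (g : L ≃ₐ[K] L) : S.tameHom g = 1 ↔ g ∈ S.ram 2 := by
  rw [← map_one (Ideal.Quotient.mk (mideal w))]
  simp only [tameHom, MonoidHom.coe_mk, OneHom.coe_mk]
  rw [Ideal.Quotient.eq, mem_mideal, mem_ram]
  simp only [AddSubgroupClass.coe_sub, OneMemClass.coe_one]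
  have hpi := S.pi_ne
  constructor
  · intro h
    have := ge_mul w h S.unif.ge
    rwa [sub_mul, div_mul_cancel₀ _ hpi, one_mul] at this
  · intro h
    have := ge_div w h S.unif
    rwa [sub_div, div_self hpi] at this

theorem tame_p (S : Setup K L p w Pi) {g : L ≃ₐ[K] L} (h : g ^ p ∈ S.ram 2) : g ∈ S.ram 2 := by
  have := mideal_prime w
  have : IsDomain (Oring w ⧸ mideal w) := inferInstance
  rw [← tameHom_eq_one] at h ⊢
  rw [map_pow] at h
  obtain ⟨r, hr⟩ := exists_add_pow_prime_eq S.pp (S.tameHom g - 1) 1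
  have hp0 : (p : Oring w ⧸ mideal w) = 0 := by
    rw [← map_natCast (Ideal.Quotient.mk (mideal w)), Ideal.Quotient.eq_zero_iff_mem, mem_mideal]
    simpa using S.wp
  rw [sub_add_cancel, h, hp0, one_pow] at hr
  have h2 : (S.tameHom g - 1) ^ p = 0 := by linear_combination -hr
  have := pow_eq_zero_iff (S.pp.ne_zero) |>.1 h2
  exact sub_eq_zero.1 this

theorem tame_pow (S : Setup K L p w Pi) (hab : ∀ x y : L ≃ₐ[K] L, x * y = y * x) {s : L ≃ₐ[K] L} {u : ℕ}
    (hs : w (s Pi - Pi) = ((u + 1 : ℤ) : WithTop ℤ)) (g : L ≃ₐ[K] L) : S.tameHom g ^ u = 1 := by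
  have hpi := S.pi_ne
  set b := g Pi / Pi with hb
  have hgb : g Pi = b * Pi := by rw [hb, div_mul_cancel₀ _ hpi]
  have hwb : w b = ((0 : ℤ) : WithTop ℤ) := S.unit_val g
  set e := (s Pi - Pi) / Pi ^ (u + 1) with he
  have hwe : w e = ((0 : ℤ) : WithTop ℤ) := by
    have := eq_div w hs (S.eq_pi_pow (u + 1))
    rw [he, this]; congr 1; push_cast; ring
  have hse : s Pi = Pi + e * Pi ^ (u + 1) := by
    rw [he, div_mul_cancel₀ _ (pow_ne_zero _ hpi)]; ring
  have hcomm : g (s Pi) = s (g Pi) := by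
    have := hab g s
    exact DFunLike.congr_fun this Pi
  rw [hgb, map_mul, hse, map_add, map_mul, map_pow, hgb] at hcomm
  -- b Pi + g e (b Pi)^(u+1) = s b (Pi + e Pi^(u+1))
  have h1 := S.ge_sub0 s hs.ge hwb.ge
  have h2 := S.ge_sub0 g (S.one_le g) hwe.ge
  have h3 : b ^ u - 1 = ((s b - b) * (Pi + e * Pi ^ (u + 1)) - b * ((b ^ u) * ((g e - e) * Pi ^ (u + 1)))) / (b * (e * Pi ^ (u + 1))) := by
    have hb0 := ne_zero_of_eq w hwb
    have he0 := ne_zero_of_eq w hwe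
    field_simp
    linear_combination hcomm
  have h4 : ((1 : ℤ) : WithTop ℤ) ≤ w (b ^ u - 1) := by
    rw [h3]
    have hden := eq_mul w hwb (eq_mul w hwe (S.eq_pi_pow (u + 1)))
    have hx1 : ((1 : ℤ) : WithTop ℤ) ≤ w (Pi + e * Pi ^ (u + 1)) := by
      rw [← hse, S.inv]; exact S.unif.ge
    have hn1 := ge_mul w h1 hx1
    have hn2 := ge_mul w hwb.ge (ge_mul w (eq_pow w hwb u).ge (ge_mul w h2 (S.eq_pi_pow (u + 1)).ge))
    have := ge_div w (w.map_le_sub (ge_mono hn1 (n := u + 2) (by omega)) (ge_mono hn2 (n := u + 2) (by push_cast; omega))) hden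
    exact ge_mono this (by push_cast; omega)
  rw [← map_one (Ideal.Quotient.mk (mideal w))]
  simp only [tameHom, MonoidHom.coe_mk, OneHom.coe_mk]
  rw [← map_pow, Ideal.Quotient.eq, mem_mideal]
  simpa using h4

section fin
variable [FiniteDimensional K L]

theorem card_ram2 (S : Setup K L p w Pi) (hab : ∀ x y : L ≃ₐ[K] L, x * y = y * x) {n : ℕ}
    (hG : Nat.card (L ≃ₐ[K] L) = (p - 1) * p ^ n) : Nat.card (S.ram 2) = p ^ n := by
  have hp := S.pp
  have := Fact.mk hp
  have hPp : IsPGroup p (S.ram 2) := by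
    intro ⟨x, hx⟩
    obtain ⟨k, hk⟩ := S.pgroup hx
    exact ⟨k, Subtype.ext hk⟩
  obtain ⟨m, hm⟩ := IsPGroup.iff_card.1 hPp
  have hmul := (S.ram 2).card_mul_index
  rw [hm, hG] at hmul
  have hN : (S.ram 2).Normal := ⟨fun n hn g => by rw [hab, ← mul_assoc, inv_mul_cancel, one_mul]; exact hn⟩
  have hidx : ¬ p ∣ (S.ram 2).index := by
    intro h
    rw [Subgroup.index] at h
    obtain ⟨x, hx⟩ := exists_prime_orderOf_dvd_card' p h
    obtain ⟨g, rfl⟩ := QuotientGroup.mk_surjective x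
    have h1 := pow_orderOf_eq_one (QuotientGroup.mk g : (L ≃ₐ[K] L) ⧸ S.ram 2)
    rw [hx, ← QuotientGroup.mk_pow, QuotientGroup.eq_one_iff] at h1
    have h2 := S.tame_p h1
    rw [← QuotientGroup.eq_one_iff] at h2
    rw [h2, orderOf_one] at hx
    exact hp.one_lt.ne hx
  have hp1 : ¬ p ∣ p - 1 := Nat.not_dvd_of_pos_of_lt (by have := hp.two_le; omega) (by have := hp.two_le; omega)
  rw [hm]
  apply Nat.dvd_antisymm
  · have : p ^ m ∣ (p - 1) * p ^ n := ⟨_, hmul.symm⟩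
    exact (Nat.Coprime.pow_left _ ((Nat.Prime.coprime_iff_not_dvd hp).2 hp1)).dvd_of_dvd_mul_left this
  · have : p ^ n ∣ p ^ m * (S.ram 2).index := ⟨_, hmul.trans (mul_comm _ _)⟩
    exact (Nat.Coprime.pow_left _ ((Nat.Prime.coprime_iff_not_dvd hp).2 hidx)).dvd_of_dvd_mul_right this

theorem tame_dvd (S : Setup K L p w Pi) (hab : ∀ x y : L ≃ₐ[K] L, x * y = y * x) {n : ℕ}
    (hG : Nat.card (L ≃ₐ[K] L) = (p - 1) * p ^ n) {s : L ≃ₐ[K] L} {u : ℕ}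
    (hs : w (s Pi - Pi) = ((u + 1 : ℤ) : WithTop ℤ)) : p - 1 ∣ u := by
  have := mideal_prime w
  have : IsDomain (Oring w ⧸ mideal w) := inferInstance
  let F := S.tameHom.toHomUnits
  have hF : ∀ g, (F g : Oring w ⧸ mideal w) = S.tameHom g := fun g => rfl
  have hker : F.ker = S.ram 2 := by
    ext g; rw [MonoidHom.mem_ker, ← tameHom_eq_one, ← hF, Units.val_eq_one]
  have : Finite F.range := Set.finite_range F
  have hcard : Nat.card F.range = p - 1 := by
    rw [← Subgroup.index_ker, hker]
    have hmul := (S.ram 2).card_mul_index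
    rw [S.card_ram2 hab hG, hG, mul_comm] at hmul
    exact Nat.eq_of_mul_eq_mul_right (Nat.pow_pos S.pp.pos) hmul
  have hcyc : IsCyclic F.range := inferInstance
  obtain ⟨⟨_, ⟨g, rfl⟩⟩, hx⟩ := hcyc.exists_ofOrder_eq_natCard
  rw [← hcard, ← hx]
  apply orderOf_dvd_of_pow_eq_one
  apply Subtype.ext
  apply Units.ext
  simpa [hF] using S.tame_pow hab hs g

theorem hasse_arf' [IsGalois K L] (S : Setup K L p w Pi) (hab : ∀ x y : L ≃ₐ[K] L, x * y = y * x) {n : ℕ}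
    (hG : Nat.card (L ≃ₐ[K] L) = (p - 1) * p ^ n) {s : L ≃ₐ[K] L} {u : ℕ}
    (hs : w (s Pi - Pi) = ((u + 1 : ℤ) : WithTop ℤ)) :
    Nat.card (L ≃ₐ[K] L) ∣ ∑ t ∈ Finset.Icc 1 u, Nat.card (S.ram (t + 1)) := by
  classical
  have hp := S.pp
  rcases Nat.eq_zero_or_pos u with rfl | hu
  · simp
  have hcop : Nat.Coprime (p - 1) (p ^ n) := by
    apply Nat.Coprime.pow_right
    apply Nat.Coprime.symm
    exact (Nat.Prime.coprime_iff_not_dvd hp).2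
      (Nat.not_dvd_of_pos_of_lt (by have := hp.two_le; omega) (by have := hp.two_le; omega))
  rw [hG]
  apply hcop.mul_dvd_of_dvd_of_dvd
  · have h1 : ∀ t, Nat.card (S.ram t) = ∑ g : L ≃ₐ[K] L, if g ∈ S.ram t then 1 else 0 := by
      intro t
      rw [Nat.card_eq_fintype_card, Fintype.card_subtype, Finset.sum_ite, Finset.sum_const_zero, add_zero,
        Finset.sum_const, smul_eq_mul, mul_one]
    simp only [h1]
    rw [Finset.sum_comm]
    apply Finset.dvd_sum
    intro g _
    obtain ⟨iv, hiv⟩ := S.exists_iv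
    rw [Finset.sum_ite, Finset.sum_const_zero, add_zero, Finset.sum_const, smul_eq_mul, mul_one]
    by_cases hg : g = 1
    · subst hg
      simp only [Subgroup.one_mem, Finset.filter_true, Nat.card_Icc, Nat.add_sub_cancel]
      exact S.tame_dvd hab hG hs
    · have h2 : (Finset.Icc 1 u).filter (fun t : ℕ => g ∈ S.ram (t + 1)) = Finset.Icc 1 (min u (iv g - 1).toNat) := by
        ext t
        simp only [Finset.mem_filter, Finset.mem_Icc, mem_ram, hiv g hg]
        norm_cast
        omega
      rw [h2, Nat.card_Icc, Nat.add_sub_cancel]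
      have h3 : (1 : ℤ) ≤ iv g := by have := S.one_le g; rw [hiv g hg] at this; exact_mod_cast this
      rcases min_choice u (iv g - 1).toNat with h | h
      · rw [h]; exact S.tame_dvd hab hG hs
      · rw [h]; exact S.tame_dvd hab hG (s := g) (by rw [hiv g hg]; congr 1; omega)
  · have h1 := S.hasse_arf hab (I := u + 1) (by omega) (by rw [hs]; push_cast; rfl)
    rw [← Finset.insert_Icc_succ_left_eq_Icc (by omega), Finset.sum_insert (by simp)] at h1
    have h2 : Nat.card (S.ram ((1 : ℕ) : ℤ) ⊓ S.ram 2 : Subgroup (L ≃ₐ[K] L)) = Nat.card (S.ram 2) := by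
      have : (S.ram ((1 : ℕ) : ℤ) ⊓ S.ram 2 : Subgroup (L ≃ₐ[K] L)) = S.ram 2 := by
        rw [inf_eq_right]
        exact fun g hg => ge_mono hg (by norm_num)
      rw [this]
    rw [h2, Nat.dvd_add_right (dvd_refl _), S.card_ram2 hab hG] at h1
    convert h1 using 1
    apply Finset.sum_nbij (fun t => t + 1)
    · intro t ht; simp only [Finset.mem_Icc, Nat.succ_eq_succ, Nat.succ_eq_add_one] at ht ⊢; omega
    · intro a _ b _ h; simpa using h
    · intro t ht
      simp only [Finset.coe_Icc, Set.mem_Icc, Nat.succ_eq_succ, Nat.succ_eq_add_one] at ht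
      exact ⟨t - 1, by simp; omega, by simp; omega⟩
    · intro t ht
      simp only [Finset.mem_Icc] at ht
      have : (S.ram ((t + 1 : ℕ) : ℤ) ⊓ S.ram 2 : Subgroup (L ≃ₐ[K] L)) = S.ram (t + 1) := by
        push_cast
        rw [inf_eq_left]
        exact fun g hg => ge_mono hg (by omega)
      rw [this]
end fin
end Setup
end HA

end

section
namespace HA
section phi
variable {p : ℕ} {A : Type} [Field A] (vd : PadicValData A p)
    (K L : Type) [Field K] [Field L] [Algebra K L] (emb : L →+* A)

theorem v_zero {p : ℕ} {A : Type} [Field A] (vd : PadicValData A p) : vd.v 0 = ⊤ := (vd.v_top_iff 0).2 rfl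

theorem inMax_succ {F : Type} [Field F] {emb : F →+* A} {j : ℕ} {y : A}
    (h : InMaxIdealPow vd emb (j + 1) y) : InMaxIdealPow vd emb j y := by
  obtain ⟨u, s, hu, hs, rfl⟩ := h
  refine ⟨u * s 0, fun k => s k.succ, ?_, fun k => hs _, ?_⟩
  · rw [map_mul, vd.v_mul]; exact add_nonneg hu (hs 0).le
  · rw [Fin.prod_univ_succ, map_mul, mul_assoc]

theorem inMax_mono {F : Type} [Field F] {emb : F →+* A} {i j : ℕ} (hij : i ≤ j) {y : A}
    (h : InMaxIdealPow vd emb j y) : InMaxIdealPow vd emb i y := by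
  induction j, hij using Nat.le_induction with
  | base => exact h
  | succ j _ ih => exact ih (inMax_succ vd h)

theorem lower_anti : Antitone (lowerRamSet vd K L emb) := by
  intro i j hij σ hσ x hx
  exact inMax_mono vd (Int.toNat_le_toNat (by omega)) (hσ x hx)

theorem one_mem_lower (i : ℤ) : (1 : L ≃ₐ[K] L) ∈ lowerRamSet vd K L emb i := by
  intro x _
  refine ⟨0, fun _ => 0, ?_, ?_, ?_⟩ <;> simp [v_zero]

variable [FiniteDimensional K L]

theorem card_lower_pos (i : ℤ) : 0 < Nat.card ↥(lowerRamSet vd K L emb i) := by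
  have : Nonempty ↥(lowerRamSet vd K L emb i) := ⟨⟨1, one_mem_lower vd K L emb i⟩⟩
  exact Nat.card_pos

theorem card_lower_anti : Antitone (fun i : ℤ => Nat.card ↥(lowerRamSet vd K L emb i)) := by
  intro i j hij
  exact Nat.card_mono (Set.toFinite _) (lower_anti vd K L emb hij)

theorem integrand_anti : Antitone (fun t : ℝ => (Nat.card ↥(lowerRamSet vd K L emb ⌈t⌉) : ℝ) /
      (Nat.card ↥(lowerRamSet vd K L emb 0) : ℝ)) := by
  intro a b hab
  have := card_lower_anti vd K L emb (Int.ceil_mono hab)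
  simp only at this ⊢
  gcongr

theorem phi_sub (a b : ℝ) : herbrandPhi vd K L emb b - herbrandPhi vd K L emb a =
    ∫ t in a..b, (Nat.card ↥(lowerRamSet vd K L emb ⌈t⌉) : ℝ) /
      (Nat.card ↥(lowerRamSet vd K L emb 0) : ℝ) :=
  intervalIntegral.integral_interval_sub_left (integrand_anti vd K L emb).intervalIntegrable
    (integrand_anti vd K L emb).intervalIntegrable

theorem phi_growth {a b : ℝ} (hab : a ≤ b) :
    (b - a) * (1 / (Nat.card ↥(lowerRamSet vd K L emb 0) : ℝ)) ≤ herbrandPhi vd K L emb b - herbrandPhi vd K L emb a := by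
  rw [phi_sub]
  have h : ∫ t in a..b, (1 / (Nat.card ↥(lowerRamSet vd K L emb 0) : ℝ)) = (b - a) * (1 / (Nat.card ↥(lowerRamSet vd K L emb 0) : ℝ)) := by
    simp
  rw [← h]
  apply intervalIntegral.integral_mono_on hab (by simp) (integrand_anti vd K L emb).intervalIntegrable
  intro x _
  gcongr
  exact_mod_cast card_lower_pos vd K L emb _

theorem phi_strictMono : StrictMono (herbrandPhi vd K L emb) := by
  intro a b hab
  have h1 := phi_growth vd K L emb hab.le
  have h2 : (0 : ℝ) < Nat.card ↥(lowerRamSet vd K L emb 0) := by exact_mod_cast card_lower_pos vd K L emb _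
  have h3 : 0 < (b - a) * (1 / (Nat.card ↥(lowerRamSet vd K L emb 0) : ℝ)) := by
    have : 0 < b - a := by linarith
    positivity
  linarith

theorem phi_zero : herbrandPhi vd K L emb 0 = 0 := by simp [herbrandPhi]

theorem phi_surj : Function.Surjective (herbrandPhi vd K L emb) := by
  have h2 : (0 : ℝ) < 1 / Nat.card ↥(lowerRamSet vd K L emb 0) := by
    have : (0 : ℝ) < Nat.card ↥(lowerRamSet vd K L emb 0) := by exact_mod_cast card_lower_pos vd K L emb _
    positivity
  apply Continuous.surjective
  · exact intervalIntegral.continuous_primitive (fun a b => (integrand_anti vd K L emb).intervalIntegrable) 0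
  · apply Filter.tendsto_atTop_mono' _ _ (Filter.tendsto_id.atTop_mul_const h2)
    filter_upwards [Filter.eventually_ge_atTop 0] with x hx
    have := phi_growth vd K L emb hx
    rw [phi_zero] at this
    simpa using this
  · apply Filter.tendsto_atBot_mono' _ _ (Filter.tendsto_id.atBot_mul_const h2)
    filter_upwards [Filter.eventually_le_atBot 0] with x hx
    have := phi_growth vd K L emb hx
    rw [phi_zero] at this
    simp only [id]
    linarith

theorem psi_phi (x : ℝ) : herbrandPsi vd K L emb (herbrandPhi vd K L emb x) = x :=
  Function.leftInverse_invFun (phi_strictMono vd K L emb).injective x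

theorem phi_psi (x : ℝ) : herbrandPhi vd K L emb (herbrandPsi vd K L emb x) = x :=
  Function.rightInverse_invFun (phi_surj vd K L emb) x

theorem psi_strictMono : StrictMono (herbrandPsi vd K L emb) := by
  intro a b hab
  rw [← (phi_strictMono vd K L emb).lt_iff_lt, phi_psi, phi_psi]
  exact hab

theorem upper_anti : Antitone (upperRamSet vd K L emb) := by
  intro i j hij
  apply lower_anti
  apply Int.ceil_mono
  apply (psi_strictMono vd K L emb).monotone
  exact_mod_cast hij

theorem upper_zero : upperRamSet vd K L emb 0 = lowerRamSet vd K L emb 0 := by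
  have : herbrandPsi vd K L emb ((0 : ℤ) : ℝ) = 0 := by
    have := psi_phi vd K L emb 0
    rw [phi_zero] at this
    simpa using this
  rw [upperRamSet, this]; simp

theorem phi_nat (m : ℕ) : herbrandPhi vd K L emb m =
    ((∑ t ∈ Finset.Icc 1 m, Nat.card ↥(lowerRamSet vd K L emb (t : ℕ)) : ℕ) : ℝ) / (Nat.card ↥(lowerRamSet vd K L emb 0) : ℝ) := by
  induction m with
  | zero => simp [phi_zero]
  | succ m ih =>
    have h := phi_sub vd K L emb m ((m + 1 : ℕ) : ℝ)
    have h2 : ∫ t in (m : ℝ)..((m + 1 : ℕ) : ℝ), (Nat.card ↥(lowerRamSet vd K L emb ⌈t⌉) : ℝ) /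
      (Nat.card ↥(lowerRamSet vd K L emb 0) : ℝ) = ∫ t in (m : ℝ)..((m + 1 : ℕ) : ℝ), (Nat.card ↥(lowerRamSet vd K L emb ((m + 1 : ℕ) : ℤ)) : ℝ) /
      (Nat.card ↥(lowerRamSet vd K L emb 0) : ℝ) := by
      apply intervalIntegral.integral_congr_ae
      apply Filter.Eventually.of_forall
      intro x hx
      rw [Set.uIoc_of_le (by push_cast; linarith)] at hx
      have : ⌈x⌉ = ((m + 1 : ℕ) : ℤ) := by
        rw [Int.ceil_eq_iff]
        push_cast at hx ⊢
        exact ⟨by linarith [hx.1], hx.2⟩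
      rw [this]
    rw [h2, intervalIntegral.integral_const, ih] at h
    rw [Finset.sum_Icc_succ_top (by omega)]
    rw [sub_eq_iff_eq_add] at h
    rw [h]
    push_cast
    simp only [smul_eq_mul]
    ring

theorem upper_of_phi {u : ℕ} {v : ℤ} (h : herbrandPhi vd K L emb u = v) :
    upperRamSet vd K L emb v = lowerRamSet vd K L emb u := by
  rw [upperRamSet, ← h, psi_phi]; simp
end phi
end HA

end

section
namespace HA
section comb
variable {p : ℕ} {A : Type} [Field A] {vd : PadicValData A p}
    {K L : Type} [Field K] [Field L] [Algebra K L] [FiniteDimensional K L] [IsGalois K L] {emb : L →+* A}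
    {w : AddValuation L (WithTop ℤ)} {Pi : L} (S : Setup K L p w Pi)
    (hlow : ∀ m : ℕ, lowerRamSet vd K L emb (m : ℤ) = (S.ram ((m : ℤ) + 1) : Set (L ≃ₐ[K] L)))
    (hab : ∀ σ τ : L ≃ₐ[K] L, σ * τ = τ * σ) {n : ℕ} (hram : RamCond vd K L emb n)

include hram in
theorem card_upper {j : ℕ} (hj : j ≤ n) : Nat.card ↥(upperRamSet vd K L emb ((n + 1 - j : ℕ) : ℤ)) = p ^ j := by
  obtain ⟨-, -, -, -, h, h1⟩ := hram
  induction j with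
  | zero => 
    push_cast; rw [h1]; simp
  | succ j ih =>
    have := h (n + 1 - (j + 1)) (by omega) (by omega)
    rw [this, pow_succ, mul_comm, ← ih (by omega)]
    congr 4
    omega

include hram in
theorem card_upper' {j : ℕ} (hj1 : 1 ≤ j) (hj : j ≤ n + 1) : Nat.card ↥(upperRamSet vd K L emb (j : ℤ)) = p ^ (n + 1 - j) := by
  rw [← card_upper hram (j := n + 1 - j) (by omega)]
  congr 4; omega

include hram in
theorem card_G : Nat.card (L ≃ₐ[K] L) = (p - 1) * p ^ n := by
  have h := hram.2.2.2.1
  rw [hram.2.1] at h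
  have h1 := card_upper' hram (j := 1) le_rfl (by omega)
  rw [Nat.cast_one] at h1
  rw [h1] at h
  simpa using h

include hram in
theorem lower_zero_univ : lowerRamSet vd K L emb 0 = Set.univ := by
  rw [← upper_zero, hram.2.1]

include hlow hab hram in
theorem lemA {s : L ≃ₐ[K] L} (hs : s ≠ 1) : ∃ u v : ℕ, w (s Pi - Pi) = ((u + 1 : ℤ) : WithTop ℤ) ∧
    herbrandPhi vd K L emb u = v ∧ s ∈ upperRamSet vd K L emb v ∧ s ∉ upperRamSet vd K L emb (v + 1) := by
  obtain ⟨iv, hiv⟩ := S.exists_iv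
  have h1 : s ∈ lowerRamSet vd K L emb ((0 : ℕ) : ℤ) := by
    rw [Nat.cast_zero, lower_zero_univ hram]; trivial
  rw [hlow, SetLike.mem_coe, Setup.mem_ram, hiv s hs] at h1
  norm_cast at h1
  obtain ⟨u, hu⟩ : ∃ u : ℕ, iv s = u + 1 := ⟨(iv s - 1).toNat, by omega⟩
  have hw : w (s Pi - Pi) = ((u + 1 : ℤ) : WithTop ℤ) := by rw [hiv s hs, hu]
  obtain ⟨v, hv⟩ := S.hasse_arf' hab (card_G hram) hw
  have hN : (Nat.card (L ≃ₐ[K] L) : ℝ) ≠ 0 := by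
    have : 0 < Nat.card (L ≃ₐ[K] L) := Nat.card_pos
    positivity
  have hphi : herbrandPhi vd K L emb u = v := by
    rw [phi_nat, lower_zero_univ hram]
    simp only [hlow]
    have e : Nat.card (Set.univ : Set (L ≃ₐ[K] L)) = Nat.card (L ≃ₐ[K] L) := by simp
    rw [e, div_eq_iff hN, mul_comm]
    exact_mod_cast hv
  refine ⟨u, v, hw, hphi, ?_, ?_⟩
  · rw [upper_of_phi vd K L emb (v := (v : ℤ)) (by exact_mod_cast hphi), hlow, SetLike.mem_coe, Setup.mem_ram, hw]
  · intro hmem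
    have h2 : (u : ℝ) < herbrandPsi vd K L emb (((v : ℤ) + 1 : ℤ) : ℝ) := by
      have := psi_phi vd K L emb u
      rw [hphi] at this
      rw [← this]
      apply psi_strictMono
      push_cast; linarith
    have h3 : ((u + 1 : ℕ) : ℤ) ≤ ⌈herbrandPsi vd K L emb (((v : ℤ) + 1 : ℤ) : ℝ)⌉ := by
      have : (u : ℤ) < ⌈herbrandPsi vd K L emb (((v : ℤ) + 1 : ℤ) : ℝ)⌉ := by
        rw [Int.lt_ceil]; exact_mod_cast h2
      rw [Nat.cast_add, Nat.cast_one]; omega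
    have h4 := lower_anti vd K L emb h3 hmem
    rw [hlow, SetLike.mem_coe, Setup.mem_ram, hw] at h4
    norm_cast at h4
    omega

theorem sum_const_tail (f : ℕ → ℕ) (a u c : ℕ) (hau : a ≤ u) (h : ∀ t, a < t → t ≤ u → f t = c) :
    ∑ t ∈ Finset.Icc 1 u, f t = ∑ t ∈ Finset.Icc 1 a, f t + (u - a) * c := by
  induction u, hau using Nat.le_induction with
  | base => simp
  | succ u hau ih =>
    rw [Finset.sum_Icc_succ_top (by omega), ih (fun t h1 h2 => h t h1 (by omega)), h (u + 1) (by omega) le_rfl]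
    rw [show u + 1 - a = (u - a) + 1 by omega]; ring

include hlow hab hram in
theorem lemB {j : ℕ} (hj : j ≤ n) : herbrandPhi vd K L emb ((p ^ j - 1 : ℕ) : ℝ) = j := by
  have hp := S.pp
  induction j with
  | zero => simp [phi_zero]
  | succ j ih =>
    have ih := ih (by omega)
    set a := p ^ j - 1 with ha
    have hpj : 0 < p ^ j := Nat.pow_pos hp.pos
    have hc1 := card_upper' hram (j := j + 1) (by omega) (by omega)
    have hc2 := card_upper' hram (j := j + 2) (by omega) (by omega)
    obtain ⟨s, hs1, hs2⟩ : ∃ s, s ∈ upperRamSet vd K L emb ((j + 1 : ℕ) : ℤ) ∧ s ∉ upperRamSet vd K L emb ((j + 2 : ℕ) : ℤ) := by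
      by_contra hcon
      push Not at hcon
      have := Nat.card_mono (Set.toFinite _) (show upperRamSet vd K L emb ((j + 1 : ℕ) : ℤ) ⊆ upperRamSet vd K L emb ((j + 2 : ℕ) : ℤ) from hcon)
      rw [hc1, hc2] at this
      have h2 := Nat.pow_lt_pow_right hp.one_lt (show n + 1 - (j + 2) < n + 1 - (j + 1) by omega)
      omega
    have hs : s ≠ 1 := by
      rintro rfl; exact hs2 (one_mem_lower vd K L emb _)
    obtain ⟨u, v, hw, hphi, hv1, hv2⟩ := lemA S hlow hab hram hs
    have hvj : v = j + 1 := by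
      apply le_antisymm
      · by_contra hh
        exact hs2 (upper_anti vd K L emb (show ((j + 2 : ℕ) : ℤ) ≤ v by push_cast; omega) hv1)
      · by_contra hh
        exact hv2 (upper_anti vd K L emb (show ((v : ℤ) + 1) ≤ (j + 1 : ℕ) by push_cast; omega) hs1)
    subst hvj
    have hau : a < u := by
      have : (a : ℝ) < u := by
        apply (phi_strictMono vd K L emb).lt_iff_lt.1
        rw [hphi, ih]; push_cast; linarith
      exact_mod_cast this
    have hup : upperRamSet vd K L emb ((j + 1 : ℕ) : ℤ) = lowerRamSet vd K L emb (u : ℤ) :=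
      upper_of_phi vd K L emb (by exact_mod_cast hphi)
    have hmid : ∀ t : ℕ, a < t → t ≤ u → Nat.card ↥(lowerRamSet vd K L emb (t : ℕ)) = p ^ (n - j) := by
      intro t ht1 ht2
      rw [show n - j = n + 1 - (j + 1) by omega, ← hc1]
      congr 2
      apply Set.Subset.antisymm
      · intro r hr
        by_cases hr1 : r = 1
        · subst hr1; exact one_mem_lower vd K L emb _
        obtain ⟨u', v', hw', hphi', hv1', hv2'⟩ := lemA S hlow hab hram hr1
        rw [hlow, SetLike.mem_coe, Setup.mem_ram, hw'] at hr
        norm_cast at hr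
        have : (j : ℝ) < v' := by
          rw [← ih, ← hphi']
          apply phi_strictMono
          exact_mod_cast (by omega : a < u')
        have : j < v' := by exact_mod_cast this
        exact upper_anti vd K L emb (by exact_mod_cast this) hv1'
      · rw [hup]
        exact lower_anti vd K L emb (by exact_mod_cast ht2)
    have hN : (Nat.card (L ≃ₐ[K] L) : ℝ) ≠ 0 := by
      have : 0 < Nat.card (L ≃ₐ[K] L) := Nat.card_pos
      positivity
    have e : Nat.card (Set.univ : Set (L ≃ₐ[K] L)) = Nat.card (L ≃ₐ[K] L) := by simp
    rw [phi_nat, lower_zero_univ hram, e, div_eq_iff hN] at hphi ih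
    have hphi' : ∑ t ∈ Finset.Icc 1 u, Nat.card ↥(lowerRamSet vd K L emb (t : ℕ)) = (j + 1) * Nat.card (L ≃ₐ[K] L) := by
      exact_mod_cast hphi
    have ih' : ∑ t ∈ Finset.Icc 1 a, Nat.card ↥(lowerRamSet vd K L emb (t : ℕ)) = j * Nat.card (L ≃ₐ[K] L) := by
      exact_mod_cast ih
    rw [sum_const_tail _ a u _ hau.le hmid, ih', card_G hram] at hphi'
    have hq : (u - a) * p ^ (n - j) = ((p - 1) * p ^ j) * p ^ (n - j) := by
      rw [mul_assoc, ← pow_add, show j + (n - j) = n by omega]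
      linarith
    have hq2 := Nat.eq_of_mul_eq_mul_right (Nat.pow_pos hp.pos) hq
    have : u = p ^ (j + 1) - 1 := by
      have h5 : p ^ (j + 1) = (p - 1) * p ^ j + p ^ j := by
        rw [pow_succ, Nat.sub_mul, mul_comm, one_mul]
        have := Nat.le_mul_of_pos_left (p ^ j) hp.pos
        omega
      omega
    rw [← this, phi_nat, lower_zero_univ hram, e, div_eq_iff hN]
    exact hphi

include hlow hab hram in
theorem upper_eq {j : ℕ} (hj : j ≤ n) : upperRamSet vd K L emb (j : ℤ) = (S.ram (p ^ j) : Set (L ≃ₐ[K] L)) := by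
  have hpj : 0 < p ^ j := Nat.pow_pos S.pp.pos
  rw [upper_of_phi vd K L emb (u := p ^ j - 1) (v := j) (by exact_mod_cast lemB S hlow hab hram hj), hlow]
  congr 2
  push_cast [Nat.cast_sub (show 1 ≤ p ^ j from hpj)]
  ring

include hlow hab hram in
theorem val_eq {j : ℕ} (hj : j ≤ n) {s : L ≃ₐ[K] L} (h1 : s ∈ upperRamSet vd K L emb (j : ℤ))
    (h2 : s ∉ upperRamSet vd K L emb ((j : ℤ) + 1)) : w (s Pi - Pi) = ((p ^ j : ℤ) : WithTop ℤ) := by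
  have hpj : 0 < p ^ j := Nat.pow_pos S.pp.pos
  have hs : s ≠ 1 := by
    rintro rfl; exact h2 (one_mem_lower vd K L emb _)
  obtain ⟨u, v, hw, hphi, hv1, hv2⟩ := lemA S hlow hab hram hs
  have hvj : v = j := by
    apply le_antisymm
    · by_contra hh
      exact h2 (upper_anti vd K L emb (show ((j : ℤ) + 1) ≤ v by omega) hv1)
    · by_contra hh
      exact hv2 (upper_anti vd K L emb (show ((v : ℤ) + 1) ≤ j by omega) h1)
  subst hvj
  have : (u : ℝ) = ((p ^ v - 1 : ℕ) : ℝ) := by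
    apply (phi_strictMono vd K L emb).injective
    rw [hphi, lemB S hlow hab hram hj]
  have : u = p ^ v - 1 := by exact_mod_cast this
  rw [hw, this]
  congr 1
  push_cast [Nat.cast_sub (show 1 ≤ p ^ v from hpj)]
  ring
end comb
end HA

end

section
namespace HA
section padic
variable {p : ℕ} [Fact p.Prime] {L : Type} [Field L] [Algebra ℚ_[p] L]

theorem exists_sqrt (hp : Odd p) (z : ℤ_[p]) : ∃ y : ℤ_[p], 1 + p * z = (1 + p * y) ^ 2 := by
  have h2 : ‖(2 : ℤ_[p])‖ = 1 := by
    have : ¬ ‖((2 : ℕ) : ℤ_[p])‖ < 1 := by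
      rw [PadicInt.norm_natCast_lt_one_iff]
      intro h
      have := (Nat.prime_dvd_prime_iff_eq (Fact.out : p.Prime) Nat.prime_two).1 h
      subst this
      exact absurd hp (by decide)
    have h3 := PadicInt.norm_le_one (2 : ℤ_[p])
    push_cast at this
    linarith
  have hpz : ‖(p : ℤ_[p]) * z‖ < 1 := (PadicInt.norm_lt_one_iff_dvd _).2 (Dvd.intro _ rfl)
  obtain ⟨y, hy1, hy2, -, -⟩ := hensels_lemma (p := p) (R := ℤ_[p]) (F := (Polynomial.X ^ 2 - Polynomial.C (1 + (p : ℤ_[p]) * z)))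
    (a := 1) (by simp at hpz ⊢; rw [one_add_one_eq_two, h2]; simpa using hpz)
  have hd : ‖y - 1‖ < 1 := by
    refine hy2.trans_le ?_
    exact PadicInt.norm_le_one _
  obtain ⟨t, ht⟩ := (PadicInt.norm_lt_one_iff_dvd _).1 hd
  refine ⟨t, ?_⟩
  have : y = 1 + p * t := by rw [← ht]; ring
  rw [← this]
  simp only [map_sub, map_pow, Polynomial.aeval_X, Polynomial.aeval_C, sub_eq_zero] at hy1
  exact hy1.symm

variable (w : AddValuation L (WithTop ℤ)) 

theorem zp_one (hp : Odd p) (z : ℤ_[p]) : w (algebraMap ℚ_[p] L ((1 + p * z : ℤ_[p]) : ℚ_[p])) = ((0 : ℤ) : WithTop ℤ) := by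
  have hne : ∀ z : ℤ_[p], algebraMap ℚ_[p] L ((1 + p * z : ℤ_[p]) : ℚ_[p]) ≠ 0 := by
    intro z h
    rw [map_eq_zero, PadicInt.coe_eq_zero] at h
    have h1 : ‖(p : ℤ_[p]) * z‖ < 1 := (PadicInt.norm_lt_one_iff_dvd _).2 (Dvd.intro _ rfl)
    rw [show (p : ℤ_[p]) * z = -1 by linear_combination h] at h1
    simp at h1
  have key : ∀ k : ℕ, ∀ z : ℤ_[p], ∃ m : ℤ, w (algebraMap ℚ_[p] L ((1 + p * z : ℤ_[p]) : ℚ_[p])) = ((2 ^ k * m : ℤ) : WithTop ℤ) := by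
    intro k
    induction k with
    | zero => intro z; obtain ⟨m, hm⟩ := exists_int w (hne z); exact ⟨m, by simpa using hm⟩
    | succ k ih =>
      intro z
      obtain ⟨y, hy⟩ := exists_sqrt hp z
      obtain ⟨m, hm⟩ := ih y
      refine ⟨m, ?_⟩
      rw [hy, PadicInt.coe_pow, map_pow, eq_pow w hm]
      congr 1; push_cast; ring
  obtain ⟨m, hm⟩ := exists_int w (hne z)
  rw [hm]
  obtain ⟨t, ht⟩ := key (m.natAbs) z
  rw [hm] at ht
  norm_cast at ht ⊢
  have h1 : m.natAbs < 2 ^ m.natAbs := Nat.lt_two_pow_self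
  apply Int.eq_zero_of_abs_lt_dvd (m := 2 ^ m.natAbs) (Dvd.intro _ ht.symm)
  rw [Int.abs_eq_natAbs]
  exact_mod_cast h1

theorem zp_nonneg (hp : Odd p) (z : ℤ_[p]) : ((0 : ℤ) : WithTop ℤ) ≤ w (algebraMap ℚ_[p] L (z : ℚ_[p])) := by
  by_contra hcon
  rw [not_le] at hcon
  have hz : algebraMap ℚ_[p] L (z : ℚ_[p]) ≠ 0 := by
    intro h; rw [h] at hcon; simp at hcon
  have hpp : (p : L) ≠ 0 := by
    have : (p : L) = algebraMap ℚ_[p] L (p : ℚ_[p]) := by simp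
    rw [this, map_ne_zero]
    exact_mod_cast (Fact.out : p.Prime).ne_zero
  obtain ⟨m, hm⟩ := exists_int w hz
  obtain ⟨e, he⟩ := exists_int w hpp
  rw [hm] at hcon
  norm_cast at hcon
  have h0 := zp_one (L := L) w hp (z ^ (e.natAbs + 1))
  rw [PadicInt.coe_add, PadicInt.coe_mul, PadicInt.coe_one, PadicInt.coe_pow, PadicInt.coe_natCast, map_add, map_mul, map_one, map_pow, map_natCast] at h0
  have h1 := eq_mul w he (eq_pow w hm (e.natAbs + 1))
  have hneg : e + ((e.natAbs + 1 : ℕ) : ℤ) * m < 0 := by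
    have : e ≤ e.natAbs := by omega
    have h3 : (0 : ℤ) ≤ e.natAbs := by omega
    have h4 : (e.natAbs : ℤ) * (m + 1) ≤ 0 := mul_nonpos_of_nonneg_of_nonpos h3 (by omega)
    rw [Nat.cast_add, Nat.cast_one]
    linarith
  have h2 := eq_add w (y := (1 : L)) h1 (by rw [w.map_one]; exact_mod_cast hneg)
  rw [add_comm, h0] at h2
  have h6 := WithTop.coe_injective h2
  omega

theorem qp_val (hp : Odd p) {e : ℤ} (he : w (p : L) = e) {x : ℚ_[p]} (hx : x ≠ 0) :
    w (algebraMap ℚ_[p] L x) = ((e * x.valuation : ℤ) : WithTop ℤ) := by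
  have hpp : (p : ℚ_[p]) ≠ 0 := by exact_mod_cast (Fact.out : p.Prime).ne_zero
  have hu : ∀ z : ℤ_[p]ˣ, w (algebraMap ℚ_[p] L ((z : ℤ_[p]) : ℚ_[p])) = ((0 : ℤ) : WithTop ℤ) := by
    intro z
    have h1 := zp_nonneg (L := L) w hp z
    have h2 := zp_nonneg (L := L) w hp (z⁻¹ : ℤ_[p]ˣ)
    have h3 : algebraMap ℚ_[p] L ((z : ℤ_[p]) : ℚ_[p]) * algebraMap ℚ_[p] L (((z⁻¹ : ℤ_[p]ˣ) : ℤ_[p]) : ℚ_[p]) = 1 := by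
      rw [← map_mul, ← PadicInt.coe_mul, Units.mul_inv]; simp
    obtain ⟨a, ha⟩ := exists_int w (left_ne_zero_of_mul_eq_one h3)
    obtain ⟨b, hb⟩ := exists_int w (right_ne_zero_of_mul_eq_one h3)
    have h4 := eq_mul w ha hb
    rw [h3, w.map_one] at h4
    rw [ha] at h1 ⊢; rw [hb] at h2
    norm_cast at *; omega
  have hpz : ∀ m : ℤ, w (algebraMap ℚ_[p] L ((p : ℚ_[p]) ^ m)) = ((e * m : ℤ) : WithTop ℤ) := by
    have he' : w (algebraMap ℚ_[p] L (p : ℚ_[p])) = e := by simpa using he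
    intro m
    obtain ⟨k, rfl | rfl⟩ := Int.eq_nat_or_neg m
    · rw [zpow_natCast, map_pow, eq_pow w he']; congr 1; ring
    · rw [zpow_neg, zpow_natCast, map_inv₀, map_pow, ← one_div, 
        eq_div w (show w 1 = ((0 : ℤ) : WithTop ℤ) by simp) (eq_pow w he' k)]
      congr 1; ring
  have hn : ‖x * (p : ℚ_[p]) ^ (-x.valuation)‖ = 1 := by
    rw [norm_mul, Padic.norm_eq_zpow_neg_valuation hx, Padic.norm_p_zpow, neg_neg, ← zpow_add₀ (by exact_mod_cast (Fact.out : p.Prime).ne_zero)]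
    simp
  set u := PadicInt.mkUnits hn
  have := hu u
  rw [PadicInt.mkUnits_eq] at this
  have h5 := eq_mul w this (hpz x.valuation)
  rw [← map_mul, mul_assoc, ← zpow_add₀ hpp] at h5
  simpa using h5
end padic
end HA

end

section
namespace HA
section abs
variable {L : Type} [Field L] (w : AddValuation L (WithTop ℤ)) 

open Classical in
noncomputable def nrm (b : ℝ) (x : L) : ℝ := if x = 0 then 0 else b ^ (-(w x).untopD 0)

theorem nrm_eq {b : ℝ} {x : L} {m : ℤ} (h : w x = m) : nrm w b x = b ^ (-m) := by
  rw [nrm, if_neg (ne_zero_of_eq w h), h]; simp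

theorem nrm_zero {b : ℝ} : nrm w b 0 = 0 := by simp [nrm]

theorem nrm_le {b : ℝ} (hb : 1 < b) {x : L} {m : ℤ} : nrm w b x ≤ b ^ (-m) ↔ (m : WithTop ℤ) ≤ w x := by
  by_cases hx : x = 0
  · subst hx; rw [nrm_zero]; simp; positivity
  · obtain ⟨k, hk⟩ := exists_int w hx
    rw [nrm_eq w hk, hk, zpow_le_zpow_iff_right₀ hb]
    norm_cast
    omega

noncomputable def absv (b : ℝ) (hb : 1 < b) : AbsoluteValue L ℝ where
  toFun := nrm w b
  map_mul' x y := by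
    by_cases hx : x = 0
    · subst hx; simp [nrm_zero]
    by_cases hy : y = 0
    · subst hy; simp [nrm_zero]
    obtain ⟨k, hk⟩ := exists_int w hx
    obtain ⟨l, hl⟩ := exists_int w hy
    rw [nrm_eq w hk, nrm_eq w hl, nrm_eq w (eq_mul w hk hl), ← zpow_add₀ (by positivity)]
    congr 1; ring
  nonneg' x := by
    rw [nrm]; split_ifs
    · exact le_rfl
    · positivity
  eq_zero' x := by
    constructor
    · intro h
      by_contra hx
      rw [nrm, if_neg hx] at h
      have : 0 < b ^ (-(w x).untopD 0) := by positivity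
      linarith
    · rintro rfl; exact nrm_zero w
  add_le' x y := by
    have hnn : ∀ x : L, 0 ≤ nrm w b x := by
      intro x
      rw [nrm]; split_ifs
      · exact le_rfl
      · positivity
    by_cases hxy : x + y = 0
    · rw [hxy, nrm_zero]; exact add_nonneg (hnn x) (hnn y)
    obtain ⟨k, hk⟩ := exists_int w hxy
    have h := w.map_add x y
    rw [hk] at h
    rw [nrm_eq w hk]
    rcases min_le_iff.1 h with h | h
    · by_cases hx : x = 0
      · rw [hx] at h; simp at h
      obtain ⟨l, hl⟩ := exists_int w hx
      rw [hl] at h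
      have : b ^ (-k) ≤ nrm w b x := by
        rw [nrm_eq w hl, zpow_le_zpow_iff_right₀ hb]; norm_cast at h; omega
      linarith [hnn y]
    · by_cases hx : y = 0
      · rw [hx] at h; simp at h
      obtain ⟨l, hl⟩ := exists_int w hx
      rw [hl] at h
      have : b ^ (-k) ≤ nrm w b y := by
        rw [nrm_eq w hl, zpow_le_zpow_iff_right₀ hb]; norm_cast at h; omega
      linarith [hnn x]
end abs

section topo
variable {p : ℕ} [Fact p.Prime] {L : Type} [Field L] [Algebra ℚ_[p] L] [FiniteDimensional ℚ_[p] L]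
  (w : AddValuation L (WithTop ℤ)) 

theorem exists_base {e : ℤ} (he1 : 1 ≤ e) : ∃ b : ℝ, 1 < b ∧ b ^ e = p := by
  have hp : (1 : ℝ) < p := by exact_mod_cast (Fact.out : p.Prime).one_lt
  have he : (0 : ℝ) < e := by exact_mod_cast he1
  refine ⟨(p : ℝ) ^ (1 / (e : ℝ)), Real.one_lt_rpow hp (by positivity), ?_⟩
  rw [← Real.rpow_intCast, ← Real.rpow_mul (by positivity)]
  field_simp
  simp

theorem small_zpow {b : ℝ} (hb : 1 < b) {ε : ℝ} (hε : 0 < ε) : ∃ m : ℤ, b ^ (-m) < ε := by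
  obtain ⟨n, hn⟩ := exists_pow_lt_of_lt_one hε (inv_lt_one_of_one_lt₀ hb)
  exact ⟨n, by simpa [zpow_neg, inv_pow] using hn⟩

theorem topo (hp : Odd p) {e : ℤ} (he1 : 1 ≤ e) (he : w (p : L) = e) :
    (∀ x : ℕ → L, (∀ k, ((0 : ℤ) : WithTop ℤ) ≤ w (x k)) → ∃ (c : L) (φ : ℕ → ℕ), StrictMono φ ∧
      ∀ m : ℤ, ∃ k0, ∀ k ≥ k0, (m : WithTop ℤ) ≤ w (x (φ k) - c)) ∧
    (∀ (W : Submodule ℚ_[p] L) (x : L), (∀ m : ℤ, ∃ y ∈ W, (m : WithTop ℤ) ≤ w (x - y)) → x ∈ W) := by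
  obtain ⟨b, hb, hbe⟩ := exists_base (p := p) he1
  letI : NormedField L := (absv w b hb).toNormedField
  have hnorm : ∀ x : L, ‖x‖ = nrm w b x := fun x => rfl
  letI : NormedAlgebra ℚ_[p] L :=
    { (inferInstance : Algebra ℚ_[p] L) with
      norm_smul_le := by
        intro r x
        rw [Algebra.smul_def, norm_mul]
        apply le_of_eq
        congr 1
        rw [hnorm]
        by_cases hr : r = 0
        · subst hr; simp [nrm_zero]
        rw [nrm_eq w (qp_val w hp he hr), Padic.norm_eq_zpow_neg_valuation hr, ← hbe, ← zpow_mul]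
        congr 1; ring }
  haveI : ProperSpace L := FiniteDimensional.proper ℚ_[p] L
  refine ⟨?_, ?_⟩
  · intro x hx
    have hx' : ∀ k, x k ∈ Metric.closedBall (0 : L) 1 := by
      intro k
      rw [mem_closedBall_zero_iff, hnorm]
      simpa using (nrm_le w hb (m := 0)).2 (hx k)
    obtain ⟨c, -, φ, hφ, hc⟩ := tendsto_subseq_of_bounded Metric.isBounded_closedBall hx'
    refine ⟨c, φ, hφ, fun m => ?_⟩
    obtain ⟨k0, hk0⟩ := Metric.tendsto_atTop.1 hc (b ^ (-m)) (by positivity)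
    refine ⟨k0, fun k hk => ?_⟩
    rw [← nrm_le w hb, ← hnorm, ← dist_eq_norm]
    exact (hk0 k hk).le
  · intro W x hx
    have hcl : IsClosed (W : Set L) := W.closed_of_finiteDimensional
    rw [← SetLike.mem_coe, ← hcl.closure_eq, Metric.mem_closure_iff]
    intro ε hε
    obtain ⟨m, hm⟩ := small_zpow hb hε
    obtain ⟨y, hy, hxy⟩ := hx m
    refine ⟨y, hy, ?_⟩
    rw [dist_eq_norm, hnorm]
    exact ((nrm_le w hb).2 hxy).trans_lt hm
end topo
end HA

end

section
namespace HA
section mk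
section pw
variable {p : ℕ} {L : Type} [Field L] (w : AddValuation L (WithTop ℤ)) (hp : p.Prime)
  (hpw : ((1 : ℤ) : WithTop ℤ) ≤ w (p : L))

include hp hpw in
theorem pow_decomp {a b : L} {m : ℤ} (hb : ((0 : ℤ) : WithTop ℤ) ≤ w b) (hm : 0 ≤ m) (h : (m : WithTop ℤ) ≤ w (a - b)) :
    ((m + 1 : ℤ) : WithTop ℤ) ≤ w (a ^ p - b ^ p - (a - b) ^ p) := by
  have hd : ((0 : ℤ) : WithTop ℤ) ≤ w (a - b) := ge_mono h hm
  obtain ⟨r, hr⟩ := exists_add_pow_prime_eq hp (⟨b, hb⟩ : Setup.Oring w) (⟨a - b, hd⟩ : Setup.Oring w)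
  have hr' := congrArg Subtype.val hr
  simp at hr'
  rw [hr', show b ^ p + (a - b) ^ p + p * b * (a - b) * (r : L) - b ^ p - (a - b) ^ p = p * b * (a - b) * (r : L) by ring]
  have := ge_mul w (ge_mul w (ge_mul w hpw hb) h) r.2
  exact ge_mono this (by omega)

theorem ge_pow' {x : L} {m : ℤ} (h : (m : WithTop ℤ) ≤ w x) (k : ℕ) : ((k * m : ℤ) : WithTop ℤ) ≤ w (x ^ k) := by
  induction k with
  | zero => simp
  | succ k ih => rw [pow_succ]; exact ge_mono (ge_mul w ih h) (by push_cast; linarith)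

theorem ge_pow0 {x : L} (h : ((0 : ℤ) : WithTop ℤ) ≤ w x) (k : ℕ) : ((0 : ℤ) : WithTop ℤ) ≤ w (x ^ k) := 
  ge_mono (ge_pow' w h k) (by simp)

include hp hpw in
theorem pow_close {a b : L} {m : ℤ} (hb : ((0 : ℤ) : WithTop ℤ) ≤ w b) (hm : 1 ≤ m) (h : (m : WithTop ℤ) ≤ w (a - b)) :
    ((m + 1 : ℤ) : WithTop ℤ) ≤ w (a ^ p - b ^ p) := by
  have h1 := pow_decomp w hp hpw hb (by omega) h
  have h2 := ge_pow' w h p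
  have h3 : m + 1 ≤ p * m := by
    have : (2 : ℤ) ≤ p := by exact_mod_cast hp.two_le
    nlinarith
  have := w.map_le_add h1 (ge_mono h2 h3)
  simpa using this

include hp hpw in
theorem pow_close_iter {a b : L} (ha : ((0 : ℤ) : WithTop ℤ) ≤ w a) (hb : ((0 : ℤ) : WithTop ℤ) ≤ w b) (h : ((1 : ℤ) : WithTop ℤ) ≤ w (a - b)) (k : ℕ) :
    ((k + 1 : ℤ) : WithTop ℤ) ≤ w (a ^ p ^ k - b ^ p ^ k) := by
  induction k with
  | zero => simpa using h
  | succ k ih =>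
    have := pow_close w hp hpw (ge_pow0 w hb _) (by omega) ih
    rw [pow_succ, pow_mul, pow_mul]
    exact_mod_cast this

include hp hpw in
theorem pow_inj {a b : L} (ha : ((0 : ℤ) : WithTop ℤ) ≤ w a) (hb : ((0 : ℤ) : WithTop ℤ) ≤ w b) 
    (h : ((1 : ℤ) : WithTop ℤ) ≤ w (a ^ p - b ^ p)) : ((1 : ℤ) : WithTop ℤ) ≤ w (a - b) := by
  have hd : ((0 : ℤ) : WithTop ℤ) ≤ w (a - b) := w.map_le_sub ha hb
  have h1 := pow_decomp w hp hpw hb le_rfl hd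
  have h2 := w.map_le_sub h (by simpa using h1)
  rw [sub_sub_cancel] at h2
  by_contra hcon
  have h0 : a - b ≠ 0 := by rintro h0; rw [h0] at hcon; simp at hcon
  obtain ⟨m, hm⟩ := exists_int w h0
  rw [hm] at hcon hd
  rw [eq_pow w hm] at h2
  norm_cast at *
  have : m = 0 := by omega
  subst this
  simp at h2

include hp hpw in
theorem pow_inj_iter {a b : L} (ha : ((0 : ℤ) : WithTop ℤ) ≤ w a) (hb : ((0 : ℤ) : WithTop ℤ) ≤ w b) (k : ℕ)
    (h : ((1 : ℤ) : WithTop ℤ) ≤ w (a ^ p ^ k - b ^ p ^ k)) : ((1 : ℤ) : WithTop ℤ) ≤ w (a - b) := by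
  induction k with
  | zero => simpa using h
  | succ k ih =>
    apply ih
    rw [pow_succ, pow_mul, pow_mul] at h
    exact pow_inj w hp hpw (ge_pow0 w ha _) (ge_pow0 w hb _) h
end pw

variable {p : ℕ} [Fact p.Prime] {K L : Type} [Field K] [Field L] [Algebra ℚ_[p] K] [FiniteDimensional ℚ_[p] K]
    [Algebra K L] [FiniteDimensional K L] [IsGalois K L] 
    (w : AddValuation L (WithTop ℤ))

theorem topoK (hp : Odd p) (hpw : ((1 : ℤ) : WithTop ℤ) ≤ w (p : L)) :
    (∀ x : ℕ → L, (∀ k, ((0 : ℤ) : WithTop ℤ) ≤ w (x k)) → ∃ (c : L) (φ : ℕ → ℕ), StrictMono φ ∧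
      ∀ m : ℤ, ∃ k0, ∀ k ≥ k0, (m : WithTop ℤ) ≤ w (x (φ k) - c)) ∧
    (∀ (W : Submodule K L) (x : L), (∀ m : ℤ, ∃ y ∈ W, (m : WithTop ℤ) ≤ w (x - y)) → x ∈ W) := by
  letI : Algebra ℚ_[p] L := ((algebraMap K L).comp (algebraMap ℚ_[p] K)).toAlgebra
  haveI : IsScalarTower ℚ_[p] K L := IsScalarTower.of_algebraMap_eq (fun x => rfl)
  haveI : FiniteDimensional ℚ_[p] L := FiniteDimensional.trans ℚ_[p] K L
  have hpp : (p : L) ≠ 0 := by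
    have : (p : L) = algebraMap ℚ_[p] L (p : ℚ_[p]) := by simp
    rw [this, map_ne_zero]
    exact_mod_cast (Fact.out : p.Prime).ne_zero
  obtain ⟨e, he⟩ := exists_int w hpp
  have he1 : 1 ≤ e := by rw [he] at hpw; exact_mod_cast hpw
  obtain ⟨h1, h2⟩ := topo w hp he1 he
  refine ⟨h1, fun W x hx => ?_⟩
  exact h2 (W.restrictScalars ℚ_[p]) x hx

theorem res_aux (hp : Odd p) (hpw : ((1 : ℤ) : WithTop ℤ) ≤ w (p : L)) 
    (hinv : ∀ (g : L ≃ₐ[K] L) x, w (g x) = w x)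
    (htriv : ∀ (g : L ≃ₐ[K] L) x, ((0 : ℤ) : WithTop ℤ) ≤ w x → ((1 : ℤ) : WithTop ℤ) ≤ w (g x - x))
    (x : L) (hx : ((0 : ℤ) : WithTop ℤ) ≤ w x) : ∃ c : K, ((1 : ℤ) : WithTop ℤ) ≤ w (x - algebraMap K L c) := by
  have hpr : p.Prime := Fact.out
  have htop := (topoK (K := K) (L := L) w hp hpw).1
  obtain ⟨c, φ, hφ, hc⟩ := htop (fun k => x ^ p ^ k) (fun k => ge_pow0 w hx _)
  obtain ⟨k0, hk0⟩ := hc 1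
  have h1 := w.map_le_sub (hk0 (k0 + 1) (by omega)) (hk0 k0 le_rfl)
  rw [sub_sub_sub_cancel_right] at h1
  obtain ⟨f, hf⟩ : ∃ f, φ (k0 + 1) = f + φ k0 ∧ 1 ≤ f := ⟨φ (k0 + 1) - φ k0, by have := hφ (show k0 < k0 + 1 by omega); omega⟩
  rw [hf.1, pow_add, pow_mul] at h1
  have h2 := pow_inj_iter w hpr hpw (ge_pow0 w hx _) hx _ h1
  have h3 : ∀ k, ((1 : ℤ) : WithTop ℤ) ≤ w (x ^ p ^ (f * k) - x) := by
    intro k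
    induction k with
    | zero => simp
    | succ k ih =>
      have h4 := pow_close_iter w hpr hpw (ge_pow0 w hx _) hx ih f
      rw [← pow_mul, ← pow_add, ← Nat.mul_succ] at h4
      have := w.map_le_add (ge_mono h4 (show (1 : ℤ) ≤ f + 1 by omega)) h2
      simpa using this
  obtain ⟨c, φ, hφ, hc⟩ := htop (fun k => x ^ p ^ (f * k)) (fun k => ge_pow0 w hx _)
  have hfix : ∀ g : L ≃ₐ[K] L, g c = c := by
    intro g
    have : ∀ m : ℕ, ((m : ℤ) : WithTop ℤ) ≤ w (g c - c) := by
      intro m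
      obtain ⟨k0, hk0⟩ := hc m
      set k := max k0 m
      have h5 := hk0 k (le_max_left _ _)
      have h6 : ((m : ℤ) : WithTop ℤ) ≤ w (g (x ^ p ^ (f * φ k)) - x ^ p ^ (f * φ k)) := by
        rw [map_pow]
        have hgx : ((0 : ℤ) : WithTop ℤ) ≤ w (g x) := by rw [hinv]; exact hx
        refine ge_mono (pow_close_iter w hpr hpw hgx hx (htriv g x hx) _) ?_
        have h7 := hφ.id_le k
        simp only [id] at h7
        have h8 : m ≤ k := le_max_right _ _
        have h9 : φ k ≤ f * φ k := Nat.le_mul_of_pos_left _ hf.2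
        have : m ≤ f * φ k := by omega
        push_cast at *
        have : (m : ℤ) ≤ (f * φ k : ℕ) := by exact_mod_cast this
        push_cast at this
        omega
      have h7 : ((m : ℤ) : WithTop ℤ) ≤ w (g (x ^ p ^ (f * φ k) - c)) := by rw [hinv]; exact h5
      have h8 := w.map_le_add (w.map_le_sub h6 h7) h5
      rw [map_sub] at h8
      convert h8 using 2
      ring
    by_contra hne
    obtain ⟨m, hm⟩ := exists_int w (sub_ne_zero.2 hne)
    have := this (m.natAbs + 1)
    rw [hm] at this
    norm_cast at this
    push_cast at this
    have := le_abs_self m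
    omega
  obtain ⟨c', hc'⟩ := (IsGalois.mem_range_algebraMap_iff_fixed c).2 hfix
  refine ⟨c', ?_⟩
  rw [hc']
  obtain ⟨k0, hk0⟩ := hc 1
  have := w.map_le_sub (hk0 k0 le_rfl) (h3 (φ k0))
  rwa [sub_sub_sub_cancel_left] at this

theorem mkSetup {Pi : L} (hp : Odd p) (hpw : ((1 : ℤ) : WithTop ℤ) ≤ w (p : L)) 
    (hinv : ∀ (g : L ≃ₐ[K] L) x, w (g x) = w x) (hPi : w Pi = ((1 : ℤ) : WithTop ℤ))
    (htriv : ∀ (g : L ≃ₐ[K] L) x, ((0 : ℤ) : WithTop ℤ) ≤ w x → ((1 : ℤ) : WithTop ℤ) ≤ w (g x - x))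
    {π : K} {e : ℤ} (he : 1 ≤ e) (hπ : w (algebraMap K L π) = e)
    (hK : ∀ c : K, c ≠ 0 → ∃ m : ℤ, w (algebraMap K L c) = ((e * m : ℤ) : WithTop ℤ)) :
    Setup K L p w Pi ∧ e = Module.finrank K L := by
  have hres := res_aux w hp hpw hinv htriv
  have hPi0 : Pi ≠ 0 := ne_zero_of_eq w hPi
  have hπ0 : π ≠ 0 := by rintro rfl; simp at hπ
  have hπz : ∀ q : ℤ, w (algebraMap K L (π ^ q)) = ((q * e : ℤ) : WithTop ℤ) := by
    intro q
    obtain ⟨k, rfl | rfl⟩ := Int.eq_nat_or_neg q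
    · rw [zpow_natCast, map_pow, eq_pow w hπ]
    · rw [zpow_neg, zpow_natCast, map_inv₀, map_pow, ← one_div, 
        eq_div w (show w 1 = ((0 : ℤ) : WithTop ℤ) by simp) (eq_pow w hπ k)]
      congr 1; ring
  let W : Submodule K L := Submodule.span K (Set.range (fun j : Fin e.toNat => Pi ^ (j : ℕ)))
  have hstep : ∀ x : L, ∀ m : ℤ, (m : WithTop ℤ) ≤ w x → ∃ y ∈ W, ((m + 1 : ℤ) : WithTop ℤ) ≤ w (x - y) := by
    intro x m hm
    have hj0 := Int.emod_nonneg m (show e ≠ 0 by omega)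
    have hj1 := Int.emod_lt_of_pos m (show 0 < e by omega)
    obtain ⟨j, hj⟩ : ∃ j : ℕ, (j : ℤ) = m % e := ⟨(m % e).toNat, by omega⟩
    have ht := eq_mul w (hπz (m / e)) (eq_pow w hPi j)
    rw [show m / e * e + j * 1 = m by rw [hj, mul_one]; exact Int.ediv_mul_add_emod m e] at ht
    set t := algebraMap K L (π ^ (m / e)) * Pi ^ j with htdef
    have ht0 := ne_zero_of_eq w ht
    obtain ⟨c, hc⟩ := hres (x / t) (by simpa using ge_div w hm ht)
    refine ⟨(c * π ^ (m / e)) • Pi ^ j, Submodule.smul_mem _ _ (Submodule.subset_span ⟨⟨j, by omega⟩, rfl⟩), ?_⟩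
    have := ge_mul w (show ((m : ℤ) : WithTop ℤ) ≤ w t from ht.ge) hc
    convert this using 2
    rw [Algebra.smul_def, map_mul, mul_sub, mul_div_cancel₀ _ ht0, htdef]
    ring
  have happ : ∀ x : L, ∀ m0 : ℤ, (m0 : WithTop ℤ) ≤ w x → ∀ k : ℕ, ∃ y ∈ W, ((m0 + k : ℤ) : WithTop ℤ) ≤ w (x - y) := by
    intro x m0 hm0 k
    induction k with
    | zero => exact ⟨0, W.zero_mem, by simpa using hm0⟩
    | succ k ih =>
      obtain ⟨y, hy, h1⟩ := ih
      obtain ⟨z, hz, h2⟩ := hstep _ _ h1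
      refine ⟨y + z, W.add_mem hy hz, ?_⟩
      rw [← sub_sub]
      convert h2 using 2
      push_cast; ring
  have hW : W = ⊤ := by
    rw [eq_top_iff]
    intro x _
    by_cases hx : x = 0
    · rw [hx]; exact W.zero_mem
    obtain ⟨m0, hm0⟩ := exists_int w hx
    apply (topoK (K := K) w hp hpw).2 W x
    intro m
    obtain ⟨y, hy, h⟩ := happ x m0 hm0.ge (m - m0).toNat
    exact ⟨y, hy, ge_mono h (by omega)⟩
  have hle : Module.finrank K L ≤ e.toNat := by
    have := finrank_range_le_card (R := K) (fun j : Fin e.toNat => Pi ^ (j : ℕ))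
    rw [Set.finrank] at this
    change Module.finrank K W ≤ _ at this
    rw [hW, finrank_top] at this
    simpa using this
  have hN : w (algebraMap K L (Algebra.norm K Pi)) = ((Module.finrank K L * 1 : ℤ) : WithTop ℤ) := by
    rw [Algebra.norm_eq_prod_automorphisms, eq_prod w _ _ (fun _ => 1) (fun g _ => by rw [hinv, hPi])]
    simp [← Nat.card_eq_fintype_card, IsGalois.card_aut_eq_finrank]
  obtain ⟨m, hm⟩ := hK (Algebra.norm K Pi) (by rw [Algebra.norm_ne_zero_iff]; exact hPi0)
  rw [hN] at hm
  have hm' : (Module.finrank K L : ℤ) * 1 = e * m := by exact_mod_cast hm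
  have hpos : 0 < Module.finrank K L := Module.finrank_pos
  have hef : e = Module.finrank K L := by
    have h1 := Int.le_of_dvd (by omega) (Dvd.intro _ (hm'.symm.trans (mul_one _)))
    omega
  exact ⟨⟨Fact.out, hinv, hPi, hres, fun c hc => by rw [← hef]; exact hK c hc, hpw⟩, hef⟩
end mk
end HA

end

section
namespace HA
section Q
variable {L : Type} [Field L] (V : AddValuation L (WithTop ℚ))

theorem q_exists {x : L} (hx : x ≠ 0) : ∃ a : ℚ, V x = (a : WithTop ℚ) := by
  have := (V.ne_top_iff (x := x)).2 hx
  lift V x to ℚ using this with m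
  exact ⟨m, rfl⟩

theorem q_mul {x y : L} {a b : ℚ} (hx : V x = a) (hy : V y = b) : V (x * y) = ((a + b : ℚ) : WithTop ℚ) := by
  rw [V.map_mul, hx, hy]; push_cast; rfl

theorem q_ne {x : L} {a : ℚ} (hx : V x = a) : x ≠ 0 := by
  rintro rfl; simp at hx

theorem q_pow {x : L} {a : ℚ} (hx : V x = a) (k : ℕ) : V (x ^ k) = ((k * a : ℚ) : WithTop ℚ) := by
  induction k with
  | zero => simp
  | succ k ih => rw [pow_succ, q_mul V ih hx]; congr 1; push_cast; ring

theorem q_inv {x : L} {a : ℚ} (hx : V x = a) : V (x⁻¹) = ((-a : ℚ) : WithTop ℚ) := by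
  obtain ⟨b, hb⟩ := q_exists V (inv_ne_zero (q_ne V hx))
  have := q_mul V hx hb
  rw [mul_inv_cancel₀ (q_ne V hx), V.map_one] at this
  rw [hb]
  have h : (0 : ℚ) = a + b := by exact_mod_cast this
  congr 1; linarith

theorem q_zpow {x : L} {a : ℚ} (hx : V x = a) (k : ℤ) : V (x ^ k) = ((k * a : ℚ) : WithTop ℚ) := by
  obtain ⟨k, rfl | rfl⟩ := Int.eq_nat_or_neg k
  · rw [zpow_natCast, q_pow V hx]; norm_cast
  · rw [zpow_neg, zpow_natCast, q_inv V (q_pow V hx k)]; congr 1; push_cast; ring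

theorem q_prod {ι : Type*} (s : Finset ι) (f : ι → L) {a : ℚ} (h : ∀ i ∈ s, V (f i) = a) : 
    V (∏ i ∈ s, f i) = ((s.card * a : ℚ) : WithTop ℚ) := by
  classical
  induction s using Finset.induction_on with
  | empty => simp
  | insert i s hi ih =>
    rw [Finset.prod_insert hi, q_mul V (h i (by simp)) (ih fun j hj => h j (by simp [hj])), Finset.card_insert_of_notMem hi]
    congr 1; push_cast; ring

theorem exists_scaledQ {q : ℚ} (hq : 0 < q) (h : ∀ x : L, x ≠ 0 → ∃ m : ℤ, V x = ((m * q : ℚ) : WithTop ℚ)) :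
    ∃ w : AddValuation L (WithTop ℤ), ∀ (x : L) (m : ℤ),
      (w x = (m : WithTop ℤ) ↔ V x = ((m * q : ℚ) : WithTop ℚ)) ∧
      ((m : WithTop ℤ) ≤ w x ↔ ((m * q : ℚ) : WithTop ℚ) ≤ V x) := by
  classical
  choose! f0 hf0 using h
  let f : L → WithTop ℤ := fun x => if x = 0 then ⊤ else (f0 x : WithTop ℤ)
  have key : ∀ (x : L) (m : ℤ),
      (f x = (m : WithTop ℤ) ↔ V x = ((m * q : ℚ) : WithTop ℚ)) ∧
      ((m : WithTop ℤ) ≤ f x ↔ ((m * q : ℚ) : WithTop ℚ) ≤ V x) := by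
    intro x m
    by_cases hx : x = 0
    · simp [f, hx, -WithTop.coe_mul]
    · simp only [f, if_neg hx, hf0 x hx]
      constructor
      · rw [WithTop.coe_inj, WithTop.coe_inj, mul_left_inj' hq.ne']; norm_cast
      · rw [WithTop.coe_le_coe, WithTop.coe_le_coe, mul_le_mul_iff_left₀ hq]; norm_cast
  have fex : ∀ x, x ≠ 0 → ∃ m : ℤ, f x = m := fun x hx => ⟨f0 x, by simp [f, hx]⟩
  refine ⟨AddValuation.of f (by simp [f]) ?_ ?_ ?_, key⟩
  · exact ((key 1 0).1).2 (by simp)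
  · intro x y
    by_cases hxy : x + y = 0
    · simp [f, hxy]
    obtain ⟨k, hk⟩ := fex _ hxy
    rw [hk]
    by_contra hcon
    rw [not_le, lt_min_iff, lt_iff_add_one_le, lt_iff_add_one_le, (key _ _).2, (key _ _).2] at hcon
    have h1 := V.map_le_add hcon.1 hcon.2
    rw [((key _ _).1).1 hk] at h1
    rw [WithTop.coe_le_coe] at h1
    push_cast at h1
    linarith
  · intro x y
    by_cases hx : x = 0
    · simp [f, hx, -WithTop.coe_mul]
    by_cases hy : y = 0
    · simp [f, hy]
    obtain ⟨k, hk⟩ := fex _ hx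
    obtain ⟨l, hl⟩ := fex _ hy
    rw [hk, hl, ← WithTop.coe_add, (key _ _).1, q_mul V (((key _ _).1).1 hk) (((key _ _).1).1 hl)]
    congr 1; push_cast; ring

variable {K : Type} [Field K] [Algebra K L] [FiniteDimensional K L] [IsGalois K L] {p : ℕ}

theorem q_invar (hp : V (p : L) = ((1 : ℚ) : WithTop ℚ)) (h : ∀ (g : L ≃ₐ[K] L) x, 0 ≤ V x → 0 < V (g x - x)) 
    (g : L ≃ₐ[K] L) (x : L) : V (g x) = V x := by
  have h1 : ∀ x, V x = ((0 : ℚ) : WithTop ℚ) → V (g x) = ((0 : ℚ) : WithTop ℚ) := by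
    intro x hx
    have h2 := h g x (by rw [hx]; simp)
    have := V.map_add_eq_of_lt_left (x := x) (y := g x - x) (by rw [hx]; exact_mod_cast h2)
    rwa [add_sub_cancel, hx] at this
  by_cases hx : x = 0
  · simp [hx]
  obtain ⟨a, ha⟩ := q_exists V hx
  obtain ⟨b, hb⟩ := q_exists V (show g x ≠ 0 by simpa using hx)
  have h2 := h1 (x ^ a.den * (p : L) ^ (-a.num)) (by
    rw [q_mul V (q_pow V ha _) (q_zpow V hp _)]
    congr 1
    have := Rat.mul_den_eq_num a
    push_cast; linarith)
  rw [map_mul, map_pow, map_zpow₀, map_natCast, q_mul V (q_pow V hb _) (q_zpow V hp _)] at h2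
  have h3 := WithTop.coe_injective h2
  rw [ha, hb]
  congr 1
  have h4 := Rat.mul_den_eq_num a
  have h5 : (a.den : ℚ) ≠ 0 := by exact_mod_cast a.den_ne_zero
  push_cast at h3
  have : (a.den : ℚ) * b = a.den * a := by linarith
  exact mul_left_cancel₀ h5 this

theorem q_disc (hinv : ∀ (g : L ≃ₐ[K] L) x, V (g x) = V x) {π : K} {q0 : ℚ} (hq0 : 0 < q0)
    (hπ : V (algebraMap K L π) = q0) (hmin : ∀ y : K, 0 < V (algebraMap K L y) → (q0 : WithTop ℚ) ≤ V (algebraMap K L y)) :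
    ∃ (Pi : L) (q : ℚ) (e : ℤ), 0 < q ∧ V Pi = (q : WithTop ℚ) ∧ (∀ x : L, x ≠ 0 → ∃ m : ℤ, V x = ((m * q : ℚ) : WithTop ℚ)) ∧
      1 ≤ e ∧ q0 = e * q ∧ ∀ c : K, c ≠ 0 → ∃ m : ℤ, V (algebraMap K L c) = ((m * q0 : ℚ) : WithTop ℚ) := by
  classical
  have hKv : ∀ c : K, c ≠ 0 → ∃ m : ℤ, V (algebraMap K L c) = ((m * q0 : ℚ) : WithTop ℚ) := by
    intro c hc
    obtain ⟨a, ha⟩ := q_exists V (show algebraMap K L c ≠ 0 by simpa using hc)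
    refine ⟨⌊a / q0⌋, ?_⟩
    rw [ha]; congr 1
    have h1 : V (algebraMap K L (c * π ^ (-⌊a / q0⌋))) = ((a - ⌊a / q0⌋ * q0 : ℚ) : WithTop ℚ) := by
      rw [map_mul, map_zpow₀, q_mul V ha (q_zpow V hπ _)]; congr 1; push_cast; ring
    have h2 := Int.floor_le (a / q0)
    have h3 := Int.lt_floor_add_one (a / q0)
    rw [le_div_iff₀ hq0] at h2
    rw [div_lt_iff₀ hq0] at h3
    by_contra hne
    have h4 : 0 < a - ⌊a / q0⌋ * q0 := by
      rcases h2.lt_or_eq with h | h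
      · linarith
      · exact absurd h.symm hne
    have h5 := hmin (c * π ^ (-⌊a / q0⌋)) (by rw [h1]; exact_mod_cast h4)
    rw [h1, WithTop.coe_le_coe] at h5
    linarith
  set N := Module.finrank K L with hN
  have hN0 : (0 : ℚ) < N := by exact_mod_cast (Module.finrank_pos : 0 < Module.finrank K L)
  have hLv : ∀ x : L, x ≠ 0 → ∃ m : ℤ, V x = ((m * (q0 / N) : ℚ) : WithTop ℚ) := by
    intro x hx
    obtain ⟨a, ha⟩ := q_exists V hx
    obtain ⟨m, hm⟩ := hKv (Algebra.norm K x) (by rw [Algebra.norm_ne_zero_iff]; exact hx)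
    rw [Algebra.norm_eq_prod_automorphisms, q_prod V _ _ (fun g _ => by rw [hinv, ha])] at hm
    have h1 := WithTop.coe_injective hm
    rw [Finset.card_univ, ← Nat.card_eq_fintype_card, IsGalois.card_aut_eq_finrank] at h1
    refine ⟨m, ?_⟩
    rw [ha]; congr 1
    field_simp
    rw [hN]; linarith
  have hex : ∃ k : ℕ, 0 < k ∧ ∃ x : L, V x = ((k * (q0 / N) : ℚ) : WithTop ℚ) := by
    refine ⟨N, by exact_mod_cast hN0, algebraMap K L π, ?_⟩
    rw [hπ]; congr 1; field_simp
  set k0 := Nat.find hex with hk0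
  obtain ⟨hkpos, Pi, hPi⟩ := Nat.find_spec hex
  rw [← hk0] at hPi hkpos
  have hkq : (0 : ℚ) < k0 := by exact_mod_cast hkpos
  have hLv2 : ∀ x : L, x ≠ 0 → ∃ m : ℤ, V x = ((m * (k0 * (q0 / N)) : ℚ) : WithTop ℚ) := by
    intro x hx
    obtain ⟨m, hm⟩ := hLv x hx
    refine ⟨m / k0, ?_⟩
    have h1 := q_mul V hm (q_zpow V hPi (-(m / k0)))
    have hr0 := Int.emod_nonneg m (show (k0 : ℤ) ≠ 0 by omega)
    have hr1 := Int.emod_lt_of_pos m (show (0 : ℤ) < k0 by omega)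
    have hdm := Int.ediv_mul_add_emod m k0
    have hdmq : (m : ℚ) = ((m / k0 : ℤ) : ℚ) * k0 + ((m % k0 : ℤ) : ℚ) := by exact_mod_cast hdm.symm
    by_cases hz : m % k0 = 0
    · rw [hm]; congr 1
      rw [hz] at hdmq
      rw [hdmq]; push_cast; ring
    · exfalso
      refine Nat.find_min hex (m := (m % k0).toNat) (by omega) ⟨by omega, _, h1.trans ?_⟩
      congr 1
      have : (((m % k0).toNat : ℕ) : ℚ) = ((m % k0 : ℤ) : ℚ) := by
        exact_mod_cast Int.toNat_of_nonneg hr0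
      rw [this]
      rw [hdmq]; push_cast; ring
  obtain ⟨e, he⟩ := hLv2 _ (q_ne V hπ)
  rw [hπ] at he
  have he' := WithTop.coe_injective he
  have hqq : 0 < (k0 * (q0 / N) : ℚ) := by positivity
  refine ⟨Pi, k0 * (q0 / N), e, hqq, hPi, hLv2, ?_, he', hKv⟩
  have : (0 : ℚ) < e := by
    by_contra hcon
    rw [not_lt] at hcon
    nlinarith [mul_nonneg (neg_nonneg.2 hcon) hqq.le]
  have : (0 : ℤ) < e := by exact_mod_cast this
  omega
end Q
end HA

end

section
namespace HA
section fr
variable {p : ℕ} {A : Type} [Field A] (vd : PadicValData A p) {L : Type} [Field L] (emb : L →+* A)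

theorem vd_one : vd.v 1 = 0 := by
  have h := vd.v_mul 1 1
  have h2 : vd.v 1 ≠ ⊤ := by rw [Ne, vd.v_top_iff]; exact one_ne_zero
  rw [mul_one] at h
  lift vd.v 1 to ℚ using h2 with a
  have : a = a + a := by exact_mod_cast h
  have : a = 0 := by linarith
  rw [this]; rfl

noncomputable def vL : AddValuation L (WithTop ℚ) :=
  AddValuation.of (fun x => vd.v (emb x)) (by simp [v_zero]) (by simp [vd_one])
    (fun x y => by simpa using vd.v_min_le_add (emb x) (emb y)) (fun x y => by simpa using vd.v_mul (emb x) (emb y))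

theorem vL_apply (x : L) : vL vd emb x = vd.v (emb x) := rfl

/-- normalised link between `w` and `vd`. -/
def NLink (w : AddValuation L (WithTop ℤ)) (q : ℚ) : Prop := ∀ (x : L) (m : ℤ),
  (m : WithTop ℤ) ≤ w x ↔ ((m * q : ℚ) : WithTop ℚ) ≤ vd.v (emb x)

theorem NLink.nonneg {vd : PadicValData A p} {emb : L →+* A} {w : AddValuation L (WithTop ℤ)} {q : ℚ} (h : NLink vd emb w q) (x : L) :
    0 ≤ vd.v (emb x) ↔ ((0 : ℤ) : WithTop ℤ) ≤ w x := by
  rw [h]; simp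

theorem NLink.pos {vd : PadicValData A p} {emb : L →+* A} {w : AddValuation L (WithTop ℤ)} {q : ℚ} (hq : 0 < q) (h : NLink vd emb w q) (x : L) :
    0 < vd.v (emb x) ↔ ((1 : ℤ) : WithTop ℤ) ≤ w x := by
  constructor
  · intro hx
    have h0 := (h.nonneg x).1 hx.le
    by_contra hcon
    have hx0 : x ≠ 0 := by rintro rfl; simp at hcon
    obtain ⟨m, hm⟩ := exists_int w hx0
    have : m = 0 := by
      rw [hm] at h0 hcon; norm_cast at h0 hcon; omega
    subst this
    have hinv : w x⁻¹ = ((0 : ℤ) : WithTop ℤ) := by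
      rw [← one_div, eq_div w (show w 1 = ((0 : ℤ) : WithTop ℤ) by simp) hm]; simp
    have h2 := (h.nonneg x⁻¹).2 hinv.ge
    have h3 := vd.v_mul (emb x) (emb x⁻¹)
    rw [← map_mul, mul_inv_cancel₀ hx0, map_one, vd_one] at h3
    have h4 := add_pos_of_pos_of_nonneg hx h2
    rw [← h3] at h4
    exact lt_irrefl _ h4
  · intro hx
    refine lt_of_lt_of_le ?_ ((h x 1).1 hx)
    simpa using hq

theorem NLink.inMax {vd : PadicValData A p} {emb : L →+* A} {w : AddValuation L (WithTop ℤ)} {q : ℚ} (hq : 0 < q) (h : NLink vd emb w q) 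
    {Pi : L} (hPi : w Pi = ((1 : ℤ) : WithTop ℤ)) (j : ℕ) (y : L) : InMaxIdealPow vd emb j (emb y) ↔ ((j : ℤ) : WithTop ℤ) ≤ w y := by
  constructor
  · rintro ⟨u, s, hu, hs, hy⟩
    have : y = u * ∏ k, s k := by
      apply emb.injective; rw [hy]; simp
    rw [this]
    have h1 := (h.nonneg u).1 hu
    have h2 := ge_prod w Finset.univ s (fun _ => 1) (fun k _ => (h.pos hq _).1 (hs k))
    have := ge_mul w h1 h2
    simpa using this
  · intro hy
    have h0 := ne_zero_of_eq w hPi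
    have h1 := eq_pow w hPi j
    refine ⟨y / Pi ^ j, fun _ => Pi, ?_, fun _ => ?_, ?_⟩
    · rw [h.nonneg]
      have := ge_div w hy h1
      simpa using this
    · rw [h.pos hq, hPi]
    · have : y = y / Pi ^ j * Pi ^ j := by field_simp
      rw [Finset.prod_const, ← map_pow, ← map_mul]
      simp only [Finset.card_univ, Fintype.card_fin, ← this]

variable {K : Type} [Field K] [Algebra K L] [FiniteDimensional K L] [IsGalois K L] 

theorem NLink.hlow {vd : PadicValData A p} {emb : L →+* A} {w : AddValuation L (WithTop ℤ)} {q : ℚ} (hq : 0 < q) (h : NLink vd emb w q) 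
    {Pi : L} (S : Setup K L p w Pi) (m : ℕ) : lowerRamSet vd K L emb (m : ℤ) = (S.ram ((m : ℤ) + 1) : Set (L ≃ₐ[K] L)) := by
  ext g
  rw [SetLike.mem_coe, Setup.mem_ram, lowerRamSet, Set.mem_ofPred_eq]
  have e : ((m : ℤ) + 1).toNat = m + 1 := by omega
  rw [e]
  have e2 : ((m : ℤ) + 1) = ((m + 1 : ℕ) : ℤ) := by push_cast; rfl
  rw [e2]
  constructor
  · intro hg
    have := hg Pi (by rw [h.nonneg, S.unif]; norm_cast)
    rwa [← map_sub, h.inMax hq S.unif] at this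
  · intro hg x hx
    rw [← map_sub, h.inMax hq S.unif]
    exact S.ge_sub0 g hg ((h.nonneg x).1 hx)

theorem mkAll [Fact p.Prime] [Algebra ℚ_[p] K] [FiniteDimensional ℚ_[p] K] (hp : Odd p)
    {π : K} (hπ : IsUniformizer vd (emb.comp (algebraMap K L)) π)
    (h0 : lowerRamSet vd K L emb 0 = Set.univ) :
    ∃ (w : AddValuation L (WithTop ℤ)) (Pi : L) (q : ℚ), 0 < q ∧ Setup K L p w Pi ∧ NLink vd emb w q ∧
      w (algebraMap K L π) = ((Module.finrank K L : ℤ) : WithTop ℤ) := by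
  set V := vL vd emb with hV
  have htriv : ∀ (g : L ≃ₐ[K] L) x, 0 ≤ V x → 0 < V (g x - x) := by
    intro g x hx
    have hg : g ∈ lowerRamSet vd K L emb 0 := by rw [h0]; trivial
    obtain ⟨u, s, hu, hs, hy⟩ := hg x hx
    rw [hV, vL_apply, map_sub, hy, vd.v_mul]
    have : ∏ k : Fin (0 + 1 : ℤ).toNat, emb (s k) = emb (s ⟨0, by simp⟩) := Fin.prod_univ_one _
    rw [this]
    rw [add_comm]; exact add_pos_of_pos_of_nonneg (hs _) hu
  have hVp : V (p : L) = ((1 : ℚ) : WithTop ℚ) := by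
    rw [hV, vL_apply, map_natCast, vd.v_coe_p]; rfl
  have hinv := q_invar V hVp htriv
  obtain ⟨hπ0, hπpos, hπmin⟩ := hπ
  obtain ⟨q0, hq0⟩ := q_exists V (show algebraMap K L π ≠ 0 by simpa using hπ0)
  have hq0pos : 0 < q0 := by
    change 0 < V (algebraMap K L π) at hπpos
    rw [hq0] at hπpos
    exact_mod_cast hπpos
  obtain ⟨Pi, q, e, hq, hPi, hLv, he, hqe, hKv⟩ := q_disc V hinv hq0pos hq0 (fun y hy => by
    rw [← hq0]; exact hπmin y hy)
  obtain ⟨w, hw⟩ := exists_scaledQ V hq hLv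
  have hN : NLink vd emb w q := fun x m => (hw x m).2
  have hwinv : ∀ (g : L ≃ₐ[K] L) x, w (g x) = w x := by
    intro g x
    by_cases hx : x = 0
    · simp [hx]
    obtain ⟨m, hm⟩ := exists_int w hx
    rw [hm, (hw _ _).1, hinv, ← (hw _ _).1, hm]
  have hwe : w (algebraMap K L π) = e := by
    rw [(hw _ _).1, hq0, hqe]
  obtain ⟨S, hef⟩ := mkSetup (K := K) w (Pi := Pi) hp ((hN.pos hq _).1 (by
      change 0 < V (p : L); rw [hVp]; norm_num)) hwinv
    (by rw [(hw _ _).1, hPi]; simp) (fun g x hx => (hN.pos hq _).1 (htriv g x ((hN.nonneg x).2 hx))) he hwe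
    (fun c hc => by
      obtain ⟨m, hm⟩ := hKv c hc
      refine ⟨m, ?_⟩
      rw [(hw _ _).1, hm, hqe]
      congr 1; push_cast; ring)
  exact ⟨w, Pi, q, hq, S, hN, by rw [hwe, hef]⟩
end fr
end HA

end

section
namespace HA
namespace Setup
section tr
variable {K L : Type*} [Field K] [Field L] [Algebra K L] {p : ℕ}
    {w : AddValuation L (WithTop ℤ)} {Pi : L} [FiniteDimensional K L] [IsGalois K L]

open Classical in
/-- the different element -/
noncomputable def diff (K : Type*) {L : Type*} [Field K] [Field L] [Algebra K L] [FiniteDimensional K L] (Pi : L) : L :=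
  ∏ s ∈ (Finset.univ : Finset (L ≃ₐ[K] L)).erase 1, (Pi - s Pi)

theorem euler (S : Setup K L p w Pi) (P : Polynomial K) (hP : P.degree < Module.finrank K L) :
    Algebra.trace K L (Polynomial.aeval Pi P / diff K Pi) = P.coeff (Module.finrank K L - 1) := by
  classical
  apply (algebraMap K L).injective
  rw [trace_eq_sum_automorphisms]
  have hcard : (Finset.univ : Finset (L ≃ₐ[K] L)).card = Module.finrank K L := by
    rw [Finset.card_univ, ← Nat.card_eq_fintype_card, IsGalois.card_aut_eq_finrank]
  have hinj : Set.InjOn (fun s : L ≃ₐ[K] L => s Pi) (Finset.univ : Finset (L ≃ₐ[K] L)) := by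
    intro a _ b _ h; exact S.aut_ext h
  have := Lagrange.coeff_eq_sum (F := L) (s := (Finset.univ : Finset (L ≃ₐ[K] L))) (v := fun s => s Pi) hinj
    (P := P.map (algebraMap K L)) (by rw [Polynomial.degree_map, hcard]; exact hP)
  rw [hcard, Polynomial.coeff_map] at this
  rw [this]
  apply Finset.sum_congr rfl
  intro s _
  rw [map_div₀]
  congr 1
  · rw [Polynomial.eval_map_algebraMap]
    exact (Polynomial.aeval_algHom_apply s.toAlgHom Pi P).symm
  · rw [diff, map_prod]
    refine Finset.prod_bij (fun t _ => s * t) ?_ ?_ ?_ ?_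
    · intro t ht
      simpa using ht
    · intro a _ b _ h; exact mul_left_cancel h
    · intro b hb
      refine ⟨s⁻¹ * b, ?_, by simp⟩
      simp only [Finset.mem_erase, Finset.mem_univ, and_true] at hb ⊢
      intro h; exact hb (inv_mul_eq_one.1 h).symm
    · intro t _
      simp

theorem trace_image (S : Setup K L p w Pi) (hd : Module.finrank K L = p) {M : ℤ}
    (hM : ∀ s : L ≃ₐ[K] L, s ≠ 1 → w (s Pi - Pi) = M) {π : K}
    (hπ : w (algebraMap K L π) = (((p - 1 : ℕ) * M : ℤ) : WithTop ℤ)) {k : ℕ} (hk : k ≤ p - 1) :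
    {y : K | ∃ x : L, ((k : ℤ) : WithTop ℤ) ≤ w x ∧ y = Algebra.trace K L x} = 
      {y : K | ∃ u : K, ((0 : ℤ) : WithTop ℤ) ≤ w (algebraMap K L u) ∧ y = π * u} := by
  classical
  have hppos := S.pp.pos
  have hD : w (diff K Pi) = (((p - 1 : ℕ) * M : ℤ) : WithTop ℤ) := by
    rw [diff, eq_prod w _ _ (fun _ => M)]
    · rw [Finset.sum_const, Finset.card_erase_of_mem (Finset.mem_univ _), Finset.card_univ, ← Nat.card_eq_fintype_card, 
        IsGalois.card_aut_eq_finrank, hd]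
      simp
    · intro s hs
      rw [← hM s (Finset.ne_of_mem_erase hs), w.map_sub_swap]
  have hD0 := ne_zero_of_eq w hD
  have hπ0 := ne_zero_of_eq w hπ
  ext y
  simp only [Set.mem_ofPred_eq]
  constructor
  · rintro ⟨x, hx, rfl⟩
    have h1 : ((0 : ℤ) : WithTop ℤ) ≤ w (diff K Pi * x / algebraMap K L π) := by
      have := ge_div w (ge_mul w hD.ge hx) hπ
      exact ge_mono this (by omega)
    obtain ⟨c, hc, hxc⟩ := S.expand h1
    rw [hd] at hc hxc
    refine ⟨c (p - 1), hc _ (by omega), ?_⟩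
    let P : Polynomial K := ∑ j ∈ Finset.range p, Polynomial.C (c j) * Polynomial.X ^ j
    have hPd : P.degree < (p : ℕ) := by
      rw [Polynomial.degree_lt_iff_coeff_zero]
      intro m hm
      simp only [P, Polynomial.finsetSum_coeff, Polynomial.coeff_C_mul_X_pow]
      apply Finset.sum_eq_zero
      intro j hj
      rw [if_neg]
      have := Finset.mem_range.1 hj
      omega
    have he := S.euler P (by rw [hd]; exact hPd)
    have hcoef : P.coeff (p - 1) = c (p - 1) := by
      simp only [P, Polynomial.finsetSum_coeff, Polynomial.coeff_C_mul_X_pow]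
      rw [Finset.sum_ite_eq, if_pos (by simp; omega)]
    have hPe : Polynomial.aeval Pi P = diff K Pi * x / algebraMap K L π := by
      rw [hxc]; simp [P]
    rw [hd, hcoef, hPe] at he
    rw [← he]
    have : x = π • (diff K Pi * x / algebraMap K L π / diff K Pi) := by
      rw [Algebra.smul_def]; field_simp
    nth_rewrite 1 [this]
    rw [map_smul, smul_eq_mul]
  · rintro ⟨u, hu, rfl⟩
    have hP := eq_pow w S.unif (p - 1)
    refine ⟨algebraMap K L (π * u) * (Pi ^ (p - 1) / diff K Pi), ?_, ?_⟩
    · rw [(algebraMap K L).map_mul, mul_assoc]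
      have := ge_mul w hπ.ge (ge_mul w hu (eq_div w hP hD).ge)
      exact ge_mono this (by omega)
    · have he := S.euler (Polynomial.X ^ (p - 1)) (by 
        rw [hd, Polynomial.degree_X_pow]; exact_mod_cast (by omega))
      rw [map_pow, Polynomial.aeval_X, hd, Polynomial.coeff_X_pow_self] at he
      rw [← Algebra.smul_def, map_smul, he, smul_eq_mul, mul_one]
end tr
end Setup
end HA

end

section
namespace HA
theorem final_abs {K F E L : Type} [Field K] [Field F] [Field E] [Field L] [Algebra K F] [Algebra F E] [Algebra E L] 
    [Algebra F L] [Algebra K L] [IsScalarTower F E L] [IsScalarTower K F L] [FiniteDimensional K L] [IsGalois K L]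
    [IsGalois F E] {p : ℕ} {w : AddValuation L (WithTop ℤ)} {Pi : L} (S : Setup K L p w Pi) 
    (hd : Module.finrank F E = p) {M : ℤ}
    (hM : ∀ g : L ≃ₐ[F] L, (¬ ∀ x : E, g (algebraMap E L x) = algebraMap E L x) → w (g Pi - Pi) = M)
    {π : F} (hπ : w (algebraMap F L π) = ((Module.finrank E L * ((p - 1 : ℕ) * M) : ℤ) : WithTop ℤ)) {k : ℕ} (hk : k ≤ p - 1) :
    ∃ (wE : AddValuation E (WithTop ℤ)) (PiE : E), wE PiE = ((1 : ℤ) : WithTop ℤ) ∧ 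
      (∀ (x : E) (m : ℤ), ((m : WithTop ℤ) ≤ wE x ↔ ((Module.finrank E L * m : ℤ) : WithTop ℤ) ≤ w (algebraMap E L x))) ∧
      {y : F | ∃ x : E, ((k : ℤ) : WithTop ℤ) ≤ wE x ∧ y = Algebra.trace F E x} = 
      {y : F | ∃ u : F, ((0 : ℤ) : WithTop ℤ) ≤ wE (algebraMap F E u) ∧ y = π * u} := by
  classical
  have : FiniteDimensional F L := FiniteDimensional.right K F L
  have : FiniteDimensional F E := FiniteDimensional.left F E L
  have : FiniteDimensional E L := FiniteDimensional.right F E L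
  have : IsGalois F L := IsGalois.tower_top_of_isGalois K F L
  have : IsGalois E L := IsGalois.tower_top_of_isGalois F E L
  have SF : Setup F L p w Pi := S.top
  obtain ⟨wE, PiE, SE, hl⟩ := SF.bot (E := E)
  refine ⟨wE, PiE, SE.unif, fun x m => (hl x m).2, ?_⟩
  apply SE.trace_image hd (M := M) _ _ hk
  · intro s hs
    rw [(hl _ _).1]
    have h := SF.herbrand SE hl (AlgEquiv.liftNormal s L) s (fun x => (AlgEquiv.liftNormal_commutes s L x).symm) (fun _ => M) (by
      intro t
      apply hM ((AlgEquiv.liftNormal s L) * t.restrictScalars F)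
      intro hcon
      apply hs
      ext x
      apply (algebraMap E L).injective
      have := hcon x
      rw [AlgEquiv.mul_apply, AlgEquiv.restrictScalars_apply, t.commutes, AlgEquiv.liftNormal_commutes] at this
      simpa using this)
    rw [h, Finset.sum_const, Finset.card_univ, ← Nat.card_eq_fintype_card, IsGalois.card_aut_eq_finrank]
    simp
  · rw [(hl _ _).1, ← IsScalarTower.algebraMap_apply, hπ]
end HA

end

section

/-- (Lemma 2.4 ii)). Let `L/K` satisfy condition (ram) with parameter `n`,
let `K_m` be the fixed field of `G^m`, and let `m_{i+1}` be the maximal ideal of the ring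
of integers of `K_{i+1}`. Then for every integer `k` with `0 ≤ k ≤ p−1` and every
`1 ≤ i ≤ n`, the trace satisfies `Tr_{K_{i+1}/K_i}(m_{i+1}^k) = π·O_{K_i}`. -/
theorem statement2 {p : ℕ} [Fact p.Prime] (hp : Odd p)
    {A : Type} [Field A] (vd : PadicValData A p)
    (K L : Type) [Field K] [Field L]
    [Algebra ℚ_[p] K] [FiniteDimensional ℚ_[p] K]
    [Algebra K L] [FiniteDimensional K L] [IsGalois K L]
    (emb : L →+* A)
    (hab : ∀ σ τ : L ≃ₐ[K] L, σ * τ = τ * σ)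
    (π : K) (hπ : IsUniformizer vd (emb.comp (algebraMap K L)) π)
    (n : ℕ) (hram : RamCond vd K L emb n)
    (i : ℕ) (hi1 : 1 ≤ i) (hi2 : i ≤ n)
    (Ki Ki1 : IntermediateField K L)
    (hKi : Ki = IntermediateField.fixedField
      (Subgroup.closure (upperRamSet vd K L emb (i : ℤ))))
    (hKi1 : Ki1 = IntermediateField.fixedField
      (Subgroup.closure (upperRamSet vd K L emb ((i : ℤ) + 1))))
    (hle : Ki ≤ Ki1)
    (k : ℕ) (hk : k ≤ p - 1) :
    letI : Algebra ↥Ki ↥Ki1 := ((IntermediateField.inclusion hle).toRingHom).toAlgebra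
    ({ y : ↥Ki | ∃ x : ↥Ki1,
        InMaxIdealPow vd (emb.comp (Ki1.val : ↥Ki1 →+* L)) k
          ((emb.comp (Ki1.val : ↥Ki1 →+* L)) x) ∧
        y = Algebra.trace ↥Ki ↥Ki1 x }
      = { y : ↥Ki | ∃ u : ↥Ki,
            0 ≤ vd.v ((emb.comp (Ki.val : ↥Ki →+* L)) u) ∧
            y = algebraMap K ↥Ki π * u }) := by
  have hpr : p.Prime := Fact.out
  obtain ⟨w, Pi, q, hq, S, hN, hπw⟩ := HA.mkAll vd emb hp hπ (HA.lower_zero_univ hram)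
  have hlow := hN.hlow hq S
  have hcG := HA.card_G hram
  have hc0 := HA.card_upper' hram hi1 (by omega)
  have hc1 := HA.card_upper' hram (j := i + 1) (by omega) (by omega)
  rw [Nat.cast_add, Nat.cast_one] at hc1
  obtain ⟨H, hH⟩ : ∃ H : Subgroup (L ≃ₐ[K] L), upperRamSet vd K L emb (i : ℤ) = H :=
    ⟨_, HA.upper_eq S hlow hab hram hi2⟩
  obtain ⟨H', hH'⟩ : ∃ H : Subgroup (L ≃ₐ[K] L), upperRamSet vd K L emb ((i : ℤ) + 1) = H := by
    rcases Nat.lt_or_ge i n with h | h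
    · have := HA.upper_eq S hlow hab hram (j := i + 1) h
      rw [Nat.cast_add, Nat.cast_one] at this
      exact ⟨_, this⟩
    · have : i = n := le_antisymm hi2 h
      subst this
      exact ⟨⊥, by rw [hram.2.2.2.2.2]; simp⟩
  have hval : ∀ s : L ≃ₐ[K] L, s ∈ H → s ∉ H' → w (s Pi - Pi) = ((p ^ i : ℤ) : WithTop ℤ) := by
    intro s h1 h2
    exact HA.val_eq S hlow hab hram hi2 (by rw [hH]; exact h1) (by rw [hH']; exact h2)
  rw [hH, Subgroup.closure_eq] at hKi
  rw [hH', Subgroup.closure_eq] at hKi1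
  rw [hH] at hc0
  rw [hH'] at hc1
  have hfixH : Ki.fixingSubgroup = H := by
    rw [hKi, IntermediateField.fixingSubgroup_fixedField]
  have hmem : ∀ y ∈ Ki1, ∀ s ∈ H', s y = y := by
    intro y hy s hs
    rw [hKi1] at hy
    exact hy ⟨s, hs⟩
  have hf0 : Module.finrank ↥Ki L = p ^ (n + 1 - i) := by
    rw [hKi, IntermediateField.finrank_fixedField_eq_card]; exact hc0
  have hf1 : Module.finrank ↥Ki1 L = p ^ (n - i) := by
    rw [hKi1, IntermediateField.finrank_fixedField_eq_card, show n - i = n + 1 - (i + 1) by omega]; exact hc1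
  letI : Algebra ↥Ki ↥Ki1 := ((IntermediateField.inclusion hle).toRingHom).toAlgebra
  haveI : IsScalarTower ↥Ki ↥Ki1 L := IsScalarTower.of_algebraMap_eq (fun x => rfl)
  haveI : IsScalarTower K ↥Ki ↥Ki1 := IsScalarTower.of_algebraMap_eq (fun x => rfl)
  haveI : H'.Normal := ⟨fun a ha g => by rwa [hab g a, mul_inv_cancel_right]⟩
  haveI : IsGalois K ↥Ki1 := by rw [hKi1]; exact IsGalois.of_fixedField_normal_subgroup H'
  haveI : IsGalois ↥Ki ↥Ki1 := IsGalois.tower_top_of_isGalois K ↥Ki ↥Ki1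
  have hfd : Module.finrank ↥Ki ↥Ki1 = p := by
    have := Module.finrank_mul_finrank ↥Ki ↥Ki1 L
    rw [hf0, hf1, show n + 1 - i = (n - i) + 1 by omega, pow_succ, mul_comm] at this
    exact Nat.eq_of_mul_eq_mul_left (Nat.pow_pos hpr.pos) this
  obtain ⟨wE, PiE, hPiE, hl, hmain⟩ := HA.final_abs (K := K) (F := ↥Ki) (E := ↥Ki1) (L := L) S hfd (M := p ^ i)
    (by
      intro g hg
      apply hval (g.restrictScalars K)
      · have h1 : g.restrictScalars K ∈ Ki.fixingSubgroup := by
          rw [IntermediateField.mem_fixingSubgroup_iff]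
          intro x hx
          exact g.commutes ⟨x, hx⟩
        rwa [hfixH] at h1
      · intro h2
        apply hg
        intro x
        exact hmem _ x.2 _ h2)
    (π := algebraMap K ↥Ki π) (by
      rw [← IsScalarTower.algebraMap_apply, hπw, hf1, ← IsGalois.card_aut_eq_finrank, hcG]
      congr 1
      push_cast
      rw [mul_left_comm, ← pow_add, show n - i + i = n by omega]) hk
  have hposE : (0 : ℚ) < Module.finrank ↥Ki1 L := by rw [hf1]; exact_mod_cast Nat.pow_pos hpr.pos
  have hNE : HA.NLink vd (emb.comp (Ki1.val : ↥Ki1 →+* L)) wE (Module.finrank ↥Ki1 L * q) := by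
    intro x m
    rw [hl, hN]
    have e : (((Module.finrank ↥Ki1 L * m : ℤ) : ℚ) * q) = (m : ℚ) * (Module.finrank ↥Ki1 L * q) := by
      push_cast; ring
    rw [e]
    rfl
  have hqE : (0 : ℚ) < Module.finrank ↥Ki1 L * q := mul_pos hposE hq
  simp only [hNE.inMax hqE hPiE]
  have hR : ∀ u : ↥Ki, 0 ≤ vd.v ((emb.comp (Ki.val : ↥Ki →+* L)) u) ↔ ((0 : ℤ) : WithTop ℤ) ≤ wE (algebraMap ↥Ki ↥Ki1 u) :=
    fun u => hNE.nonneg (algebraMap ↥Ki ↥Ki1 u)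
  simp only [hR]
  exact hmain

end
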